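/- arXiv:2010.04985 — 2 statements merged into one kernel-verified Lean document; each statement's English description precedes it below -/
import Mathlib

section
/- There exists a universal constant c > 0 such that for every constant δ ∈ (0,1) and all sufficiently large n the following holds: if a binary code C : {0,1}^k → {0,1}^n admits a relaxed local decoder with decoding radius δ and query complexity q, then C admits a sample-based relaxed local decoder with decoding radius δ/2 and sample complexity at most n^{1 − 1/(c·q²·log₂²(q+2))}. -/
open scoped Classical

/-- Decision trees over strings in `Fin n → A` with outputs in `O`: internal nodes are
labeled by coordinates, with one child per symbol, and leaves are labeled by outputs. -/
inductive DTree (A : Type) (n : ℕ) (O : Type) : Type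
  | leaf : O → DTree A n O
  | node : Fin n → (A → DTree A n O) → DTree A n O

namespace DTree

/-- Evaluate a decision tree on input `x`, following the path determined by `x`. -/
def eval {A O : Type} {n : ℕ} : DTree A n O → (Fin n → A) → O
  | leaf b, _ => b
  | node i ts, x => (ts (x i)).eval x

/-- The set of coordinates queried by a decision tree on input `x`. -/
def queries {A O : Type} {n : ℕ} : DTree A n O → (Fin n → A) → Finset (Fin n)
  | leaf _, _ => ∅
  | node i ts, x => insert i ((ts (x i)).queries x)

/-- The depth (maximum number of queries along a branch) of a decision tree. -/
def depth {A O : Type} [Fintype A] {n : ℕ} : DTree A n O → ℕ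
  | leaf _ => 0
  | node _ ts => 1 + Finset.univ.sup fun a => (ts a).depth

end DTree

/-- A randomized local algorithm is modeled as a finite multiset `M` of decision trees,
one per outcome of the coin flips (uniformly distributed).  `prP M x P` is the
probability, over a uniformly random tree of `M`, that the output on input `x`
satisfies `P`. -/
noncomputable def prP {A O : Type} {n : ℕ} (M : Multiset (DTree A n O)) (x : Fin n → A)
    (P : O → Prop) : ℝ :=
  ((Multiset.countP (fun t => P (t.eval x)) M : ℕ) : ℝ) / ((Multiset.card M : ℕ) : ℝ)

/-- Relative Hamming distance on `Fin n → A`. -/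
noncomputable def relDist {A : Type} [DecidableEq A] {n : ℕ} (x y : Fin n → A) : ℝ :=
  ((Finset.univ.filter fun i => x i ≠ y i).card : ℝ) / (n : ℝ)

/-- A sample-based algorithm over `Σⁿ` with outputs in `O`: it selects a random set `Q`
of coordinates by including each coordinate independently with probability `p`, reads
the input restricted to `Q`, and outputs a randomized value in `O` whose distribution
depends only on `Q` and the restriction of the input to `Q`. -/
structure SampleAlg (A : Type) (n : ℕ) (O : Type) [Fintype O] where
  /-- the sampling probability -/
  p : ℝ
  /-- `out Q x o` is the probability of outputting `o` given sample set `Q` on input `x` -/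
  out : Finset (Fin n) → ((Fin n) → A) → O → ℝ
  p_nonneg : 0 ≤ p
  p_le_one : p ≤ 1
  out_nonneg : ∀ Q x o, 0 ≤ out Q x o
  out_sum : ∀ Q x, ∑ o, out Q x o = 1
  local_out : ∀ Q x y, (∀ i ∈ Q, x i = y i) → out Q x = out Q y

namespace SampleAlg

/-- The probability that the output of the sample-based algorithm `N` on input `x`
satisfies `P`, over the binomial choice of the sample set and the internal
randomness. -/
noncomputable def pr {A O : Type} [Fintype O] {n : ℕ} (N : SampleAlg A n O)
    (x : (Fin n) → A) (P : O → Prop) : ℝ :=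
  ∑ Q : Finset (Fin n),
    N.p ^ Q.card * (1 - N.p) ^ (n - Q.card) * ∑ o : O, if P o then N.out Q x o else 0

/-- `N` has sample complexity at most `s`: it enforces the cap `s`, i.e. whenever the
number of sampled coordinates exceeds `s` it ignores the input (outputs arbitrarily,
without reading the samples). -/
def complexityLE {A O : Type} [Fintype O] {n : ℕ} (N : SampleAlg A n O) (s : ℝ) : Prop :=
  ∀ Q : Finset (Fin n), s < (Q.card : ℝ) → ∀ x y, N.out Q x = N.out Q y

end SampleAlg


namespace RLDC

open Finset

/-- weight of a sample set -/
noncomputable def W {n : ℕ} (p : ℝ) (Q : Finset (Fin n)) : ℝ :=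
  p ^ Q.card * (1 - p) ^ (n - Q.card)

/-- expectation over the binomial sample set -/
noncomputable def Ex {n : ℕ} (p : ℝ) (f : Finset (Fin n) → ℝ) : ℝ := ∑ Q, W p Q * f Q

/-- probability over the binomial sample set -/
noncomputable def Pb {n : ℕ} (p : ℝ) (E : Finset (Fin n) → Prop) : ℝ :=
  Ex p (fun Q => if E Q then 1 else 0)

section
variable {n : ℕ} {p : ℝ}

lemma W_nonneg (h0 : 0 ≤ p) (h1 : p ≤ 1) (Q : Finset (Fin n)) : 0 ≤ W p Q := by
  unfold W
  have : 0 ≤ 1 - p := by linarith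
  positivity

lemma Ex_mono (h0 : 0 ≤ p) (h1 : p ≤ 1) {f g : Finset (Fin n) → ℝ} (h : ∀ Q, f Q ≤ g Q) :
    Ex p f ≤ Ex p g :=
  Finset.sum_le_sum fun Q _ => mul_le_mul_of_nonneg_left (h Q) (W_nonneg h0 h1 Q)

lemma Ex_mul (a : ℝ) (f : Finset (Fin n) → ℝ) : Ex p (fun Q => a * f Q) = a * Ex p f := by
  unfold Ex
  rw [Finset.mul_sum]
  exact Finset.sum_congr rfl fun Q _ => by ring

lemma Ex_add (f g : Finset (Fin n) → ℝ) : Ex p (fun Q => f Q + g Q) = Ex p f + Ex p g := by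
  unfold Ex
  rw [← Finset.sum_add_distrib]
  exact Finset.sum_congr rfl fun Q _ => by ring

lemma Ex_sum {ι : Type} (s : Finset ι) (f : ι → Finset (Fin n) → ℝ) :
    Ex p (fun Q => ∑ t ∈ s, f t Q) = ∑ t ∈ s, Ex p (f t) := by
  unfold Ex
  rw [Finset.sum_comm]
  exact Finset.sum_congr rfl fun Q _ => by rw [Finset.mul_sum]

lemma Ex_superset (A : Finset (Fin n)) :
    Ex p (fun Q => if A ⊆ Q then (1:ℝ) else 0) = p ^ A.card := by
  have h := Finset.prod_add (fun _ : Fin n => p) (fun i => if i ∈ A then (0:ℝ) else 1 - p)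
    Finset.univ
  have h1 : ∏ i : Fin n, (p + if i ∈ A then (0:ℝ) else 1 - p) = p ^ A.card := by
    have : ∀ i : Fin n, (p + if i ∈ A then (0:ℝ) else 1 - p) = if i ∈ A then p else 1 := by
      intro i; split_ifs <;> ring
    simp only [this]
    rw [Finset.prod_ite_mem]
    simp
  rw [h1] at h
  rw [h, Finset.powerset_univ]
  unfold Ex W
  refine Finset.sum_congr rfl fun Q _ => ?_
  rw [Finset.prod_const, mul_assoc]
  congr 1
  beta_reduce
  by_cases hA : A ⊆ Q
  · rw [if_pos hA, Finset.prod_congr rfl (g := fun _ => 1 - p), Finset.prod_const]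
    · rw [Finset.card_sdiff_of_subset (Finset.subset_univ _)]; simp
    · intro i hi
      have : i ∉ A := fun h => (Finset.mem_sdiff.1 hi).2 (hA h)
      simp [this]
  · rw [if_neg hA, mul_zero]
    obtain ⟨i, hi, hiQ⟩ := Finset.not_subset.1 hA
    symm
    apply Finset.prod_eq_zero (i := i)
    · simp [hiQ]
    · simp [hi]

lemma Ex_one : Ex p (fun _ : Finset (Fin n) => (1:ℝ)) = 1 := by
  have := Ex_superset (p := p) (∅ : Finset (Fin n))
  simpa using this

lemma Pb_mono (h0 : 0 ≤ p) (h1 : p ≤ 1) {E F : Finset (Fin n) → Prop} (h : ∀ Q, E Q → F Q) :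
    Pb p E ≤ Pb p F := by
  apply Ex_mono h0 h1
  intro Q
  by_cases hE : E Q
  · simp [hE, h Q hE]
  · simp only [hE, if_false]; split_ifs <;> norm_num

lemma Pb_le_of_markov (h0 : 0 ≤ p) (h1 : p ≤ 1) {E : Finset (Fin n) → Prop}
    {f : Finset (Fin n) → ℝ} {a b : ℝ} (ha : 0 < a) (hf : ∀ Q, 0 ≤ f Q)
    (hE : ∀ Q, E Q → a ≤ f Q) (hb : Ex p f ≤ b) : Pb p E ≤ b / a := by
  rw [le_div_iff₀ ha, mul_comm]
  unfold Pb
  rw [← Ex_mul]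
  refine le_trans (Ex_mono h0 h1 fun Q => ?_) hb
  split_ifs with h
  · simpa using hE Q h
  · simpa using hf Q

lemma Pb_union {κ : Type} (h0 : 0 ≤ p) (h1 : p ≤ 1) (s : Finset κ)
    (E : κ → Finset (Fin n) → Prop) (F : Finset (Fin n) → Prop)
    (h : ∀ Q, F Q → ∃ k ∈ s, E k Q) : Pb p F ≤ ∑ k ∈ s, Pb p (E k) := by
  unfold Pb
  rw [← Ex_sum]
  apply Ex_mono h0 h1
  intro Q
  split_ifs with hF
  · obtain ⟨k, hk, hE⟩ := h Q hF
    refine le_trans ?_ (Finset.single_le_sum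
      (f := fun k => if E k Q then (1:ℝ) else 0) (fun i _ => ?_) hk)
    · simp [hE]
    · split_ifs <;> norm_num
  · apply Finset.sum_nonneg
    intro i _; split_ifs <;> norm_num

/-- Second-moment bound for weighted sums of containment indicators. -/
lemma cheb {ι : Type} (s : Finset ι) (P : ι → Finset (Fin n)) (μ : ι → ℝ)
    (hp : 0 < p) (h1 : p ≤ 1) (hμ : ∀ t ∈ s, 0 ≤ μ t) (r : ℕ) (hP : ∀ t ∈ s, (P t).card ≤ r)
    (θ : ℝ) (hθ : ∀ v, (∃ t ∈ s, v ∈ P t) → ∑ t ∈ s with v ∈ P t, μ t ≤ θ) (hθ0 : 0 ≤ θ) :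
    Ex p (fun Q => (∑ t ∈ s, (μ t * (p⁻¹) ^ (P t).card) * (if P t ⊆ Q then 1 else 0)
      - ∑ t ∈ s, μ t) ^ 2) ≤ (∑ t ∈ s, μ t) * (r * θ * (p⁻¹) ^ r) := by
  set M := ∑ t ∈ s, μ t with hM
  have hpi : 1 ≤ p⁻¹ := (one_le_inv₀ hp).2 h1
  have e1 : Ex p (fun Q => ∑ t ∈ s, (μ t * (p⁻¹) ^ (P t).card) * (if P t ⊆ Q then (1:ℝ) else 0))
      = M := by
    rw [Ex_sum]
    refine Finset.sum_congr rfl fun t _ => ?_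
    rw [Ex_mul, Ex_superset, mul_assoc, ← mul_pow, inv_mul_cancel₀ hp.ne', one_pow, mul_one]
  have e2 : Ex p (fun Q => (∑ t ∈ s, (μ t * (p⁻¹) ^ (P t).card) *
      (if P t ⊆ Q then (1:ℝ) else 0)) ^ 2)
      = ∑ t ∈ s, ∑ t' ∈ s, μ t * μ t' * (p⁻¹) ^ (P t ∩ P t').card := by
    have : ∀ Q : Finset (Fin n), (∑ t ∈ s, (μ t * (p⁻¹) ^ (P t).card) *
      (if P t ⊆ Q then (1:ℝ) else 0)) ^ 2 = ∑ t ∈ s, ∑ t' ∈ s,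
        (μ t * μ t' * (p⁻¹) ^ (P t).card * (p⁻¹) ^ (P t').card) *
          (if P t ∪ P t' ⊆ Q then (1:ℝ) else 0) := by
      intro Q
      rw [sq, Finset.sum_mul_sum]
      refine Finset.sum_congr rfl fun t _ => Finset.sum_congr rfl fun t' _ => ?_
      by_cases h : P t ⊆ Q <;> by_cases h' : P t' ⊆ Q <;>
        simp [h, h', Finset.union_subset_iff]
      ring
    simp only [this]
    rw [Ex_sum]
    refine Finset.sum_congr rfl fun t _ => ?_
    rw [Ex_sum]
    refine Finset.sum_congr rfl fun t' _ => ?_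
    rw [Ex_mul, Ex_superset]
    have hc := Finset.card_union_add_card_inter (P t) (P t')
    have h3 : (p⁻¹) ^ (P t).card * (p⁻¹) ^ (P t').card
        = (p⁻¹) ^ (P t ∪ P t').card * (p⁻¹) ^ (P t ∩ P t').card := by
      rw [← pow_add, ← pow_add, hc]
    rw [mul_assoc (μ t * μ t'), h3]
    have h4 : (p⁻¹) ^ (P t ∪ P t').card * p ^ (P t ∪ P t').card = 1 := by
      rw [← mul_pow, inv_mul_cancel₀ hp.ne', one_pow]
    linear_combination (μ t * μ t' * (p⁻¹) ^ (P t ∩ P t').card) * h4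
  have e3 : Ex p (fun Q => (∑ t ∈ s, (μ t * (p⁻¹) ^ (P t).card) * (if P t ⊆ Q then 1 else 0)
      - M) ^ 2) = ∑ t ∈ s, ∑ t' ∈ s, μ t * μ t' * (p⁻¹) ^ (P t ∩ P t').card - M ^ 2 := by
    have : ∀ Q : Finset (Fin n), (∑ t ∈ s, (μ t * (p⁻¹) ^ (P t).card) *
        (if P t ⊆ Q then 1 else 0) - M) ^ 2 =
        ((∑ t ∈ s, (μ t * (p⁻¹) ^ (P t).card) * (if P t ⊆ Q then 1 else 0)) ^ 2
        + (-(2 * M)) * (∑ t ∈ s, (μ t * (p⁻¹) ^ (P t).card) * (if P t ⊆ Q then 1 else 0)))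
        + M ^ 2 * 1 := by
      intro Q; ring
    simp only [this]
    rw [Ex_add, Ex_add, Ex_mul, Ex_mul, Ex_one, e1, e2]; ring
  rw [e3]
  have e4 : M ^ 2 = ∑ t ∈ s, ∑ t' ∈ s, μ t * μ t' := by
    rw [sq, hM, Finset.sum_mul_sum]
  rw [e4, ← Finset.sum_sub_distrib, hM, Finset.sum_mul]
  refine Finset.sum_le_sum fun t ht => ?_
  rw [← Finset.sum_sub_distrib]
  have h5 : ∀ t' ∈ s, μ t * μ t' * (p⁻¹) ^ (P t ∩ P t').card - μ t * μ t' ≤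
      μ t * (p⁻¹) ^ r * ∑ v ∈ P t, if v ∈ P t' then μ t' else 0 := by
    intro t' ht'
    by_cases hd : P t ∩ P t' = ∅
    · rw [hd]
      simp only [Finset.card_empty, pow_zero, mul_one, sub_self]
      apply mul_nonneg (mul_nonneg (hμ t ht) (by positivity))
      apply Finset.sum_nonneg
      intro v _; split_ifs
      · exact hμ t' ht'
      · exact le_rfl
    · obtain ⟨v, hv⟩ := Finset.nonempty_iff_ne_empty.2 hd
      rw [Finset.mem_inter] at hv
      have h6 : μ t' ≤ ∑ v ∈ P t, if v ∈ P t' then μ t' else 0 := by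
        refine le_trans ?_ (Finset.single_le_sum
          (f := fun v => if v ∈ P t' then μ t' else 0) (fun i _ => ?_) hv.1)
        · simp [hv.2]
        · split_ifs
          · exact hμ t' ht'
          · exact le_rfl
      have h7 : (p⁻¹) ^ (P t ∩ P t').card ≤ (p⁻¹) ^ r :=
        pow_le_pow_right₀ hpi ((Finset.card_le_card Finset.inter_subset_left).trans (hP t ht))
      have h8 : 0 ≤ μ t * μ t' := mul_nonneg (hμ t ht) (hμ t' ht')
      calc _ ≤ μ t * μ t' * (p⁻¹) ^ (P t ∩ P t').card := by linarith
        _ ≤ μ t * μ t' * (p⁻¹) ^ r := by gcongr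
        _ = μ t * (p⁻¹) ^ r * μ t' := by ring
        _ ≤ _ := mul_le_mul_of_nonneg_left h6 (mul_nonneg (hμ t ht) (by positivity))
  refine (Finset.sum_le_sum h5).trans ?_
  rw [← Finset.mul_sum, Finset.sum_comm]
  have h9 : ∑ v ∈ P t, ∑ t' ∈ s, (if v ∈ P t' then μ t' else 0) ≤ r * θ := by
    calc _ ≤ ∑ v ∈ P t, θ := by
          refine Finset.sum_le_sum fun v hv => ?_
          rw [← Finset.sum_filter]
          exact hθ v ⟨t, ht, hv⟩
      _ = (P t).card * θ := by simp
      _ ≤ r * θ := by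
          gcongr
          exact_mod_cast hP t ht
  calc μ t * (p⁻¹) ^ r * _ ≤ μ t * (p⁻¹) ^ r * (r * θ) :=
        mul_le_mul_of_nonneg_left h9 (mul_nonneg (hμ t ht) (by positivity))
    _ = _ := by ring

/-- Chebyshev for the size of the sample. -/
lemma card_cheb (hp : 0 < p) (h1 : p ≤ 1) (lam : ℝ) (hl : 0 < lam) (E : Finset (Fin n) → Prop)
    (hE : ∀ Q, E Q → lam ^ 2 ≤ ((Q.card : ℝ) - n * p) ^ 2) :
    Pb p E ≤ n * p / lam ^ 2 := by
  have h := cheb (p := p) (Finset.univ : Finset (Fin n)) (fun v => {v}) (fun _ => p) hp h1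
    (fun _ _ => hp.le) 1 (by simp) p (by
      intro v _
      have : (Finset.univ.filter fun t : Fin n => v ∈ ({t} : Finset (Fin n))) = {v} := by
        ext t; simp [eq_comm]
      rw [this]; simp) hp.le
  refine Pb_le_of_markov hp.le h1 (by positivity) (fun Q => sq_nonneg _) ?_ (h.trans ?_)
  · intro Q hQ
    have e : ∑ t : Fin n, (p * (p⁻¹) ^ ({t} : Finset (Fin n)).card) *
        (if ({t} : Finset (Fin n)) ⊆ Q then (1:ℝ) else 0) = Q.card := by
      simp [hp.ne']
    rw [e]
    simpa using hE Q hQ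
  · simp [hp.ne']

/-- Iterated sum over disjoint tuples of sampled sets. -/
noncomputable def Z {ι : Type} (F : Finset ι) (P : ι → Finset (Fin n)) (ν : ι → ℝ)
    (Q : Finset (Fin n)) : ℕ → Finset (Fin n) → ℝ
  | 0, _ => 1
  | m + 1, A => ∑ t ∈ F, if P t ⊆ Q ∧ Disjoint (P t) A then ν t * Z F P ν Q m (A ∪ P t) else 0

lemma Z_nonneg {ι : Type} (F : Finset ι) (P : ι → Finset (Fin n)) (ν : ι → ℝ)
    (hν : ∀ t, 0 ≤ ν t) (Q : Finset (Fin n)) (m : ℕ) (A : Finset (Fin n)) :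
    0 ≤ Z F P ν Q m A := by
  induction m generalizing A with
  | zero => simp [Z]
  | succ m ih =>
    simp only [Z]
    apply Finset.sum_nonneg
    intro t _
    split_ifs
    · exact mul_nonneg (hν t) (ih _)
    · exact le_rfl

lemma Z_Ex {ι : Type} (F : Finset ι) (P : ι → Finset (Fin n)) (μ : ι → ℝ)
    (hμ : ∀ t, 0 ≤ μ t) (hp : 0 < p) (ε : ℝ) (hε : ∑ t ∈ F, μ t ≤ ε)
    (m : ℕ) (A : Finset (Fin n)) :
    Ex p (fun Q => (if A ⊆ Q then 1 else 0) * Z F P (fun t => μ t * (p⁻¹) ^ (P t).card) Q m A)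
      ≤ p ^ A.card * ε ^ m := by
  have hε0 : 0 ≤ ε := (Finset.sum_nonneg fun t _ => hμ t).trans hε
  induction m generalizing A with
  | zero => simp [Z, Ex_superset]
  | succ m ih =>
    set ν := fun t => μ t * (p⁻¹) ^ (P t).card with hν
    have h : ∀ Q : Finset (Fin n), (if A ⊆ Q then (1:ℝ) else 0) * Z F P ν Q (m+1) A
        = ∑ t ∈ F, (if Disjoint (P t) A then ν t else 0) *
            ((if A ∪ P t ⊆ Q then (1:ℝ) else 0) * Z F P ν Q m (A ∪ P t)) := by
      intro Q
      simp only [Z]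
      rw [Finset.mul_sum]
      refine Finset.sum_congr rfl fun t _ => ?_
      by_cases a1 : A ⊆ Q <;> by_cases a2 : P t ⊆ Q <;> by_cases a3 : Disjoint (P t) A <;>
        simp [a1, a2, a3, Finset.union_subset_iff]
    simp only [h]
    rw [Ex_sum]
    calc _ ≤ ∑ t ∈ F, μ t * (p ^ A.card * ε ^ m) := by
          refine Finset.sum_le_sum fun t _ => ?_
          rw [Ex_mul]
          by_cases a3 : Disjoint (P t) A
          · rw [if_pos a3]
            have hc : (A ∪ P t).card = A.card + (P t).card :=
              Finset.card_union_of_disjoint a3.symm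
            have hν0 : 0 ≤ ν t := mul_nonneg (hμ t) (by positivity)
            refine (mul_le_mul_of_nonneg_left (ih (A ∪ P t)) hν0).trans (le_of_eq ?_)
            rw [hc, pow_add]
            have h4 : (p⁻¹) ^ (P t).card * p ^ (P t).card = 1 := by
              rw [← mul_pow, inv_mul_cancel₀ hp.ne', one_pow]
            simp only [hν]
            linear_combination (μ t * p ^ A.card * ε ^ m) * h4
          · rw [if_neg a3, zero_mul]
            have := hμ t
            positivity
      _ = (∑ t ∈ F, μ t) * (p ^ A.card * ε ^ m) := by rw [Finset.sum_mul]
      _ ≤ ε * (p ^ A.card * ε ^ m) := by gcongr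
      _ = _ := by ring

lemma Z_lower {ι : Type} (F F' : Finset ι) (hF : F' ⊆ F) (P : ι → Finset (Fin n)) (ν : ι → ℝ)
    (hν : ∀ t, 0 ≤ ν t) (Q : Finset (Fin n)) (hQ : ∀ t ∈ F', P t ⊆ Q) (r : ℕ)
    (hP : ∀ t ∈ F', (P t).card ≤ r) (D a : ℝ) (hD0 : 0 ≤ D) (ha : 0 ≤ a)
    (hD : ∀ v, ∑ t ∈ F' with v ∈ P t, ν t ≤ D) (hs : a ≤ ∑ t ∈ F', ν t)
    (m : ℕ) (A : Finset (Fin n)) (hm : ((A.card : ℝ) + m * r) * D ≤ a / 2) :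
    (a / 2) ^ m ≤ Z F P ν Q m A := by
  induction m generalizing A with
  | zero => simp [Z]
  | succ m ih =>
    simp only [Z]
    have hpos : ∀ t ∈ F, 0 ≤ (if P t ⊆ Q ∧ Disjoint (P t) A then
        ν t * Z F P ν Q m (A ∪ P t) else 0) := by
      intro t _
      split_ifs
      · exact mul_nonneg (hν t) (Z_nonneg F P ν hν Q m _)
      · exact le_rfl
    refine le_trans ?_ (Finset.sum_le_sum_of_subset_of_nonneg hF fun t ht _ => hpos t ht)
    have hb : ∑ t ∈ F', ν t ≤ (∑ t ∈ F', if Disjoint (P t) A then ν t else 0) + A.card * D := by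
      have h1 : ∑ t ∈ F', (if Disjoint (P t) A then 0 else ν t) ≤ A.card * D := by
        calc _ ≤ ∑ t ∈ F', ∑ v ∈ A, (if v ∈ P t then ν t else 0) := by
              refine Finset.sum_le_sum fun t _ => ?_
              have hnn : ∀ v ∈ A, 0 ≤ (if v ∈ P t then ν t else 0) := by
                intro v _; split_ifs
                · exact hν t
                · exact le_rfl
              split_ifs with hd
              · exact Finset.sum_nonneg hnn
              · obtain ⟨v, hv, hvA⟩ := Finset.not_disjoint_iff.1 hd
                refine le_trans ?_ (Finset.single_le_sum hnn hvA)
                simp [hv]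
          _ = ∑ v ∈ A, ∑ t ∈ F' with v ∈ P t, ν t := by
              rw [Finset.sum_comm]
              exact Finset.sum_congr rfl fun v _ => by rw [Finset.sum_filter]
          _ ≤ ∑ v ∈ A, D := Finset.sum_le_sum fun v _ => hD v
          _ = A.card * D := by simp
      have h2 : ∑ t ∈ F', ν t = (∑ t ∈ F', if Disjoint (P t) A then ν t else 0) +
          ∑ t ∈ F', (if Disjoint (P t) A then 0 else ν t) := by
        rw [← Finset.sum_add_distrib]
        refine Finset.sum_congr rfl fun t _ => ?_
        split_ifs <;> simp
      linarith
    have hA : (A.card : ℝ) * D ≤ a / 2 := by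
      refine le_trans ?_ hm
      gcongr
      have : (0:ℝ) ≤ ((m + 1 : ℕ) : ℝ) * r := by positivity
      linarith
    have hc : a / 2 ≤ ∑ t ∈ F', if Disjoint (P t) A then ν t else 0 := by linarith
    calc (a/2)^(m+1) = (a/2) * (a/2)^m := by ring
      _ ≤ (∑ t ∈ F', if Disjoint (P t) A then ν t else 0) * (a/2)^m := by gcongr
      _ = ∑ t ∈ F', (if Disjoint (P t) A then ν t else 0) * (a/2)^m := by rw [Finset.sum_mul]
      _ ≤ _ := by
        refine Finset.sum_le_sum fun t ht => ?_
        by_cases a3 : Disjoint (P t) A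
        · rw [if_pos a3, if_pos ⟨hQ t ht, a3⟩]
          refine mul_le_mul_of_nonneg_left (ih _ ?_) (hν t)
          refine le_trans (mul_le_mul_of_nonneg_right ?_ hD0) hm
          have hc : (A ∪ P t).card ≤ A.card + r :=
            (Finset.card_union_le _ _).trans (by have := hP t ht; omega)
          have hc' : ((A ∪ P t).card : ℝ) ≤ A.card + r := by exact_mod_cast hc
          push_cast
          linarith
        · rw [if_neg a3, zero_mul]
          split_ifs
          · exact mul_nonneg (hν t) (Z_nonneg F P ν hν Q m _)
          · exact le_rfl

/-- Upper tail, uniformly over sub-families of bounded degree. -/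
lemma packing {ι : Type} (F : Finset ι) (P : ι → Finset (Fin n)) (μ : ι → ℝ)
    (hμ : ∀ t, 0 ≤ μ t) (hp : 0 < p) (h1 : p ≤ 1) (a : ℝ) (ha : 0 < a)
    (hε : ∑ t ∈ F, μ t ≤ a / 4) (r m : ℕ) (D : ℝ) (hD0 : 0 ≤ D) (hm : (m * r : ℝ) * D ≤ a / 2) :
    Pb p (fun Q => ∃ F' ⊆ F, (∀ t ∈ F', P t ⊆ Q) ∧ (∀ t ∈ F', (P t).card ≤ r) ∧
      (∀ v, ∑ t ∈ F' with v ∈ P t, μ t * (p⁻¹) ^ (P t).card ≤ D) ∧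
      a ≤ ∑ t ∈ F', μ t * (p⁻¹) ^ (P t).card) ≤ (1/2)^m := by
  have hν : ∀ t, 0 ≤ μ t * (p⁻¹) ^ (P t).card := fun t => mul_nonneg (hμ t) (by positivity)
  have key : Ex p (fun Q => Z F P (fun t => μ t * (p⁻¹) ^ (P t).card) Q m ∅) ≤ (a/4)^m := by
    have := Z_Ex F P μ hμ hp (a/4) hε m ∅
    simpa using this
  refine (Pb_le_of_markov hp.le h1 (a := (a/2)^m) (by positivity)
    (fun Q => Z_nonneg F P _ hν Q m ∅) ?_ key).trans (le_of_eq ?_)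
  · rintro Q ⟨F', hF, hQ, hr, hD, hs⟩
    exact Z_lower F F' hF P _ hν Q hQ r hr D a hD0 ha.le hD hs m ∅ (by simpa using hm)
  · rw [← div_pow]; congr 1; field_simp; norm_num
end

section core
variable {n : ℕ}

/-- overwritten coordinates of an encoded partial assignment -/
noncomputable def encK {s : ℕ} (e : Fin s → Option (Fin n × Bool)) : Finset (Fin n) :=
  Finset.univ.filter fun v => ∃ j β, e j = some (v, β)

/-- overwriting `w` by an encoded partial assignment -/
noncomputable def encU {s : ℕ} (w : Fin n → Bool) (e : Fin s → Option (Fin n × Bool)) :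
    Fin n → Bool := fun v =>
  if ∃ j, e j = some (v, true) then true else if ∃ j, e j = some (v, false) then false else w v

lemma encK_card {s : ℕ} (e : Fin s → Option (Fin n × Bool)) : (encK e).card ≤ s := by
  have h : encK e ⊆ Finset.univ.biUnion (fun j => ((e j).map Prod.fst).toFinset) := by
    intro v hv
    obtain ⟨j, β, h⟩ := (Finset.mem_filter.1 hv).2
    simp only [Finset.mem_biUnion, Finset.mem_univ, true_and]
    exact ⟨j, by simp [h]⟩
  refine (Finset.card_le_card h).trans ((Finset.card_biUnion_le_card_mul _ _ 1 ?_).trans ?_)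
  · intro j _
    rw [Option.card_toFinset]
    cases e j <;> simp
  · simp

lemma encU_off {s : ℕ} (w : Fin n → Bool) (e : Fin s → Option (Fin n × Bool)) (v : Fin n)
    (hv : v ∉ encK e) : encU w e v = w v := by
  have h : ∀ j β, e j ≠ some (v, β) := by
    intro j β h
    exact hv (Finset.mem_filter.2 ⟨Finset.mem_univ _, j, β, h⟩)
  simp [encU, h]

lemma enc_surj {s : ℕ} (K : Finset (Fin n)) (hK : K.card ≤ s) (z w : Fin n → Bool) :
    ∃ e : Fin s → Option (Fin n × Bool), encK e = K ∧
      ∀ v, encU w e v = if v ∈ K then z v else w v := by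
  set e : Fin s → Option (Fin n × Bool) := fun j => (K.toList[(j:ℕ)]?).map fun v => (v, z v)
    with he
  have key : ∀ v β, (∃ j, e j = some (v, β)) ↔ v ∈ K ∧ z v = β := by
    intro v β
    constructor
    · rintro ⟨j, h⟩
      simp only [he, Option.map_eq_some_iff, Prod.mk.injEq] at h
      obtain ⟨u, hu, rfl, h2⟩ := h
      exact ⟨Finset.mem_toList.1 (List.mem_of_getElem? hu), h2⟩
    · rintro ⟨hv, rfl⟩
      obtain ⟨j, hj⟩ := List.mem_iff_getElem?.1 (Finset.mem_toList.2 hv)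
      have hlt : j < K.toList.length := by
        by_contra hcon
        rw [List.getElem?_eq_none (by omega)] at hj
        simp at hj
      rw [Finset.length_toList] at hlt
      exact ⟨⟨j, by omega⟩, by simp [he, hj]⟩
  refine ⟨e, ?_, ?_⟩
  · ext v
    simp only [encK, Finset.mem_filter, Finset.mem_univ, true_and]
    rw [exists_comm]
    simp only [key]
    simp
  · intro v
    simp only [encU, key]
    by_cases hv : v ∈ K <;> cases hz : z v <;> simp [hv]

variable {ι : Type} [Fintype ι] (μ : ι → ℝ) (Qs : ι → (Fin n → Bool) → Finset (Fin n))

/-- probability that coordinate `v` is queried on input `z` -/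
noncomputable def deg (z : Fin n → Bool) (v : Fin n) : ℝ := ∑ t with v ∈ Qs t z, μ t

/-- kernel -/
noncomputable def Ker (θ : ℕ → ℝ) (g : ℕ) (z : Fin n → Bool) : Finset (Fin n) :=
  Finset.univ.filter fun v => θ (g + 1) ≤ deg μ Qs z v

/-- petal -/
noncomputable def Pet (θ : ℕ → ℝ) (g : ℕ) (z : Fin n → Bool) (t : ι) : Finset (Fin n) :=
  Qs t z \ Ker μ Qs θ g z

/-- the query set avoids the gap between consecutive thresholds -/
def Avoid (θ : ℕ → ℝ) (g : ℕ) (z : Fin n → Bool) (t : ι) : Prop :=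
  ∀ v ∈ Qs t z, ¬ (θ g ≤ deg μ Qs z v ∧ deg μ Qs z v < θ (g + 1))

lemma Ker_card (hμ : ∀ t, 0 ≤ μ t) (hμ1 : ∑ t, μ t = 1) (r : ℕ)
    (hr : ∀ t z, (Qs t z).card ≤ r) (θ : ℕ → ℝ) (hθ : ∀ g, 0 < θ g) (g : ℕ) (z : Fin n → Bool) :
    ((Ker μ Qs θ g z).card : ℝ) ≤ r / θ (g + 1) := by
  rw [le_div_iff₀ (hθ _)]
  have hdeg : ∀ v, 0 ≤ deg μ Qs z v := fun v => Finset.sum_nonneg fun t _ => hμ t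
  calc ((Ker μ Qs θ g z).card : ℝ) * θ (g+1) = ∑ v ∈ Ker μ Qs θ g z, θ (g+1) := by simp
    _ ≤ ∑ v ∈ Ker μ Qs θ g z, deg μ Qs z v :=
        Finset.sum_le_sum fun v hv => (Finset.mem_filter.1 hv).2
    _ ≤ ∑ v, deg μ Qs z v :=
        Finset.sum_le_sum_of_subset_of_nonneg (Finset.subset_univ _) fun v _ _ => hdeg v
    _ = ∑ t, ((Qs t z).card : ℝ) * μ t := by
        unfold deg
        simp only [Finset.sum_filter]
        rw [Finset.sum_comm]
        refine Finset.sum_congr rfl fun t _ => ?_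
        rw [← Finset.sum_filter]
        simp
    _ ≤ ∑ t, (r : ℝ) * μ t := by
        refine Finset.sum_le_sum fun t _ => mul_le_mul_of_nonneg_right ?_ (hμ t)
        exact_mod_cast hr t z
    _ = r := by rw [← Finset.mul_sum, hμ1, mul_one]

lemma avoid_exists (r : ℕ) (hr : ∀ t z, (Qs t z).card ≤ r) (θ : ℕ → ℝ) (hθ : Monotone θ)
    (z : Fin n → Bool) (t : ι) : ∃ g ∈ Finset.range (r + 1), Avoid μ Qs θ g z t := by
  by_contra hcon
  push Not at hcon
  unfold Avoid at hcon
  push Not at hcon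
  have : Nonempty (Fin n) := ⟨(hcon 0 (by simp)).choose⟩
  choose! f hf1 hf2 hf3 using hcon
  have hle : (Finset.range (r+1)).card ≤ (Qs t z).card := by
    apply Finset.card_le_card_of_injOn f
    · intro g hg; exact hf1 g hg
    · have aux : ∀ g ∈ Finset.range (r+1), ∀ g' ∈ Finset.range (r+1), f g = f g' → ¬ g < g' := by
        intro g hg g' hg' h hlt
        have h1 := hf3 g hg
        have h2 := hf2 g' hg'
        have h3 : θ (g+1) ≤ θ g' := hθ hlt
        rw [h] at h1
        linarith
      intro g hg g' hg' h
      have h1 := aux g hg g' hg' h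
      have h2 := aux g' hg' g hg h.symm
      omega
  rw [Finset.card_range] at hle
  have := hr t z
  omega

lemma pet_deg (θ : ℕ → ℝ) (g : ℕ) (z : Fin n → Bool) (t : ι) (ha : Avoid μ Qs θ g z t)
    (v : Fin n) (hv : v ∈ Pet μ Qs θ g z t) : deg μ Qs z v ≤ θ g := by
  unfold Pet Ker at hv
  simp only [Finset.mem_sdiff, Finset.mem_filter, Finset.mem_univ, true_and, not_le] at hv
  by_contra hcon
  push Not at hcon
  exact ha v hv.1 ⟨hcon.le, hv.2⟩

variable (sy : Bool → ι → (Fin n → Bool) → Prop)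

/-- trees counted for the candidate `z` at level `g` -/
noncomputable def Cnt (θ : ℕ → ℝ) (b : Bool) (g : ℕ) (z : Fin n → Bool) (Q : Finset (Fin n))
    (w : Fin n → Bool) : Finset ι :=
  Finset.univ.filter fun t => (sy b t z ∧ Avoid μ Qs θ g z t) ∧
    Pet μ Qs θ g z t ⊆ Q ∧ ∀ v ∈ Pet μ Qs θ g z t, w v = z v

/-- weighted vote -/
noncomputable def vote (p : ℝ) (θ : ℕ → ℝ) (b : Bool) (g : ℕ) (z : Fin n → Bool)
    (Q : Finset (Fin n)) (w : Fin n → Bool) : ℝ :=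
  ∑ t ∈ Cnt μ Qs sy θ b g z Q w, μ t * (p⁻¹) ^ (Pet μ Qs θ g z t).card

theorem core {X : Type} (C : X → Fin n → Bool) (bit : X → Bool)
    (hn : 0 < n) (hμ : ∀ t, 0 ≤ μ t) (hμ1 : ∑ t, μ t = 1)
    (hloc : ∀ t z u, (∀ v ∈ Qs t z, u v = z v) →
      Qs t u = Qs t z ∧ ∀ b, sy b t u ↔ sy b t z)
    (r : ℕ) (hr : ∀ t z, (Qs t z).card ≤ r) (δ p a : ℝ)
    (ha : a = 1 / (4 * (r + 1)))
    (hp : 0 < p) (hp1 : p ≤ 1) (θ : ℕ → ℝ) (hθ : ∀ g, 0 < θ g) (hmono : Monotone θ)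
    (L : ℕ) (hL9 : 9 ≤ L) (hLn : 2 * n + 1 ≤ 2 ^ L) (hLr : 9 * (r + 1) ≤ 2 ^ L)
    (hK : ∀ g, g ≤ r → r / θ (g + 1) ≤ δ * n / 2)
    (hm : ∀ g, g ≤ r → (r / θ (g + 1) + 1) * L * r * ((p⁻¹) ^ r * θ g) ≤ a / 2)
    (hcomp : ∀ x, 1 / 2 ≤ ∑ t with sy (bit x) t (C x), μ t)
    (hsound : ∀ x u, relDist u (C x) ≤ δ → ∑ t with sy (!bit x) t u, μ t ≤ a / 4) :
    ∃ S : Bool → Finset (Fin n) → (Fin n → Bool) → Prop,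
      (∀ b Q w w', (∀ v ∈ Q, w v = w' v) → (S b Q w ↔ S b Q w')) ∧
      (∀ x w, relDist w (C x) ≤ δ / 2 → Pb p (fun Q => S (!bit x) Q w) ≤ 1/9) ∧
      (∀ x, Pb p (fun Q => ¬ S (bit x) Q (C x)) ≤ 1/9) := by
  have ha0 : 0 < a := by rw [ha]; positivity
  have hpi : 1 ≤ p⁻¹ := (one_le_inv₀ hp).2 hp1
  have hL0 : (9:ℝ) ≤ L := by exact_mod_cast hL9
  refine ⟨fun b Q w => ∃ x, bit x = b ∧ ∃ g ∈ Finset.range (r+1),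
    a ≤ vote μ Qs sy p θ b g (C x) Q w, ?_, ?_, ?_⟩
  · intro b Q w w' hw
    have : ∀ g z, Cnt μ Qs sy θ b g z Q w = Cnt μ Qs sy θ b g z Q w' := by
      intro g z
      unfold Cnt
      refine Finset.filter_congr fun t _ => and_congr_right fun _ => and_congr_right fun h => ?_
      constructor
      · intro h' v hv; rw [← hw v (h hv)]; exact h' v hv
      · intro h' v hv; rw [hw v (h hv)]; exact h' v hv
    simp only [vote, this]
  · intro x w hw
    -- union bound
    let s : ℕ → ℕ := fun g => ⌊(r : ℝ) / θ (g+1)⌋₊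
    let P : (g : ℕ) → (Fin (s g) → Option (Fin n × Bool)) → ι → Finset (Fin n) :=
      fun g e t => Qs t (encU w e) \ encK e
    let F : (g : ℕ) → (Fin (s g) → Option (Fin n × Bool)) → Finset ι :=
      fun g e => Finset.univ.filter fun t => sy (!bit x) t (encU w e)
    let E : (g : ℕ) → (Fin (s g) → Option (Fin n × Bool)) → Finset (Fin n) → Prop :=
      fun g e Q => ∃ F' ⊆ F g e, (∀ t ∈ F', P g e t ⊆ Q) ∧ (∀ t ∈ F', (P g e t).card ≤ r) ∧
        (∀ v, ∑ t ∈ F' with v ∈ P g e t, μ t * (p⁻¹) ^ (P g e t).card ≤ (p⁻¹)^r * θ g) ∧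
        a ≤ ∑ t ∈ F', μ t * (p⁻¹) ^ (P g e t).card
    have step1 : ∀ Q, (∃ y, bit y = !bit x ∧ ∃ g ∈ Finset.range (r+1),
        a ≤ vote μ Qs sy p θ (!bit x) g (C y) Q w) →
        ∃ g ∈ Finset.range (r+1), ∃ e ∈ (Finset.univ : Finset _), E g e Q := by
      rintro Q ⟨y, -, g, hg, hv⟩
      refine ⟨g, hg, ?_⟩
      set z := C y with hz
      obtain ⟨e, he1, he2⟩ := enc_surj (s := s g) (Ker μ Qs θ g z)
        (Nat.le_floor (Ker_card μ Qs hμ hμ1 r hr θ hθ g z)) z w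
      have hag : ∀ t ∈ Cnt μ Qs sy θ (!bit x) g z Q w,
          Qs t (encU w e) = Qs t z ∧ ∀ b, sy b t (encU w e) ↔ sy b t z := by
        intro t ht
        apply hloc
        intro v hv
        rw [he2]
        split_ifs with hvk
        · rfl
        · exact (Finset.mem_filter.1 ht).2.2.2 v (Finset.mem_sdiff.2 ⟨hv, hvk⟩)
      have hPe : ∀ t ∈ Cnt μ Qs sy θ (!bit x) g z Q w, P g e t = Pet μ Qs θ g z t := by
        intro t ht
        simp only [P, Pet, (hag t ht).1, he1]
      refine ⟨e, Finset.mem_univ _, Cnt μ Qs sy θ (!bit x) g z Q w, ?_, ?_, ?_, ?_, ?_⟩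
      · intro t ht
        exact Finset.mem_filter.2 ⟨Finset.mem_univ _,
          ((hag t ht).2 _).2 (Finset.mem_filter.1 ht).2.1.1⟩
      · intro t ht
        rw [hPe t ht]
        exact (Finset.mem_filter.1 ht).2.2.1
      · intro t ht
        exact (Finset.card_le_card Finset.sdiff_subset).trans (hr _ _)
      · intro v
        by_cases hex : ∃ t ∈ Cnt μ Qs sy θ (!bit x) g z Q w, v ∈ P g e t
        · obtain ⟨t0, ht0, hv0⟩ := hex
          rw [hPe t0 ht0] at hv0
          have hd := pet_deg μ Qs θ g z t0 (Finset.mem_filter.1 ht0).2.1.2 v hv0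
          calc _ ≤ ∑ t ∈ Cnt μ Qs sy θ (!bit x) g z Q w with v ∈ P g e t,
                (p⁻¹)^r * μ t := by
                refine Finset.sum_le_sum fun t ht => ?_
                rw [mul_comm]
                refine mul_le_mul_of_nonneg_right (pow_le_pow_right₀ hpi ?_) (hμ t)
                exact (Finset.card_le_card Finset.sdiff_subset).trans (hr _ _)
            _ ≤ ∑ t with v ∈ Qs t z, (p⁻¹)^r * μ t := by
                apply Finset.sum_le_sum_of_subset_of_nonneg
                · intro t ht
                  rw [Finset.mem_filter] at ht
                  have h2 := ht.2
                  rw [hPe t ht.1] at h2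
                  exact Finset.mem_filter.2 ⟨Finset.mem_univ _, (Finset.mem_sdiff.1 h2).1⟩
                · intro t _ _
                  exact mul_nonneg (by positivity) (hμ t)
            _ = (p⁻¹)^r * deg μ Qs z v := by rw [← Finset.mul_sum]; rfl
            _ ≤ _ := by gcongr
        · rw [Finset.filter_false_of_mem]
          · have := hθ g
            simp only [Finset.sum_empty]; positivity
          · intro t ht h
            exact hex ⟨t, ht, h⟩
      · refine hv.trans (le_of_eq ?_)
        unfold vote
        exact Finset.sum_congr rfl fun t ht => by rw [hPe t ht]
    have step2 : ∀ g ∈ Finset.range (r+1), ∀ e, Pb p (E g e) ≤ (1/2)^((s g + 1) * L) := by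
      intro g hg e
      have hgr : g ≤ r := by simpa [Nat.lt_succ_iff] using hg
      have hs : (s g : ℝ) ≤ r / θ (g+1) := Nat.floor_le (by have := hθ (g+1); positivity)
      refine packing (F g e) (P g e) μ hμ hp hp1 a ha0 ?_ r _ _ ?_ ?_
      · apply hsound
        have hsub : (Finset.univ.filter fun v => encU w e v ≠ C x v) ⊆
            (Finset.univ.filter fun v => w v ≠ C x v) ∪ encK e := by
          intro v hv
          rw [Finset.mem_filter] at hv
          rw [Finset.mem_union, Finset.mem_filter]
          by_cases hk : v ∈ encK e
          · exact Or.inr hk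
          · left
            rw [encU_off w e v hk] at hv
            exact hv
        have hc := (Finset.card_le_card hsub).trans (Finset.card_union_le _ _)
        have hc2 : ((Finset.univ.filter fun v => encU w e v ≠ C x v).card : ℝ) ≤
            (Finset.univ.filter fun v => w v ≠ C x v).card + (encK e).card := by
          exact_mod_cast hc
        have hk : ((encK e).card : ℝ) ≤ s g := by exact_mod_cast encK_card e
        have hk2 := hK g hgr
        have hn' : (0:ℝ) < n := by exact_mod_cast hn
        unfold relDist at hw ⊢
        rw [div_le_iff₀ hn'] at hw ⊢
        linarith
      · have := hθ g
        positivity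
      · refine le_trans ?_ (hm g hgr)
        have := hθ g
        push_cast
        gcongr
    have step3 : ∀ g ∈ Finset.range (r+1), ∑ e, Pb p (E g e) ≤ (1/2)^L := by
      intro g hg
      calc ∑ e, Pb p (E g e) ≤ ∑ e : Fin (s g) → Option (Fin n × Bool),
            (1/2:ℝ)^((s g + 1) * L) := Finset.sum_le_sum fun e _ => step2 g hg e
        _ = ((2 * n + 1 : ℕ) : ℝ) ^ (s g) * (1/2:ℝ)^((s g + 1) * L) := by
            simp [mul_comm]
        _ ≤ ((2:ℝ)^L) ^ (s g) * (1/2:ℝ)^((s g + 1) * L) := by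
            gcongr
            exact_mod_cast hLn
        _ = (1/2)^L := by
            rw [add_mul, pow_add, ← pow_mul, mul_comm L (s g), ← mul_assoc, ← mul_pow]
            norm_num
    calc _ ≤ ∑ g ∈ Finset.range (r+1), Pb p (fun Q => ∃ e ∈ (Finset.univ : Finset _), E g e Q) :=
          Pb_union hp.le hp1 _ _ _ step1
      _ ≤ ∑ g ∈ Finset.range (r+1), (1/2:ℝ)^L := by
          refine Finset.sum_le_sum fun g hg => ?_
          exact (Pb_union hp.le hp1 Finset.univ (E g) _ (fun Q h => h)).trans (step3 g hg)
      _ = (r+1) * (1/2:ℝ)^L := by simp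
      _ ≤ 1/9 := by
          have h : (9 * (r+1) : ℝ) ≤ 2^L := by exact_mod_cast hLr
          rw [one_div, inv_pow, ← div_eq_mul_inv, div_le_div_iff₀ (by positivity) (by norm_num)]
          linarith
  · intro x
    set z := C x with hz
    let Fg : ℕ → Finset ι := fun g => Finset.univ.filter fun t =>
      sy (bit x) t z ∧ Avoid μ Qs θ g z t
    obtain ⟨g, hg, hM⟩ : ∃ g ∈ Finset.range (r+1), 2 * a ≤ ∑ t ∈ Fg g, μ t := by
      by_contra hcon
      push Not at hcon
      have h1 : ∑ g ∈ Finset.range (r+1), ∑ t ∈ Fg g, μ t < ∑ g ∈ Finset.range (r+1), 2 * a :=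
        Finset.sum_lt_sum_of_nonempty ⟨0, by simp⟩ hcon
      have h2 : ∑ g ∈ Finset.range (r+1), 2 * a = 1/2 := by
        simp [ha]; field_simp; norm_num
      have h3 : ∑ t with sy (bit x) t z, μ t ≤ ∑ g ∈ Finset.range (r+1), ∑ t ∈ Fg g, μ t := by
        have : ∀ g, ∑ t ∈ Fg g, μ t = ∑ t with sy (bit x) t z,
            if Avoid μ Qs θ g z t then μ t else 0 := by
          intro g
          simp only [Fg]
          rw [← Finset.sum_filter, Finset.filter_filter]
        simp only [this]
        rw [Finset.sum_comm]
        refine Finset.sum_le_sum fun t _ => ?_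
        obtain ⟨g, hg, hav⟩ := avoid_exists μ Qs r hr θ hmono z t
        refine le_trans ?_ (Finset.single_le_sum
          (f := fun g => if Avoid μ Qs θ g z t then μ t else 0) (fun i _ => ?_) hg)
        · simp [hav]
        · split_ifs
          · exact hμ t
          · exact le_rfl
      have := hcomp x
      linarith
    have hgr : g ≤ r := by simpa [Nat.lt_succ_iff] using hg
    set M := ∑ t ∈ Fg g, μ t with hMdef
    have hch := cheb (p := p) (Fg g) (Pet μ Qs θ g z) μ hp hp1 (fun t _ => hμ t) r
      (fun t _ => (Finset.card_le_card Finset.sdiff_subset).trans (hr _ _)) (θ g) (by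
        rintro v ⟨t0, ht0, hv0⟩
        refine le_trans ?_ (pet_deg μ Qs θ g z t0 (Finset.mem_filter.1 ht0).2.2 v hv0)
        unfold deg
        apply Finset.sum_le_sum_of_subset_of_nonneg
        · intro t ht
          rw [Finset.mem_filter] at ht
          exact Finset.mem_filter.2 ⟨Finset.mem_univ _, (Finset.mem_sdiff.1 ht.2).1⟩
        · intro t _ _
          exact hμ t) (hθ g).le
    rw [← hMdef] at hch
    have hvar : (r:ℝ) * θ g * (p⁻¹)^r ≤ a / 18 := by
      have h1 := hm g hgr
      have h2 : (9:ℝ) * (r * θ g * (p⁻¹)^r) ≤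
          (r / θ (g + 1) + 1) * L * r * ((p⁻¹) ^ r * θ g) := by
        have h3 : (9:ℝ) ≤ (r / θ (g + 1) + 1) * L := by
          have : (0:ℝ) ≤ r / θ (g+1) := by have := hθ (g+1); positivity
          nlinarith
        have h4 : (0:ℝ) ≤ r * θ g * (p⁻¹)^r := by have := hθ g; positivity
        calc _ ≤ (r / θ (g + 1) + 1) * L * (r * θ g * (p⁻¹)^r) := by gcongr
          _ = _ := by ring
      linarith
    have hM0 : 0 < M := by linarith
    refine (Pb_le_of_markov hp.le hp1 (a := (M/2)*a) (by positivity) (fun Q => sq_nonneg _) ?_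
      hch).trans ?_
    · intro Q hQ
      have hlt : vote μ Qs sy p θ (bit x) g z Q z < a := by
        by_contra hcon
        push Not at hcon
        exact hQ ⟨x, rfl, g, hg, hcon⟩
      have hv : vote μ Qs sy p θ (bit x) g z Q z = ∑ t ∈ Fg g,
          (μ t * (p⁻¹) ^ (Pet μ Qs θ g z t).card) *
            (if Pet μ Qs θ g z t ⊆ Q then 1 else 0) := by
        unfold vote Cnt
        simp only [mul_ite, mul_one, mul_zero, Fg]
        rw [← Finset.sum_filter, Finset.filter_filter]
        simp
      rw [← hv]
      nlinarith
    · rw [div_le_iff₀ (by positivity)]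
      calc M * (r * θ g * (p⁻¹)^r) ≤ M * (a/18) := by gcongr
        _ = _ := by ring

end core

section wrapup

lemma Pb_compl {n : ℕ} {p : ℝ} (E : Finset (Fin n) → Prop) :
    Pb p E = 1 - Pb p (fun Q => ¬ E Q) := by
  have h2 : Pb p E + Pb p (fun Q => ¬ E Q) = 1 := by
    unfold Pb
    rw [← Ex_add]
    refine Eq.trans (congrArg (Ex p) (funext fun Q => ?_)) (Ex_one (n := n) (p := p))
    by_cases hE : E Q <;> simp [hE]
  linarith

lemma Pb_or {n : ℕ} {p : ℝ} (h0 : 0 ≤ p) (h1 : p ≤ 1) (E F : Finset (Fin n) → Prop) :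
    Pb p (fun Q => E Q ∨ F Q) ≤ Pb p E + Pb p F := by
  unfold Pb
  rw [← Ex_add]
  apply Ex_mono h0 h1
  intro Q
  by_cases hE : E Q <;> by_cases hF : F Q <;> simp [hE, hF]

/-- output rule -/
noncomputable def dec {n : ℕ} (cap : ℝ) (S : Bool → Finset (Fin n) → (Fin n → Bool) → Prop)
    (Q : Finset (Fin n)) (w : Fin n → Bool) : Option Bool :=
  if cap < (Q.card : ℝ) then none else
  if S true Q w ∧ ¬ S false Q w then some true else
  if S false Q w ∧ ¬ S true Q w then some false else none

lemma wrap {n k : ℕ} (C : (Fin k → Bool) → Fin n → Bool) (i : Fin k) (δ p cap : ℝ)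
    (hp0 : 0 ≤ p) (hp1 : p ≤ 1) (S : Bool → Finset (Fin n) → (Fin n → Bool) → Prop)
    (hloc : ∀ b Q w w', (∀ v ∈ Q, w v = w' v) → (S b Q w ↔ S b Q w'))
    (hs : ∀ x w, relDist w (C x) ≤ δ / 2 → Pb p (fun Q => S (!x i) Q w) ≤ 1/9)
    (hc : ∀ x, Pb p (fun Q => ¬ S (x i) Q (C x)) ≤ 1/9) (hδ : 0 ≤ δ)
    (hcap : Pb p (fun Q : Finset (Fin n) => cap < (Q.card : ℝ)) ≤ 1/9) :
    ∃ N : SampleAlg Bool n (Option Bool),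
      (∀ x : Fin k → Bool, 2/3 ≤ N.pr (C x) (· = some (x i))) ∧
      (∀ (x : Fin k → Bool) (w : Fin n → Bool), relDist w (C x) ≤ δ / 2 →
        2/3 ≤ N.pr w (fun o => o = some (x i) ∨ o = none)) ∧ N.complexityLE cap := by
  let N : SampleAlg Bool n (Option Bool) :=
    { p := p
      out := fun Q w o => if dec cap S Q w = o then 1 else 0
      p_nonneg := hp0
      p_le_one := hp1
      out_nonneg := by intro Q x o; split_ifs <;> norm_num
      out_sum := by intro Q x; simp
      local_out := by
        intro Q x y h
        have : dec cap S Q x = dec cap S Q y := by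
          unfold dec
          simp only [hloc _ Q x y h]
        simp only [this] }
  have hpr : ∀ w P, N.pr w P = Pb p (fun Q => P (dec cap S Q w)) := by
    intro w P
    unfold SampleAlg.pr Pb Ex W
    refine Finset.sum_congr rfl fun Q _ => ?_
    congr 1
    have : ∀ o : Option Bool, (if P o then N.out Q w o else 0) =
        if dec cap S Q w = o then (if P o then (1:ℝ) else 0) else 0 := by
      intro o
      simp only [N]
      split_ifs <;> rfl
    simp only [this]
    rw [Finset.sum_ite_eq]
    simp
  refine ⟨N, ?_, ?_, ?_⟩
  · intro x
    rw [hpr, Pb_compl]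
    have hself : relDist (C x) (C x) ≤ δ / 2 := by
      simp [relDist]; linarith
    have h1 := hs x (C x) hself
    have h2 := hc x
    have h3 : Pb p (fun Q => ¬ dec cap S Q (C x) = some (x i)) ≤ Pb p (fun Q =>
        (cap < (Q.card : ℝ) ∨ S (!x i) Q (C x)) ∨ ¬ S (x i) Q (C x)) := by
      apply Pb_mono hp0 hp1
      intro Q hQ
      by_contra hcon
      push Not at hcon
      apply hQ
      obtain ⟨⟨a1, a2⟩, a3⟩ := hcon
      unfold dec
      rw [if_neg (not_lt.2 a1)]
      cases hx : x i <;> simp [hx] at a2 a3 <;> simp [a2, a3]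
    have h4 := Pb_or hp0 hp1 (fun Q => cap < (Q.card : ℝ) ∨ S (!x i) Q (C x))
      (fun Q => ¬ S (x i) Q (C x))
    have h5 := Pb_or hp0 hp1 (fun Q => cap < (Q.card : ℝ)) (fun Q => S (!x i) Q (C x))
    linarith
  · intro x w hw
    rw [hpr, Pb_compl]
    have h1 := hs x w hw
    have h3 : Pb p (fun Q => ¬ (dec cap S Q w = some (x i) ∨ dec cap S Q w = none)) ≤
        Pb p (fun Q => S (!x i) Q w) := by
      apply Pb_mono hp0 hp1
      intro Q hQ
      by_contra hcon
      apply hQ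
      unfold dec
      split_ifs <;> cases hx : x i <;> simp [hx] at hcon <;> simp_all
    linarith
  · intro Q hQ x y
    simp only [N, dec, if_pos hQ]

lemma trivial_regime {n k : ℕ} (C : (Fin k → Bool) → Fin n → Bool) (i : Fin k) (δ cap : ℝ)
    (hn : 0 < n) (h0 : 0 < δ) (h1 : δ < 1) (hnδ : 2304 / δ ^ 2 ≤ n)
    (hd : ∀ x y : (Fin k) → Bool, x ≠ y → 2 * δ < relDist (C x) (C y))
    (hcap : (1 - δ / 16) * n ≤ cap) :
    ∃ N : SampleAlg Bool n (Option Bool),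
      (∀ x : Fin k → Bool, 2/3 ≤ N.pr (C x) (· = some (x i))) ∧
      (∀ (x : Fin k → Bool) (w : Fin n → Bool), relDist w (C x) ≤ δ / 2 →
        2/3 ≤ N.pr w (fun o => o = some (x i) ∨ o = none)) ∧ N.complexityLE cap := by
  have hn' : (0:ℝ) < n := by exact_mod_cast hn
  rw [div_le_iff₀ (by positivity)] at hnδ
  have hp : 0 < 1 - δ / 8 := by linarith
  have hp1 : 1 - δ / 8 ≤ 1 := by linarith
  have dev : ∀ E : Finset (Fin n) → Prop,
      (∀ Q, E Q → (δ * n / 16) ^ 2 ≤ ((Q.card : ℝ) - n * (1 - δ/8)) ^ 2) →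
      Pb (1 - δ/8) E ≤ 1/9 := by
    intro E hE
    refine (card_cheb hp hp1 (δ * n / 16) (by positivity) E hE).trans ?_
    rw [div_le_div_iff₀ (by positivity) (by norm_num)]
    have : (n:ℝ) * (1 - δ/8) ≤ n * 1 := by gcongr
    nlinarith
  apply wrap C i δ (1 - δ / 8) cap hp.le hp1
    (fun b Q w => ∃ x : Fin k → Bool, x i = b ∧
      ((Q.filter fun v => w v ≠ C x v).card : ℝ) ≤ δ * n / 2)
  · intro b Q w w' h
    have : ∀ x, (Q.filter fun v => w v ≠ C x v) = Q.filter fun v => w' v ≠ C x v := by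
      intro x
      refine Finset.filter_congr fun v hv => by rw [h v hv]
    simp only [this]
  · intro x w hw
    apply dev
    rintro Q ⟨y, hy, hyc⟩
    have hne : x ≠ y := by
      rintro rfl
      cases hx : x i <;> simp [hx] at hy
    have hdist := hd x y hne
    unfold relDist at hdist hw
    rw [lt_div_iff₀ hn'] at hdist
    rw [div_le_iff₀ hn'] at hw
    have hsub : (Finset.univ.filter fun v => C x v ≠ C y v) ⊆
        ((Finset.univ.filter fun v => w v ≠ C x v) ∪ (Q.filter fun v => w v ≠ C y v)) ∪ Qᶜ := by
      intro v hv
      simp only [Finset.mem_filter, Finset.mem_univ, true_and, Finset.mem_union,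
        Finset.mem_compl] at hv ⊢
      by_cases a1 : v ∈ Q
      · by_cases a2 : w v = C x v
        · left; right
          exact ⟨a1, by rw [a2]; exact hv⟩
        · exact Or.inl (Or.inl a2)
      · exact Or.inr a1
    have hcard := (Finset.card_le_card hsub).trans ((Finset.card_union_le _ _).trans
      (Nat.add_le_add_right (Finset.card_union_le _ _) _))
    have hcq : (Qᶜ.card : ℝ) = n - Q.card := by
      rw [Finset.card_compl, Nat.cast_sub (Finset.card_le_univ Q)]; simp
    have hcard' : ((Finset.univ.filter fun v => C x v ≠ C y v).card : ℝ) ≤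
        (Finset.univ.filter fun v => w v ≠ C x v).card + (Q.filter fun v => w v ≠ C y v).card
          + Qᶜ.card := by exact_mod_cast hcard
    have hpos : 0 < δ * n := by positivity
    have hfin : δ * n / 16 ≤ -((Q.card : ℝ) - n * (1 - δ/8)) := by linarith
    rw [← neg_sq ((Q.card : ℝ) - n * (1 - δ/8))]
    gcongr
  · intro x
    apply dev
    intro Q hQ
    exfalso
    apply hQ
    refine ⟨x, rfl, ?_⟩
    simp only [ne_eq, not_true_eq_false, Finset.filter_false, Finset.card_empty, Nat.cast_zero]
    positivity
  · exact h0.le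
  · apply dev
    intro Q hQ
    have hpos : 0 < δ * n := by positivity
    have hfin : δ * n / 16 ≤ ((Q.card : ℝ) - n * (1 - δ/8)) := by linarith
    gcongr

lemma amp {N l : ℕ} (A : Fin N → Prop) (hA : 3 * (Finset.univ.filter A).card ≤ N) :
    ((Finset.univ.filter fun t : Fin (2 * l) → Fin N =>
      l ≤ (Finset.univ.filter fun j => A (t j)).card).card : ℝ) ≤ (8/9) ^ l * (N:ℝ) ^ (2 * l) := by
  have h1 : ((Finset.univ.filter fun t : Fin (2 * l) → Fin N =>
      l ≤ (Finset.univ.filter fun j => A (t j)).card).card : ℝ) * 2 ^ l ≤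
      ∑ t : Fin (2 * l) → Fin N, ∏ j, (if A (t j) then (2:ℝ) else 1) := by
    rw [Finset.card_eq_sum_ones, Nat.cast_sum, Finset.sum_mul, Finset.sum_filter]
    refine Finset.sum_le_sum fun t _ => ?_
    have h2 : ∏ j, (if A (t j) then (2:ℝ) else 1) =
        2 ^ (Finset.univ.filter fun j => A (t j)).card := by
      rw [← Finset.prod_filter]; simp
    rw [h2]
    split_ifs with h
    · simp only [Nat.cast_one, one_mul]
      exact pow_le_pow_right₀ (by norm_num) h
    · positivity
  have h3 : ∑ t : Fin (2 * l) → Fin N, ∏ j, (if A (t j) then (2:ℝ) else 1) =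
      (∑ s : Fin N, (if A s then (2:ℝ) else 1)) ^ (2 * l) := by
    exact (Fintype.sum_pow (fun s => if A s then (2:ℝ) else 1) (2 * l)).symm
  have h4 : ∑ s : Fin N, (if A s then (2:ℝ) else 1) ≤ 4 / 3 * N := by
    have : ∀ s : Fin N, (if A s then (2:ℝ) else 1) = 1 + if A s then 1 else 0 := by
      intro s; split_ifs <;> norm_num
    simp only [this]
    rw [Finset.sum_add_distrib, ← Finset.sum_filter]
    have hA' : (3:ℝ) * (Finset.univ.filter A).card ≤ N := by exact_mod_cast hA
    simp only [Finset.sum_const, Finset.card_univ, Fintype.card_fin, nsmul_eq_mul, mul_one]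
    linarith
  have h5 : (∑ s : Fin N, (if A s then (2:ℝ) else 1)) ^ (2 * l) ≤ (4 / 3 * N) ^ (2 * l) := by
    apply pow_le_pow_left₀ _ h4
    apply Finset.sum_nonneg
    intro s _; split_ifs <;> norm_num
  have h6 : (4 / 3 * (N:ℝ)) ^ (2 * l) = ((8/9) ^ l * (N:ℝ) ^ (2 * l)) * 2 ^ l := by
    have : (8/9:ℝ)^l * 2^l = (4/3)^(2*l) := by
      rw [← mul_pow, pow_mul]; norm_num
    rw [mul_pow, ← this]; ring
  have h7 : (0:ℝ) < 2 ^ l := by positivity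
  rw [h3] at h1
  rw [h6] at h5
  exact le_of_mul_le_mul_right (h1.trans h5) h7

lemma queries_card {n : ℕ} {O : Type} (t : DTree Bool n O) (w : Fin n → Bool) :
    (t.queries w).card ≤ t.depth := by
  induction t with
  | leaf o => simp [DTree.queries]
  | node i ts ih =>
    simp only [DTree.queries, DTree.depth]
    refine (Finset.card_insert_le _ _).trans ?_
    have h1 := ih (w i)
    have h2 : (ts (w i)).depth ≤ Finset.univ.sup fun a => (ts a).depth :=
      Finset.le_sup (f := fun a => (ts a).depth) (Finset.mem_univ (w i))
    omega

lemma tree_local {n : ℕ} {O : Type} (t : DTree Bool n O) (z u : Fin n → Bool)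
    (h : ∀ v ∈ t.queries z, u v = z v) : t.queries u = t.queries z ∧ t.eval u = t.eval z := by
  induction t with
  | leaf o => simp [DTree.queries, DTree.eval]
  | node i ts ih =>
    simp only [DTree.queries, DTree.eval] at h ⊢
    have hi : u i = z i := h i (Finset.mem_insert_self _ _)
    have := ih (z i) (fun v hv => h v (Finset.mem_insert_of_mem hv))
    rw [hi, this.1, this.2]
    exact ⟨rfl, rfl⟩

lemma multiset_fin {α : Type} (M : Multiset α) : ∃ N : ℕ, N = Multiset.card M ∧ ∃ T : Fin N → α,
    (∀ j, T j ∈ M) ∧ ∀ P : α → Prop,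
      Multiset.countP P M = (Finset.univ.filter fun j => P (T j)).card := by
  induction M using Quot.inductionOn with
  | h L =>
    refine ⟨L.length, rfl, fun j => L.get j, fun j => ?_, fun P => ?_⟩
    · exact List.get_mem L j
    · have h : (Finset.univ : Finset (Fin L.length)).val.map L.get = (L : Multiset α) := by
        rw [Fin.univ_val_map, List.ofFn_get]
      change Multiset.countP P (L : Multiset α) = _
      rw [← h, Multiset.countP_map]
      rfl

lemma main_regime {n k : ℕ} (C : (Fin k → Bool) → Fin n → Bool) (i : Fin k)
    (M : Multiset (DTree Bool n (Option Bool))) (q l r : ℕ) (hrdef : r = 2 * l * q)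
    (hM : M ≠ 0) (hdepth : ∀ t ∈ M, DTree.depth t ≤ q) (δ p a cap : ℝ)
    (hc : ∀ x : (Fin k) → Bool, 2/3 ≤ prP M (C x) (· = some (x i)))
    (hs : ∀ (x : (Fin k) → Bool) (w : (Fin n) → Bool), relDist w (C x) ≤ δ →
          2/3 ≤ prP M w (fun o => o = some (x i) ∨ o = none))
    (hn : 0 < n) (hδ : 0 ≤ δ) (ha : a = 1 / (4 * (r + 1))) (hl : (8/9:ℝ) ^ l ≤ a / 4)
    (hp : 0 < p) (hp1 : p ≤ 1) (θ : ℕ → ℝ) (hθ : ∀ g, 0 < θ g) (hmono : Monotone θ)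
    (L : ℕ) (hL9 : 9 ≤ L) (hLn : 2 * n + 1 ≤ 2 ^ L) (hLr : 9 * (r + 1) ≤ 2 ^ L)
    (hK : ∀ g, g ≤ r → r / θ (g + 1) ≤ δ * n / 2)
    (hm : ∀ g, g ≤ r → (r / θ (g + 1) + 1) * L * r * ((p⁻¹) ^ r * θ g) ≤ a / 2)
    (hcap : Pb p (fun Q : Finset (Fin n) => cap < (Q.card : ℝ)) ≤ 1/9) :
    ∃ N : SampleAlg Bool n (Option Bool),
      (∀ x : Fin k → Bool, 2/3 ≤ N.pr (C x) (· = some (x i))) ∧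
      (∀ (x : Fin k → Bool) (w : Fin n → Bool), relDist w (C x) ≤ δ / 2 →
        2/3 ≤ N.pr w (fun o => o = some (x i) ∨ o = none)) ∧ N.complexityLE cap := by
  obtain ⟨N, hN, T, hT, hcount⟩ := multiset_fin M
  have hN0 : 0 < N := hN ▸ Multiset.card_pos.2 hM
  have hN0' : (0:ℝ) < N := by exact_mod_cast hN0
  have hprP : ∀ w P, prP M w P = ((Finset.univ.filter fun j => P ((T j).eval w)).card : ℝ) / N := by
    intro w P
    unfold prP
    rw [← hN, ← hcount fun t => P (t.eval w)]
  have hthird : ∀ w P, 2/3 ≤ prP M w P →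
      3 * (Finset.univ.filter fun j => ¬ P ((T j).eval w)).card ≤ N := by
    intro w P h
    rw [hprP, le_div_iff₀ hN0'] at h
    have h2 := Finset.card_filter_add_card_filter_not (s := (Finset.univ : Finset (Fin N)))
      (fun j => P ((T j).eval w))
    simp only [Finset.card_univ, Fintype.card_fin] at h2
    have h3 : ((Finset.univ.filter fun j => P ((T j).eval w)).card : ℝ) +
      (Finset.univ.filter fun j => ¬ P ((T j).eval w)).card = N := by exact_mod_cast h2
    have : (3:ℝ) * (Finset.univ.filter fun j => ¬ P ((T j).eval w)).card ≤ N := by linarith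
    exact_mod_cast this
  let μ : (Fin (2 * l) → Fin N) → ℝ := fun _ => ((N:ℝ) ^ (2 * l))⁻¹
  have hμs : ∀ s : Finset (Fin (2 * l) → Fin N), ∑ t ∈ s, μ t = s.card * ((N:ℝ) ^ (2 * l))⁻¹ := by
    intro s; simp [μ]
  have hμ1 : ∑ t, μ t = 1 := by
    rw [hμs]
    simp only [Finset.card_univ, Fintype.card_fun, Fintype.card_fin, Nat.cast_pow]
    exact mul_inv_cancel₀ (by positivity)
  let Qs : (Fin (2 * l) → Fin N) → (Fin n → Bool) → Finset (Fin n) := fun t w =>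
    Finset.univ.biUnion fun j => (T (t j)).queries w
  let sy : Bool → (Fin (2 * l) → Fin N) → (Fin n → Bool) → Prop := fun b t w =>
    l ≤ (Finset.univ.filter fun j => (T (t j)).eval w = some b).card
  have hamp : ∀ A : Fin N → Prop, 3 * (Finset.univ.filter A).card ≤ N →
      ∑ t with l ≤ (Finset.univ.filter fun j => A (t j)).card, μ t ≤ a / 4 := by
    intro A hA
    rw [hμs]
    refine le_trans ?_ hl
    rw [← div_eq_mul_inv, div_le_iff₀ (by positivity)]
    exact amp A hA
  have ha1 : a ≤ 1 := by
    rw [ha, div_le_one (by positivity)]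
    have : (0:ℝ) ≤ r := by positivity
    linarith
  obtain ⟨S, hS1, hS2, hS3⟩ := core μ Qs sy C (fun x => x i) hn
    (fun t => by simp only [μ]; positivity) hμ1
    (by
      intro t z u h
      have hq : ∀ j, (T (t j)).queries u = (T (t j)).queries z ∧
          (T (t j)).eval u = (T (t j)).eval z := by
        intro j
        apply tree_local
        intro v hv
        exact h v (Finset.mem_biUnion.2 ⟨j, Finset.mem_univ _, hv⟩)
      refine ⟨?_, fun b => ?_⟩
      · simp only [Qs]
        exact Finset.biUnion_congr rfl fun j _ => (hq j).1
      · simp only [sy, (hq _).2])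
    r (by
      intro t z
      refine (Finset.card_biUnion_le_card_mul _ _ q ?_).trans ?_
      · intro j _
        exact (queries_card _ _).trans (hdepth _ (hT _))
      · simp [hrdef])
    δ p a ha hp hp1 θ hθ hmono L hL9 hLn hLr hK hm
    (by
      intro x
      have h1 := hamp (fun j => ¬ (T j).eval (C x) = some (x i))
        (by convert hthird (C x) _ (hc x))
      have h2 : ∑ t with sy (x i) t (C x), μ t + ∑ t with ¬ sy (x i) t (C x), μ t = 1 := by
        rw [← hμ1]
        exact Finset.sum_filter_add_sum_filter_not (Finset.univ) (fun t => sy (x i) t (C x)) μ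
      have h3 : ∑ t with ¬ sy (x i) t (C x), μ t ≤ a / 4 := by
        refine le_trans ?_ h1
        apply Finset.sum_le_sum_of_subset_of_nonneg
        · intro t ht
          rw [Finset.mem_filter] at ht ⊢
          refine ⟨ht.1, ?_⟩
          have h4 := ht.2
          simp only [sy, not_le] at h4
          have h5 := Finset.card_filter_add_card_filter_not
            (s := (Finset.univ : Finset (Fin (2 * l))))
            (fun j => (T (t j)).eval (C x) = some (x i))
          simp only [Finset.card_univ, Fintype.card_fin] at h5
          have h6 : l ≤ (Finset.univ.filter fun j =>
              ¬ (T (t j)).eval (C x) = some (x i)).card := by omega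
          convert h6
        · intro t _ _
          simp only [μ]; positivity
      have h7 : 1 / 2 ≤ ∑ t with sy (x i) t (C x), μ t := by linarith
      convert h7)
    (by
      intro x u hu
      have h1 := hamp (fun j => (T j).eval u = some (!x i)) ?_
      · convert h1
      refine le_trans ?_ (hthird u _ (hs x u hu))
      refine Nat.mul_le_mul_left 3 (Finset.card_le_card ?_)
      intro j hj
      have hj2 : (T j).eval u = some (!x i) := by simpa using hj
      have hj3 : ¬ ((T j).eval u = some (x i) ∨ (T j).eval u = none) := by
        rw [hj2]; simp
      simpa using hj3)
  exact wrap C i δ p cap hp.le hp1 S hS1 hS2 hS3 hδ hcap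

end wrapup
section params

lemma log_le_self' {u : ℝ} (hu : 0 < u) : Real.log u ≤ u := by
  have := Real.log_le_sub_one_of_pos hu
  linarith

/-- main analytic bound -/
lemma ana_bound {δ y u P : ℝ} {r Λ : ℕ} (h0 : 0 < δ) (h1 : δ < 1) (hu : 128 / δ ≤ u)
    (hy : y = u ^ 4) (hr : (r : ℝ) ^ 2 ≤ y / δ) (hΛ : (Λ : ℝ) ≤ 5 * y)
    (hP : 1 ≤ P) (hPr : P ^ (r * (r + 1)) ≤ Real.exp (y / 4)) :
    (2 * r / δ) * (16 * ((r:ℝ) + 1) ^ 3 * Λ * P ^ r) ^ (r + 1) ≤ Real.exp y ∧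
    9 * ((r:ℝ) + 1) ≤ Real.exp y := by
  have hu0 : 0 < u := lt_of_lt_of_le (by positivity) hu
  have hδu : 128 ≤ u * δ := by rwa [div_le_iff₀ h0] at hu
  have hu128 : 128 ≤ u := by nlinarith
  have hr0 : (0:ℝ) ≤ r := Nat.cast_nonneg r
  have hrδ : r * δ ≤ u ^ 2 := by
    rw [le_div_iff₀ h0, hy] at hr
    have : (r * δ) ^ 2 ≤ (u ^ 2) ^ 2 := by nlinarith [sq_nonneg (r:ℝ), mul_nonneg (sq_nonneg (r:ℝ)) h0.le]
    exact le_of_sq_le_sq this (by positivity)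
  have hr1δ : (r + 1) * δ ≤ 2 * u ^ 2 := by nlinarith
  have hr1 : ((r:ℝ) + 1) ≤ u ^ 3 / 64 := by
    have : (r + 1) * 128 ≤ 2 * u ^ 2 * u := by
      calc ((r:ℝ) + 1) * 128 ≤ (r + 1) * (u * δ) := by gcongr
        _ = ((r + 1) * δ) * u := by ring
        _ ≤ _ := by gcongr
    nlinarith
  have hyexp : ∀ t : ℝ, t ≤ Real.exp t := fun t => by linarith [Real.add_one_le_exp t]
  have hB : 16 * ((r:ℝ) + 1) ^ 3 * Λ ≤ Real.exp (13 * u.log) := by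
    have e1 : Real.exp (13 * u.log) = u ^ 13 := by
      rw [mul_comm, ← Real.rpow_def_of_pos hu0]
      exact_mod_cast Real.rpow_natCast u 13
    rw [e1]
    calc 16 * ((r:ℝ) + 1) ^ 3 * Λ ≤ 16 * (u ^ 3 / 64) ^ 3 * (5 * u ^ 4) := by
          rw [← hy]; gcongr
      _ = (80 / 64 ^ 3) * u ^ 13 := by ring
      _ ≤ 1 * u ^ 13 := by gcongr; norm_num
      _ = _ := one_mul _
  have hBr : (16 * ((r:ℝ) + 1) ^ 3 * Λ) ^ (r + 1) ≤ Real.exp (y / 4) := by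
    calc (16 * ((r:ℝ) + 1) ^ 3 * Λ) ^ (r + 1) ≤ Real.exp (13 * u.log) ^ (r + 1) := by gcongr
      _ = Real.exp ((r + 1) * (13 * u.log)) := by
          rw [← Real.exp_nat_mul]; push_cast; rfl
      _ ≤ Real.exp (y / 4) := by
          apply Real.exp_le_exp.2
          have h2 : ((r:ℝ) + 1) * 128 ≤ 2 * u ^ 3 := by linarith
          have hlog : u.log ≤ u / 8 := by
            have h := log_le_self' (u := u / 16) (by positivity)
            rw [Real.log_div hu0.ne' (by norm_num)] at h
            have h16 : Real.log 16 ≤ 4 := by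
              have : (16:ℝ) = 2 ^ 4 := by norm_num
              rw [this, Real.log_pow]
              have := Real.log_two_lt_d9
              push_cast; linarith
            linarith
          have hlog0 : 0 ≤ u.log := Real.log_nonneg (by linarith)
          calc ((r:ℝ) + 1) * (13 * u.log) ≤ (u ^ 3 / 64) * (13 * (u / 8)) := by gcongr
            _ ≤ y / 4 := by rw [hy]; nlinarith [pow_pos hu0 4]
  have hA : 2 * r / δ ≤ Real.exp (y / 4) := by
    refine le_trans ?_ (hyexp _)
    rw [hy]
    rw [div_le_iff₀ h0]
    have : u ^ 4 * δ = u ^ 3 * (u * δ) := by ring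
    have : u ^ 3 * 128 ≤ u ^ 3 * (u * δ) := by gcongr
    linarith
  constructor
  · calc (2 * r / δ) * (16 * ((r:ℝ) + 1) ^ 3 * Λ * P ^ r) ^ (r + 1)
        = (2 * r / δ) * ((16 * ((r:ℝ) + 1) ^ 3 * Λ) ^ (r + 1) * P ^ (r * (r + 1))) := by
          rw [mul_pow _ (P ^ r), ← pow_mul]
      _ ≤ Real.exp (y / 4) * (Real.exp (y / 4) * Real.exp (y / 4)) := by gcongr
      _ = Real.exp (3 * y / 4) := by
          rw [← Real.exp_add, ← Real.exp_add]; ring_nf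
      _ ≤ Real.exp y := by
          apply Real.exp_le_exp.2
          have : 0 ≤ y := by rw [hy]; positivity
          linarith
  · refine le_trans ?_ (hyexp _)
    rw [hy]
    have : u ^ 3 * 128 ≤ u ^ 3 * u := by gcongr
    have e : u ^ 4 = u ^ 3 * u := by ring
    linarith [pow_pos hu0 3]

lemma theta_bounds {δ n P : ℝ} {r Λ : ℕ} (h0 : 0 < δ) (hn : 0 < n) (hr : 1 ≤ r) (hΛ : 1 ≤ Λ)
    (hP : 1 ≤ P)
    (hB : (2 * r / δ) * (16 * ((r:ℝ) + 1) ^ 3 * Λ * P ^ r) ^ (r + 1) ≤ n) :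
    ∃ θ : ℕ → ℝ, (∀ g, 0 < θ g) ∧ Monotone θ ∧ (∀ g, g ≤ r → r / θ (g + 1) ≤ δ * n / 2) ∧
      (∀ g, g ≤ r → (r / θ (g + 1) + 1) * Λ * r * (P ^ r * θ g) ≤ (1 / (4 * ((r:ℝ) + 1))) / 2) := by
  obtain ⟨R, hR⟩ : ∃ R, R = 16 * ((r:ℝ) + 1) ^ 3 * Λ * P ^ r := ⟨_, rfl⟩
  rw [← hR] at hB
  have hr' : (1:ℝ) ≤ r := by exact_mod_cast hr
  have hr0 : (0:ℝ) < r := by linarith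
  have hΛ' : (1:ℝ) ≤ Λ := by exact_mod_cast hΛ
  have hPr : 1 ≤ P ^ r := one_le_pow₀ hP
  have hR1 : 1 ≤ R := by
    rw [hR]
    have : 1 ≤ ((r:ℝ) + 1) ^ 3 := one_le_pow₀ (by linarith)
    have a1 : 1 ≤ 16 * ((r:ℝ) + 1) ^ 3 := by linarith
    exact one_le_mul_of_one_le_of_one_le (one_le_mul_of_one_le_of_one_le a1 hΛ') hPr
  have hR0 : 0 < R := by linarith
  obtain ⟨t, ht⟩ : ∃ t, t = 2 * r / (δ * n) := ⟨_, rfl⟩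
  have ht0 : 0 < t := by rw [ht]; positivity
  have htR : t * R ^ (r + 1) ≤ 1 := by
    have e : t * R ^ (r + 1) = (2 * r / δ * R ^ (r + 1)) / n := by
      rw [ht]; field_simp
    rw [e, div_le_one hn]; exact hB
  have hmono : Monotone fun g => t * R ^ g := fun a b hab =>
    mul_le_mul_of_nonneg_left (pow_le_pow_right₀ hR1 hab) ht0.le
  refine ⟨fun g => t * R ^ g, fun g => by positivity, hmono, ?_, ?_⟩
  · intro g _
    have h2 : t ≤ t * R ^ (g + 1) := by
      have := one_le_pow₀ hR1 (n := g + 1)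
      nlinarith
    calc r / (t * R ^ (g + 1)) ≤ r / t := by gcongr
      _ = δ * n / 2 := by rw [ht]; field_simp
  · intro g hg
    have h3 : t * R ^ g * R ≤ 1 := by
      refine le_trans ?_ htR
      have := hmono (show g + 1 ≤ r + 1 by omega)
      simp only at this
      rw [pow_succ] at this
      linarith
    have hθ : 0 < t * R ^ g := by positivity
    have e : (r / (t * R ^ (g + 1)) + 1) * (t * R ^ g) = r / R + t * R ^ g := by
      rw [pow_succ]; field_simp
    have h4 : t * R ^ g ≤ 1 / R := by rwa [le_div_iff₀ hR0]
    have h5 : (r / (t * R ^ (g + 1)) + 1) * (t * R ^ g) ≤ (r + 1) / R := by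
      rw [e, add_div]; linarith
    calc (r / (t * R ^ (g + 1)) + 1) * Λ * r * (P ^ r * (t * R ^ g))
        = ((r / (t * R ^ (g + 1)) + 1) * (t * R ^ g)) * (Λ * r * P ^ r) := by ring
      _ ≤ ((r + 1) / R) * (Λ * r * P ^ r) := by gcongr
      _ = r / (16 * (r + 1) ^ 2) := by
          rw [hR]; field_simp
      _ ≤ (1 / (4 * ((r:ℝ) + 1))) / 2 := by
          rw [div_div, div_le_div_iff₀ (by positivity) (by positivity)]
          nlinarith

/-- the amplification parameter -/
lemma lam_bound (q lm : ℕ) (h1 : 1 ≤ lm) (hq : q + 2 ≤ 2 ^ lm) :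
    (8/9:ℝ) ^ (96 * lm) ≤ (1 / (4 * (((192 * lm * q : ℕ) : ℝ) + 1))) / 4 := by
  have ha : (8/9:ℝ) ^ (96 * lm) ≤ 1 / 2 ^ (16 * lm) := by
    have e : (8/9:ℝ) ^ (96 * lm) = ((8/9:ℝ) ^ 6) ^ (16 * lm) := by
      rw [← pow_mul]; congr 1; ring
    rw [e, ← one_div_pow]
    gcongr
    norm_num
  refine ha.trans ?_
  rw [div_div]
  apply one_div_le_one_div_of_le (by positivity)
  have hlm : lm ≤ 2 ^ lm := (Nat.lt_two_pow_self).le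
  have : 4 * ((192 * lm * q) + 1) * 4 ≤ 2 ^ (16 * lm) := by
    calc 4 * ((192 * lm * q) + 1) * 4 ≤ 3072 * (lm * (q + 2)) := by nlinarith
      _ ≤ 2 ^ 12 * (2 ^ lm * 2 ^ lm) := by gcongr; norm_num
      _ = 2 ^ (12 + (lm + lm)) := by rw [pow_add, pow_add]
      _ ≤ 2 ^ (16 * lm) := Nat.pow_le_pow_right (by norm_num) (by omega)
  exact_mod_cast this

lemma clog_bound (q : ℕ) : 1 ≤ Nat.clog 2 (q + 2) ∧ q + 2 ≤ 2 ^ Nat.clog 2 (q + 2) ∧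
    (Nat.clog 2 (q + 2) : ℝ) ≤ 2 * Real.logb 2 ((q:ℝ) + 2) := by
  have h1 : 1 ≤ Nat.clog 2 (q + 2) := Nat.clog_pos (by norm_num) (by omega)
  refine ⟨h1, Nat.le_pow_clog (by norm_num) _, ?_⟩
  have h2 : 2 ^ (Nat.clog 2 (q + 2) - 1) < q + 2 :=
    Nat.pow_pred_clog_lt_self (b := 2) (x := q + 2) (by norm_num) (by omega)
  have h3 : ((Nat.clog 2 (q + 2) - 1 : ℕ) : ℝ) ≤ Real.logb 2 ((q:ℝ) + 2) := by
    rw [Real.le_logb_iff_rpow_le (by norm_num) (by positivity), Real.rpow_natCast]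
    exact_mod_cast h2.le
  have h4 : 1 ≤ Real.logb 2 ((q:ℝ) + 2) := by
    rw [Real.le_logb_iff_rpow_le (by norm_num) (by positivity), Real.rpow_one]
    have : (0:ℝ) ≤ q := Nat.cast_nonneg q
    linarith
  push_cast [Nat.cast_sub h1] at h3
  linarith

set_option maxHeartbeats 1600000 in
lemma per_index {n k : ℕ} (C : (Fin k → Bool) → Fin n → Bool) (i : Fin k)
    (M : Multiset (DTree Bool n (Option Bool))) (q : ℕ)
    (hM : M ≠ 0) (hdepth : ∀ t ∈ M, DTree.depth t ≤ q) (δ : ℝ) (h0 : 0 < δ) (h1 : δ < 1)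
    (hd : ∀ x y : (Fin k) → Bool, x ≠ y → 2 * δ < relDist (C x) (C y))
    (hc : ∀ x : (Fin k) → Bool, 2/3 ≤ prP M (C x) (· = some (x i)))
    (hs : ∀ (x : (Fin k) → Bool) (w : (Fin n) → Bool), relDist w (C x) ≤ δ →
          2/3 ≤ prP M w (fun o => o = some (x i) ∨ o = none))
    (hn : ⌈Real.exp ((128 / δ) ^ 4)⌉₊ ≤ n) :
    ∃ N : SampleAlg Bool n (Option Bool),
      (∀ x : Fin k → Bool, 2/3 ≤ N.pr (C x) (· = some (x i))) ∧
      (∀ (x : Fin k → Bool) (w : Fin n → Bool), relDist w (C x) ≤ δ / 2 →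
        2/3 ≤ N.pr w (fun o => o = some (x i) ∨ o = none)) ∧ N.complexityLE
        ((n : ℝ) ^ (1 - 1 / ((16 * 384 ^ 2) * (q : ℝ) ^ 2 * (Real.logb 2 ((q : ℝ) + 2)) ^ 2))) := by
  have hnexp : Real.exp ((128 / δ) ^ 4) ≤ n := (Nat.le_ceil _).trans (by exact_mod_cast hn)
  have hn0' : (0:ℝ) < n := lt_of_lt_of_le (Real.exp_pos _) hnexp
  have hn0 : 0 < n := by exact_mod_cast hn0'
  obtain ⟨y, hy⟩ : ∃ y, y = Real.log n := ⟨_, rfl⟩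
  have hexpy : Real.exp y = n := by rw [hy, Real.exp_log hn0']
  have hyl : (128 / δ) ^ 4 ≤ y := by rw [hy, Real.le_log_iff_exp_le hn0']; exact hnexp
  have h128 : 128 ≤ 128 / δ := by rw [le_div_iff₀ h0]; linarith
  have h1282 : 128 ^ 2 ≤ (128 / δ) ^ 2 := by gcongr
  have hy1 : (128 / δ) ^ 2 * 128 ^ 2 ≤ y := by
    refine le_trans ?_ hyl
    have e : (128 / δ) ^ 4 = (128 / δ) ^ 2 * (128 / δ) ^ 2 := by ring
    rw [e]; gcongr
  have hy2 : 128 ^ 2 * 128 ^ 2 ≤ y := le_trans (by gcongr) hy1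
  have hny : y ≤ n := by rw [← hexpy]; linarith [Real.add_one_le_exp y]
  have hnδ : 2304 / δ ^ 2 ≤ n := by
    refine le_trans ?_ (hy1.trans hny)
    rw [div_pow, div_mul_eq_mul_div]
    gcongr
    norm_num
  obtain ⟨Lq, hLq⟩ : ∃ Lq, Lq = Real.logb 2 ((q : ℝ) + 2) := ⟨_, rfl⟩
  rw [← hLq]
  obtain ⟨e, he⟩ : ∃ e, e = 1 / ((16 * 384 ^ 2) * (q : ℝ) ^ 2 * Lq ^ 2) := ⟨_, rfl⟩
  rw [← he]
  have he0 : 0 ≤ e := by rw [he]; positivity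
  obtain ⟨ρ, hρ⟩ : ∃ ρ, ρ = Real.exp (-(e * y)) := ⟨_, rfl⟩
  have hρ0 : 0 < ρ := by rw [hρ]; exact Real.exp_pos _
  have hcap : (n:ℝ) ^ (1 - e) = n * ρ := by
    rw [Real.rpow_sub hn0', Real.rpow_one, Real.rpow_def_of_pos hn0', ← hy, hρ, Real.exp_neg,
      mul_comm e y]
    rfl
  rw [hcap]
  by_cases hcase : 1 - δ / 16 ≤ ρ
  · apply trivial_regime C i δ (n * ρ) hn0 h0 h1 hnδ hd
    rw [mul_comm]
    gcongr
  push Not at hcase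
  have hey : δ / 16 ≤ e * y := by
    have := Real.add_one_le_exp (-(e * y))
    rw [← hρ] at this
    linarith
  have hepos : 0 < e := by
    rcases he0.eq_or_lt with h | h
    · rw [← h] at hey; linarith
    · exact h
  have hq0 : q ≠ 0 := by
    rintro rfl
    rw [he] at hepos
    simp at hepos
  obtain ⟨hl1, hl2, hl3⟩ := clog_bound q
  obtain ⟨lm, hlm⟩ : ∃ lm, lm = Nat.clog 2 (q + 2) := ⟨_, rfl⟩
  rw [← hlm] at hl1 hl2 hl3
  rw [← hLq] at hl3
  have hq1 : 1 ≤ q := Nat.one_le_iff_ne_zero.2 hq0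
  obtain ⟨r, hr⟩ : ∃ r, r = 192 * lm * q := ⟨_, rfl⟩
  have hr1 : 1 ≤ r := by
    rw [hr]; exact Nat.mul_pos (Nat.mul_pos (by norm_num) hl1) hq1
  have hLqpos : 0 < Lq := by
    have : (1:ℝ) ≤ lm := by exact_mod_cast hl1
    linarith
  have hqpos : (0:ℝ) < q := by exact_mod_cast hq1
  have hrle : (r:ℝ) ≤ 384 * q * Lq := by
    rw [hr]; push_cast
    calc (192:ℝ) * lm * q ≤ 192 * (2 * Lq) * q := by gcongr
      _ = 384 * q * Lq := by ring
  have hr2e : (r:ℝ) ^ 2 * e ≤ 1 / 16 := by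
    calc (r:ℝ) ^ 2 * e ≤ (384 * q * Lq) ^ 2 * e := by gcongr
      _ = 1 / 16 := by rw [he]; field_simp
  have hypos : 0 < y := by linarith
  have hr2 : (r:ℝ) ^ 2 ≤ y / δ := by
    rw [le_div_iff₀ h0]
    have : (r:ℝ) ^ 2 * δ ≤ (r:ℝ) ^ 2 * (16 * (e * y)) := by gcongr; linarith
    calc (r:ℝ) ^ 2 * δ ≤ (r:ℝ) ^ 2 * (16 * (e * y)) := this
      _ = 16 * ((r:ℝ) ^ 2 * e) * y := by ring
      _ ≤ 16 * (1 / 16) * y := by gcongr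
      _ = y := by ring
  obtain ⟨P, hP⟩ : ∃ P, P = Real.exp (2 * (e * y)) := ⟨_, rfl⟩
  have hey0 : 0 ≤ e * y := by positivity
  have hP1 : 1 ≤ P := by rw [hP]; exact Real.one_le_exp (by positivity)
  have hpP : (ρ ^ 2)⁻¹ = P := by
    rw [hP, hρ, ← Real.exp_nat_mul, ← Real.exp_neg]; congr 1; push_cast; ring
  have hr1' : (1:ℝ) ≤ r := by exact_mod_cast hr1
  have hPr : P ^ (r * (r + 1)) ≤ Real.exp (y / 4) := by
    rw [hP, ← Real.exp_nat_mul]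
    apply Real.exp_le_exp.2
    push_cast
    calc (r:ℝ) * (r + 1) * (2 * (e * y)) ≤ r * (r + r) * (2 * (e * y)) := by gcongr
      _ = 4 * (r ^ 2 * e) * y := by ring
      _ ≤ 4 * (1 / 16) * y := by gcongr
      _ = y / 4 := by ring
  obtain ⟨Λ, hΛ⟩ : ∃ Λ, Λ = ⌈4 * y⌉₊ := ⟨_, rfl⟩
  have hΛ1 : 4 * y ≤ Λ := by rw [hΛ]; exact Nat.le_ceil _
  have hΛ2 : (Λ:ℝ) ≤ 5 * y := by
    have := Nat.ceil_lt_add_one (a := 4 * y) (by positivity)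
    rw [← hΛ] at this
    linarith
  have hΛ9 : 9 ≤ Λ := by
    have : (9:ℝ) ≤ Λ := by linarith
    exact_mod_cast this
  have h2Λ : (n:ℝ) * n ≤ 2 ^ Λ := by
    rw [← hexpy, ← Real.exp_add, ← Real.rpow_natCast, Real.rpow_def_of_pos (by norm_num)]
    apply Real.exp_le_exp.2
    have h2 : 1 / 2 ≤ Real.log 2 := by linarith [Real.log_two_gt_d9]
    calc y + y = 1 / 2 * (4 * y) := by ring
      _ ≤ Real.log 2 * Λ := by gcongr
  have hn3 : (3:ℝ) ≤ n := by linarith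
  have hnn : 3 * (n:ℝ) ≤ 2 ^ Λ := le_trans (by gcongr) h2Λ
  set u := Real.sqrt (Real.sqrt y) with hu
  have hu4 : y = u ^ 4 := by
    have e1 : u ^ 4 = (u ^ 2) ^ 2 := by ring
    rw [e1, hu, Real.sq_sqrt (Real.sqrt_nonneg _), Real.sq_sqrt hypos.le]
  have hu128 : 128 / δ ≤ u := by
    rw [hu4] at hyl
    exact le_of_pow_le_pow_left₀ (by norm_num) (Real.sqrt_nonneg _) hyl
  obtain ⟨hb1, hb2⟩ := ana_bound (Λ := Λ) h0 h1 hu128 hu4 hr2 hΛ2 hP1 hPr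
  rw [hexpy] at hb1 hb2
  obtain ⟨θ, t1, t2, t3, t4⟩ := theta_bounds h0 hn0' hr1 (by omega) hP1 hb1
  have hρ1 : ρ < 1 := by linarith
  refine main_regime C i M q (96 * lm) r (by rw [hr]; ring) hM hdepth δ (ρ ^ 2)
    (1 / (4 * ((r:ℝ) + 1))) (n * ρ) hc hs hn0 h0.le rfl ?_ (by positivity)
    (pow_le_one₀ hρ0.le hρ1.le) θ t1 t2 Λ hΛ9 ?_ ?_ t3 ?_ ?_
  · rw [hr]; exact lam_bound q lm hl1 hl2
  · have : (2 * n + 1 : ℝ) ≤ 2 ^ Λ := by linarith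
    exact_mod_cast this
  · have : (9 * (r + 1) : ℝ) ≤ 2 ^ Λ := by linarith
    exact_mod_cast this
  · rw [hpP]; exact t4
  · have hlam : 0 < ρ * n - ρ ^ 2 * n := by
      have : 0 < ρ * n * (1 - ρ) := mul_pos (by positivity) (by linarith)
      linarith
    refine (card_cheb (by positivity) (pow_le_one₀ hρ0.le hρ1.le) (ρ * n - ρ ^ 2 * n) hlam
      _ ?_).trans ?_
    · intro Q hQ
      have : ρ * n - ρ ^ 2 * n ≤ (Q.card : ℝ) - n * ρ ^ 2 := by linarith
      gcongr
    · have hge : δ / 16 ≤ 1 - ρ := by linarith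
      have hsq : (δ / 16) ^ 2 ≤ (1 - ρ) ^ 2 := by gcongr
      rw [div_le_iff₀ (by positivity)] at hnδ
      have e1 : n * ρ ^ 2 / (ρ * n - ρ ^ 2 * n) ^ 2 = 1 / (n * (1 - ρ) ^ 2) := by
        have : (1 - ρ) ≠ 0 := by linarith
        have e2 : ρ * n - ρ ^ 2 * n = ρ * n * (1 - ρ) := by ring
        rw [e2]
        field_simp
      rw [e1]
      apply one_div_le_one_div_of_le (by norm_num)
      calc (9:ℝ) = 2304 / 256 := by norm_num
        _ ≤ n * δ ^ 2 / 256 := by gcongr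
        _ = n * (δ / 16) ^ 2 := by ring
        _ ≤ n * (1 - ρ) ^ 2 := by gcongr

end params

end RLDC

/-- **Sample-based relaxed local decoding.** There is a universal constant `c > 0` such
that for every constant `δ ∈ (0,1)` and all sufficiently large `n`: if a binary code
`C : {0,1}^k → {0,1}^n` admits a `q`-query relaxed local decoder with decoding radius
`δ` (outputs in `{0,1,⊥}`, modeled as `Option Bool` with `⊥ = none`), then `C` admits a
sample-based relaxed local decoder with decoding radius `δ/2` and sample complexity at
most `n^(1 - 1/(c·q²·log₂²(q+2)))`. -/
theorem rldc_to_sample_based :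
    ∃ c : ℝ, 0 < c ∧
    ∀ δ : ℝ, 0 < δ → δ < 1 →
    ∃ n₀ : ℕ, ∀ n : ℕ, n₀ ≤ n →
    ∀ (k q : ℕ) (C : ((Fin k) → Bool) → ((Fin n) → Bool))
      (D : Fin k → Multiset (DTree Bool n (Option Bool))),
      Function.Injective C →
      (∀ x y : (Fin k) → Bool, x ≠ y → 2 * δ < relDist (C x) (C y)) →
      (∀ i, D i ≠ 0) →
      (∀ i, ∀ t ∈ D i, DTree.depth t ≤ q) →
      (∀ (i : Fin k) (x : (Fin k) → Bool), 2/3 ≤ prP (D i) (C x) (· = some (x i))) →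
      (∀ (i : Fin k) (x : (Fin k) → Bool) (w : (Fin n) → Bool),
        relDist w (C x) ≤ δ →
          2/3 ≤ prP (D i) w (fun o => o = some (x i) ∨ o = none)) →
      ∃ D' : Fin k → SampleAlg Bool n (Option Bool),
        (∀ (i : Fin k) (x : (Fin k) → Bool), 2/3 ≤ (D' i).pr (C x) (· = some (x i))) ∧
        (∀ (i : Fin k) (x : (Fin k) → Bool) (w : (Fin n) → Bool),
          relDist w (C x) ≤ δ / 2 →
            2/3 ≤ (D' i).pr w (fun o => o = some (x i) ∨ o = none)) ∧
        (∀ i, (D' i).complexityLE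
          ((n : ℝ) ^ (1 - 1 / (c * (q : ℝ) ^ 2 * (Real.logb 2 ((q : ℝ) + 2)) ^ 2)))) := by
  refine ⟨16 * 384 ^ 2, by norm_num, ?_⟩
  intro δ h0 h1
  refine ⟨⌈Real.exp ((128 / δ) ^ 4)⌉₊, ?_⟩
  intro n hn k q C D _ hd hD hdepth hc hs
  have key := fun i => RLDC.per_index C i (D i) q (hD i) (hdepth i) δ h0 h1 hd (hc i) (hs i) hn
  choose D' a1 a2 a3 using key
  exact ⟨D', a1, a2, a3⟩
end

section
/- There exists a universal constant c > 0 such that for every constant δ ∈ (0,1) the following holds for all sufficiently large k: every binary code C : {0,1}^k → {0,1}^n that admits a q-query relaxed local decoder with decoding radius δ must have blocklength n ≥ k^{1 + 1/(c·q²·log₂²(q+2))}. -/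
open scoped Classical

namespace RLDC

/-- The weight of a sample `S` when each coordinate is kept with probability `p`. -/
noncomputable def wt {n : ℕ} (p : ℝ) (S : Finset (Fin n)) : ℝ :=
  p ^ S.card * (1 - p) ^ (n - S.card)

/-- Probability of an event over the random sample. -/
noncomputable def Pr {n : ℕ} (p : ℝ) (E : Finset (Fin n) → Prop) : ℝ :=
  ∑ S : Finset (Fin n), if E S then wt p S else 0

lemma wt_nonneg {n : ℕ} {p : ℝ} (hp : 0 ≤ p) (hp1 : p ≤ 1) (S : Finset (Fin n)) :
    0 ≤ wt p S := by
  unfold wt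
  have : 0 ≤ 1 - p := by linarith
  positivity

lemma sum_superset {n : ℕ} (p : ℝ) (A : Finset (Fin n)) :
    ∑ S : Finset (Fin n), (if A ⊆ S then wt p S else 0) = p ^ A.card := by
  have h := Finset.prod_add (fun _ : Fin n => p) (fun v => if v ∈ A then 0 else 1 - p)
    Finset.univ
  have h1 : ∏ v : Fin n, (p + (if v ∈ A then 0 else 1 - p)) = p ^ A.card := by
    have : ∀ v : Fin n, (p + (if v ∈ A then 0 else 1 - p)) = if v ∈ A then p else 1 := by
      intro v; split_ifs <;> ring
    simp only [this]
    rw [Finset.prod_ite_mem]; simp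
  rw [h1] at h
  rw [h, Finset.powerset_univ]
  refine Finset.sum_congr rfl fun S _ => ?_
  split_ifs with hAS
  · rw [Finset.prod_const, wt]
    congr 1
    rw [Finset.prod_congr rfl (g := fun _ => 1 - p)]
    · rw [Finset.prod_const, Finset.card_sdiff]; simp
    · intro v hv
      have : v ∉ A := fun hA => by simp at hv; exact hv (hAS hA)
      simp [this]
  · obtain ⟨v, hvA, hvS⟩ := Finset.not_subset.mp hAS
    rw [Finset.prod_eq_zero (i := v) (s := Finset.univ \ S)]
    · simp
    · simp [hvS]
    · simp [hvA]

lemma sum_wt {n : ℕ} (p : ℝ) : ∑ S : Finset (Fin n), wt p S = 1 := by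
  have := sum_superset (n := n) p ∅
  simpa using this

lemma sum_wt_two {n : ℕ} (p : ℝ) :
    ∑ S : Finset (Fin n), wt p S * 2 ^ S.card = (1 + p) ^ n := by
  have h := Finset.prod_add (fun _ : Fin n => 2 * p) (fun v => 1 - p) Finset.univ
  simp only [Finset.prod_const, Finset.powerset_univ] at h
  have e : (2 * p + (1 - p)) = 1 + p := by ring
  rw [e] at h
  simp only [Finset.card_univ, Fintype.card_fin] at h
  rw [h]
  refine Finset.sum_congr rfl fun S _ => ?_
  rw [wt, Finset.card_sdiff, mul_pow]; simp; ring

lemma Pr_mono {n : ℕ} {p : ℝ} (hp : 0 ≤ p) (hp1 : p ≤ 1) {E F : Finset (Fin n) → Prop}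
    (h : ∀ S, E S → F S) : Pr p E ≤ Pr p F := by
  unfold Pr
  refine Finset.sum_le_sum fun S _ => ?_
  have := wt_nonneg hp hp1 S
  by_cases hE : E S
  · simp [hE, h S hE]
  · simp only [hE, if_false]; split_ifs <;> simp [this]

lemma Pr_or {n : ℕ} {p : ℝ} (hp : 0 ≤ p) (hp1 : p ≤ 1) (E F : Finset (Fin n) → Prop) :
    Pr p (fun S => E S ∨ F S) ≤ Pr p E + Pr p F := by
  unfold Pr
  rw [← Finset.sum_add_distrib]
  refine Finset.sum_le_sum fun S _ => ?_
  have := wt_nonneg hp hp1 S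
  by_cases hE : E S <;> by_cases hF : F S <;> simp [hE, hF, this]

lemma Pr_exists {n : ℕ} {p : ℝ} (hp : 0 ≤ p) (hp1 : p ≤ 1) {ι : Type} (I : Finset ι)
    (E : ι → Finset (Fin n) → Prop) :
    Pr p (fun S => ∃ a ∈ I, E a S) ≤ ∑ a ∈ I, Pr p (E a) := by
  unfold Pr
  rw [Finset.sum_comm]
  refine Finset.sum_le_sum fun S _ => ?_
  have hw := wt_nonneg hp hp1 S
  have hn : ∀ a ∈ I, 0 ≤ (if E a S then wt p S else 0) := by
    intro a _; split_ifs <;> simp [hw]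
  split_ifs with h
  · obtain ⟨a, ha, hE⟩ := h
    have := Finset.single_le_sum hn ha
    simpa [hE] using this
  · exact Finset.sum_nonneg hn

/-- Markov's inequality. -/
lemma Pr_markov {n : ℕ} {p : ℝ} (hp : 0 ≤ p) (hp1 : p ≤ 1) (E : Finset (Fin n) → Prop)
    (f : Finset (Fin n) → ℝ) (hf : ∀ S, 0 ≤ f S) (a : ℝ) (h : ∀ S, E S → a ≤ f S) :
    a * Pr p E ≤ ∑ S, wt p S * f S := by
  unfold Pr
  rw [Finset.mul_sum]
  refine Finset.sum_le_sum fun S _ => ?_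
  have hw := wt_nonneg hp hp1 S
  split_ifs with hE
  · rw [mul_comm]; exact mul_le_mul_of_nonneg_left (h S hE) hw
  · simpa using mul_nonneg hw (hf S)

/-- Number of members of `F` meeting a set `U`. -/
lemma card_meet {n : ℕ} {Ω : Type} (F : Finset Ω) (A : Ω → Finset (Fin n)) (Δ : ℝ)
    (hdeg : ∀ v, ((F.filter fun ω => v ∈ A ω).card : ℝ) ≤ Δ) (U : Finset (Fin n)) :
    ((F.filter fun ω => ¬ Disjoint (A ω) U).card : ℝ) ≤ U.card * Δ := by
  have hsub : (F.filter fun ω => ¬ Disjoint (A ω) U) ⊆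
      U.biUnion fun v => F.filter fun ω => v ∈ A ω := by
    intro ω hω
    simp only [Finset.mem_filter] at hω
    obtain ⟨v, hv, hvU⟩ := Finset.not_disjoint_iff.mp hω.2
    simp only [Finset.mem_biUnion, Finset.mem_filter]
    exact ⟨v, hvU, hω.1, hv⟩
  have h1 := (Finset.card_le_card hsub).trans Finset.card_biUnion_le
  calc ((F.filter fun ω => ¬ Disjoint (A ω) U).card : ℝ)
      ≤ ((∑ v ∈ U, (F.filter fun ω => v ∈ A ω).card : ℕ) : ℝ) := by exact_mod_cast h1
    _ = ∑ v ∈ U, ((F.filter fun ω => v ∈ A ω).card : ℝ) := by push_cast; rfl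
    _ ≤ ∑ v ∈ U, Δ := Finset.sum_le_sum fun v _ => hdeg v
    _ = U.card * Δ := by simp

/-- Lower tail by Chebyshev. -/
lemma lower_tail {n : ℕ} {p : ℝ} (hp : 0 < p) (hp1 : p ≤ 1) {Ω : Type} (F : Finset Ω)
    (A : Ω → Finset (Fin n)) (j : ℕ) (hA : ∀ ω ∈ F, (A ω).card = j) (Δ : ℝ)
    (hΔ : 0 ≤ Δ)
    (hdeg : ∀ v, ((F.filter fun ω => v ∈ A ω).card : ℝ) ≤ Δ) :
    (F.card * p ^ j) * Pr p (fun S => ((F.filter fun ω => A ω ⊆ S).card : ℝ) < F.card * p ^ j / 2)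
      ≤ 4 * (j * Δ) := by
  set μ : ℝ := F.card * p ^ j with hμ
  have hμ0 : 0 ≤ μ := by positivity
  rcases F.eq_empty_or_nonempty with hF | hF
  · have hμz : μ = 0 := by simp [hμ, hF]
    rw [hμz, zero_mul]
    rcases Nat.eq_zero_or_pos j with rfl | hj
    · simp
    · positivity
  have hμp : 0 < μ := by
    have : 0 < F.card := hF.card_pos
    positivity
  set Z : Finset (Fin n) → ℝ := fun S => ((F.filter fun ω => A ω ⊆ S).card : ℝ) with hZ
  have hZs : ∀ S, Z S = ∑ ω ∈ F, if A ω ⊆ S then (1 : ℝ) else 0 := by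
    intro S; simp [hZ]
  have hE1 : ∑ S, wt p S * Z S = μ := by
    simp only [hZs, Finset.mul_sum]
    rw [Finset.sum_comm]
    simp only [mul_ite, mul_one, mul_zero, sum_superset]
    rw [Finset.sum_congr rfl (fun ω hω => by rw [hA ω hω])]
    simp [hμ]
  have hE2 : ∑ S, wt p S * Z S ^ 2 ≤ μ ^ 2 + μ * (j * Δ) := by
    have h1 : ∀ S, wt p S * Z S ^ 2 =
        ∑ ω ∈ F, ∑ ω' ∈ F, if A ω ∪ A ω' ⊆ S then wt p S else 0 := by
      intro S
      rw [sq, hZs, Finset.sum_mul_sum, Finset.mul_sum]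
      refine Finset.sum_congr rfl fun ω _ => ?_
      rw [Finset.mul_sum]
      refine Finset.sum_congr rfl fun ω' _ => ?_
      by_cases h : A ω ⊆ S <;> by_cases h' : A ω' ⊆ S <;> simp [h, h', Finset.union_subset_iff]
    simp only [h1]
    rw [Finset.sum_comm]
    have h2 : ∀ ω ∈ F, ∑ S, ∑ ω' ∈ F, (if A ω ∪ A ω' ⊆ S then wt p S else 0)
        ≤ F.card * (p ^ j * p ^ j) + p ^ j * (j * Δ) := by
      intro ω hω
      rw [Finset.sum_comm]
      simp only [sum_superset]
      have h3 : ∀ ω' ∈ F, p ^ (A ω ∪ A ω').card ≤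
          p ^ j * p ^ j + if ¬ Disjoint (A ω') (A ω) then p ^ j else 0 := by
        intro ω' hω'
        by_cases hd : Disjoint (A ω') (A ω)
        · rw [Finset.card_union_of_disjoint hd.symm, hA ω hω, hA ω' hω', pow_add]; simp [hd]
        · have : p ^ (A ω ∪ A ω').card ≤ p ^ j := by
            apply pow_le_pow_of_le_one hp.le hp1
            rw [← hA ω hω]
            exact Finset.card_le_card Finset.subset_union_left
          have : 0 ≤ p ^ j * p ^ j := by positivity
          rw [if_pos hd]
          linarith
      refine (Finset.sum_le_sum h3).trans ?_
      rw [Finset.sum_add_distrib, ← Finset.sum_filter]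
      simp only [Finset.sum_const, nsmul_eq_mul]
      have := card_meet F A Δ hdeg (A ω)
      rw [hA ω hω] at this
      have hpj : 0 ≤ p ^ j := by positivity
      nlinarith
    refine (Finset.sum_le_sum h2).trans ?_
    simp only [Finset.sum_const, nsmul_eq_mul, hμ]
    apply le_of_eq; ring
  have hvar : ∑ S, wt p S * (Z S - μ) ^ 2 ≤ μ * (j * Δ) := by
    have : ∀ S, wt p S * (Z S - μ) ^ 2 =
        wt p S * Z S ^ 2 - 2 * μ * (wt p S * Z S) + μ ^ 2 * wt p S := by intro S; ring
    simp only [this, Finset.sum_add_distrib, Finset.sum_sub_distrib, ← Finset.mul_sum, hE1,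
      sum_wt]
    linarith
  have hm := Pr_markov hp.le hp1 (fun S => Z S < μ / 2) (fun S => (Z S - μ) ^ 2)
    (fun S => sq_nonneg _) (μ ^ 2 / 4) (by
      intro S hS
      nlinarith)
  have := hm.trans hvar
  have h5 : μ * (μ * Pr p (fun S => Z S < μ / 2)) ≤ μ * (4 * (j * Δ)) := by nlinarith
  exact le_of_mul_le_mul_left h5 hμp

/-- Weighted count of ordered `r`-tuples of disjoint sampled petals. -/
noncomputable def cnt {n : ℕ} {Ω : Type} (F : Finset Ω) (A : Ω → Finset (Fin n))
    (S : Finset (Fin n)) : ℕ → Finset (Fin n) → ℝ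
  | 0, _ => 1
  | r + 1, U => ∑ ω ∈ F.filter (fun ω => A ω ⊆ S ∧ Disjoint (A ω) U), cnt F A S r (U ∪ A ω)

lemma cnt_nonneg {n : ℕ} {Ω : Type} (F : Finset Ω) (A : Ω → Finset (Fin n))
    (S : Finset (Fin n)) (r : ℕ) : ∀ U, 0 ≤ cnt F A S r U := by
  induction r with
  | zero => intro U; simp [cnt]
  | succ r ih => intro U; rw [cnt]; exact Finset.sum_nonneg fun ω _ => ih _

lemma cnt_lower {n : ℕ} {Ω : Type} (F : Finset Ω) (A : Ω → Finset (Fin n)) (j : ℕ)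
    (hA : ∀ ω ∈ F, (A ω).card = j)
    (S : Finset (Fin n)) (G : Finset Ω) (hG : G ⊆ F) (hS : ∀ ω ∈ G, A ω ⊆ S) (Δ M : ℝ)
    (hΔ : 0 ≤ Δ) (hM0 : 0 ≤ M)
    (hdeg : ∀ v, ((G.filter fun ω => v ∈ A ω).card : ℝ) ≤ Δ) (hM : M ≤ G.card) (r : ℕ) :
    ∀ U : Finset (Fin n), (U.card + r * j : ℝ) * Δ ≤ M / 2 → (M / 2) ^ r ≤ cnt F A S r U := by
  induction r with
  | zero => intro U _; simp [cnt]
  | succ r ih =>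
    intro U hU
    rw [cnt]
    have hsub : G.filter (fun ω => Disjoint (A ω) U) ⊆
        F.filter (fun ω => A ω ⊆ S ∧ Disjoint (A ω) U) := by
      intro ω hω
      simp only [Finset.mem_filter] at hω ⊢
      exact ⟨hG hω.1, hS ω hω.1, hω.2⟩
    have h1 := Finset.sum_le_sum_of_subset_of_nonneg (f := fun ω => cnt F A S r (U ∪ A ω)) hsub
      (fun ω _ _ => cnt_nonneg F A S r _)
    refine le_trans ?_ h1
    have h2 : ∀ ω ∈ G.filter (fun ω => Disjoint (A ω) U),
        (M / 2) ^ r ≤ cnt F A S r (U ∪ A ω) := by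
      intro ω hω
      simp only [Finset.mem_filter] at hω
      apply ih
      rw [Finset.card_union_of_disjoint hω.2.symm, hA ω (hG hω.1)]
      push_cast at hU ⊢
      linarith
    refine le_trans ?_ (Finset.sum_le_sum h2)
    rw [Finset.sum_const, nsmul_eq_mul, pow_succ, mul_comm]
    apply mul_le_mul_of_nonneg_right _ (by positivity)
    have h3 := card_meet G A Δ hdeg U
    have h4 : (G.filter (fun ω => Disjoint (A ω) U)).card +
        (G.filter (fun ω => ¬ Disjoint (A ω) U)).card = G.card :=
      Finset.card_filter_add_card_filter_not _
    have h5 : ((G.filter (fun ω => Disjoint (A ω) U)).card : ℝ) +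
        (G.filter (fun ω => ¬ Disjoint (A ω) U)).card = G.card := by exact_mod_cast h4
    have h6 : (0 : ℝ) ≤ ((r + 1 : ℕ) * j : ℝ) * Δ := by positivity
    nlinarith

lemma cnt_upper {n : ℕ} {p : ℝ} (hp : 0 ≤ p) {Ω : Type} (F : Finset Ω)
    (A : Ω → Finset (Fin n)) (j : ℕ) (hA : ∀ ω ∈ F, (A ω).card = j) (r : ℕ) :
    ∀ U : Finset (Fin n), ∑ S, (if U ⊆ S then wt p S * cnt F A S r U else 0) ≤
      p ^ U.card * (F.card * p ^ j) ^ r := by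
  induction r with
  | zero => intro U; simp [cnt, sum_superset]
  | succ r ih =>
    intro U
    have h1 : ∀ S, (if U ⊆ S then wt p S * cnt F A S (r + 1) U else 0) =
        ∑ ω ∈ F.filter (fun ω => Disjoint (A ω) U),
          (if U ∪ A ω ⊆ S then wt p S * cnt F A S r (U ∪ A ω) else 0) := by
      intro S
      rw [cnt]
      split_ifs with hU
      · rw [Finset.mul_sum, Finset.sum_filter, Finset.sum_filter]
        refine Finset.sum_congr rfl fun ω _ => ?_
        by_cases h : A ω ⊆ S <;> by_cases h' : Disjoint (A ω) U <;>
          simp [h, h', hU, Finset.union_subset_iff]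
      · symm; apply Finset.sum_eq_zero
        intro ω _
        simp [Finset.union_subset_iff, hU]
    simp only [h1]
    rw [Finset.sum_comm]
    have h2 : ∀ ω ∈ F.filter (fun ω => Disjoint (A ω) U),
        ∑ S, (if U ∪ A ω ⊆ S then wt p S * cnt F A S r (U ∪ A ω) else 0) ≤
          p ^ U.card * p ^ j * (F.card * p ^ j) ^ r := by
      intro ω hω
      simp only [Finset.mem_filter] at hω
      have := ih (U ∪ A ω)
      rwa [Finset.card_union_of_disjoint hω.2.symm, hA ω hω.1, pow_add] at this
    refine (Finset.sum_le_sum h2).trans ?_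
    rw [Finset.sum_const, nsmul_eq_mul]
    have h3 : ((F.filter (fun ω => Disjoint (A ω) U)).card : ℝ) ≤ F.card := by
      exact_mod_cast Finset.card_filter_le _ _
    calc _ ≤ (F.card : ℝ) * (p ^ U.card * p ^ j * (F.card * p ^ j) ^ r) :=
          mul_le_mul_of_nonneg_right h3 (by positivity)
      _ = _ := by ring

/-- Upper tail for bounded-degree sampled subfamilies. -/
lemma upper_tail {n : ℕ} {p : ℝ} (hp : 0 ≤ p) (hp1 : p ≤ 1) {Ω : Type} (F : Finset Ω)
    (A : Ω → Finset (Fin n)) (j : ℕ) (hA : ∀ ω ∈ F, (A ω).card = j) (Δ M : ℝ)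
    (hΔ : 0 ≤ Δ) (hM0 : 0 < M) (r : ℕ) (hr : (r * j : ℝ) * Δ ≤ M / 2)
    (hF : 4 * (F.card * p ^ j) ≤ M) :
    Pr p (fun S => ∃ G ⊆ F, (∀ ω ∈ G, A ω ⊆ S) ∧
      (∀ v, ((G.filter fun ω => v ∈ A ω).card : ℝ) ≤ Δ) ∧ M ≤ G.card) ≤ (1 / 2) ^ r := by
  have hm := Pr_markov hp hp1 (fun S => ∃ G ⊆ F, (∀ ω ∈ G, A ω ⊆ S) ∧
      (∀ v, ((G.filter fun ω => v ∈ A ω).card : ℝ) ≤ Δ) ∧ M ≤ G.card)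
      (fun S => cnt F A S r ∅) (fun S => cnt_nonneg F A S r ∅) ((M / 2) ^ r) (by
        rintro S ⟨G, hG, hS, hdeg, hM⟩
        apply cnt_lower F A j hA S G hG hS Δ M hΔ hM0.le hdeg hM r ∅
        simpa using hr)
  have hu := cnt_upper hp F A j hA r ∅
  simp only [Finset.empty_subset, if_true, Finset.card_empty, pow_zero, one_mul] at hu
  have h1 := hm.trans hu
  have h2 : (F.card * p ^ j : ℝ) ^ r ≤ (M / 2) ^ r * (1 / 2) ^ r := by
    rw [← mul_pow]
    apply pow_le_pow_left₀ (by positivity)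
    linarith
  exact le_of_mul_le_mul_left (h1.trans h2) (by positivity)

/-- Choosing a level: the petal of `X` w.r.t. a decreasing chain of kernels. -/
lemma exists_level {n : ℕ} (K : ℕ → Finset (Fin n)) (hK : ∀ j, K (j + 1) ⊆ K j)
    (X : Finset (Fin n)) (Q : ℕ) (hX : X.card ≤ Q) :
    ∃ j ≤ Q, (X \ K (j + 1)).card = j ∧ ∀ v ∈ X \ K (j + 1), v ∉ K j := by
  have hex : ∃ j, (X \ K (j + 1)).card ≤ j :=
    ⟨Q, (Finset.card_le_card Finset.sdiff_subset).trans hX⟩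
  have hQ : Nat.find hex ≤ Q :=
    Nat.find_min' hex ((Finset.card_le_card Finset.sdiff_subset).trans hX)
  have hspec := Nat.find_spec hex
  have hmin := fun m => Nat.find_min hex (m := m)
  generalize Nat.find hex = j at *
  refine ⟨j, hQ, ?_⟩
  rcases j with _ | j
  · have : (X \ K (0 + 1)).card = 0 := by omega
    refine ⟨this, ?_⟩
    rw [Finset.card_eq_zero.mp this]; simp
  · have h1 := hmin j (by omega)
    have hsub : X \ K (j + 1) ⊆ X \ K (j + 1 + 1) := Finset.sdiff_subset_sdiff le_rfl (hK _)
    have h2 := Finset.card_le_card hsub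
    have h3 : (X \ K (j + 1 + 1)).card = j + 1 := by omega
    refine ⟨h3, ?_⟩
    have : X \ K (j + 1) = X \ K (j + 1 + 1) := Finset.eq_of_subset_of_card_le hsub (by omega)
    rw [← this]
    intro v hv
    exact (Finset.mem_sdiff.mp hv).2

/-- A certificate: a kernel `K` and a bounded degree family `G` of local views of `u` accepting
the value `b`, each having exactly `j` queries outside `K`, all of them sampled. -/
def Cert {n : ℕ} {Ω : Type} (Qs : Ω → (Fin n → Bool) → Finset (Fin n))
    (acc : Bool → Ω → (Fin n → Bool) → Prop) (Δ M : ℕ → ℝ) (m : ℕ → ℕ)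
    (j : ℕ) (K : Finset (Fin n)) (G : Finset Ω) (b : Bool) (u : Fin n → Bool)
    (S : Finset (Fin n)) : Prop :=
  K.card ≤ m j ∧ (∀ ω ∈ G, acc b ω u ∧ (Qs ω u \ K).card = j ∧ Qs ω u \ K ⊆ S) ∧
    (∀ v, ((G.filter fun ω => v ∈ Qs ω u \ K).card : ℝ) ≤ Δ j) ∧ M j ≤ (G.card : ℝ)

/-- The sample certifies the value `b` for `w`. -/
def Good {n : ℕ} {Ω : Type} (Qs : Ω → (Fin n → Bool) → Finset (Fin n))
    (acc : Bool → Ω → (Fin n → Bool) → Prop) (Δ M : ℕ → ℝ) (m : ℕ → ℕ) (Q : ℕ)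
    (w : Fin n → Bool) (b : Bool) (S : Finset (Fin n)) : Prop :=
  ∃ j ≤ Q, ∃ K G, Cert Qs acc Δ M m j K G b w S

/-- The sample certifies the wrong value for a string which differs from `w` on the kernel. -/
def Danger {n : ℕ} {Ω : Type} (Qs : Ω → (Fin n → Bool) → Finset (Fin n))
    (acc : Bool → Ω → (Fin n → Bool) → Prop) (Δ M : ℕ → ℝ) (m : ℕ → ℕ) (Q : ℕ)
    (w : Fin n → Bool) (b : Bool) (S : Finset (Fin n)) : Prop :=
  ∃ j ≤ Q, ∃ K G u, (∀ v, v ∉ K → u v = w v) ∧ Cert Qs acc Δ M m j K G (!b) u S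

lemma decode {n : ℕ} {Ω : Type} (Qs : Ω → (Fin n → Bool) → Finset (Fin n))
    (acc : Bool → Ω → (Fin n → Bool) → Prop) (Δ M : ℕ → ℝ) (m : ℕ → ℕ) (Q : ℕ)
    (hloc : ∀ ω u w, (∀ v ∈ Qs ω w, u v = w v) →
      Qs ω u = Qs ω w ∧ ∀ b, acc b ω u ↔ acc b ω w)
    (w w' : Fin n → Bool) (b b' : Bool) (S : Finset (Fin n)) (hS : ∀ v ∈ S, w v = w' v)
    (hG : Good Qs acc Δ M m Q w' b' S) (hD : ¬ Danger Qs acc Δ M m Q w b S) : b = b' := by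
  by_contra hne
  have hb : b' = !b := by cases b <;> cases b' <;> simp_all
  subst hb
  apply hD
  obtain ⟨j, hj, K, G, hK, hacc, hdeg, hM⟩ := hG
  set u : Fin n → Bool := fun v => if v ∈ K then w' v else w v with hu
  have hag : ∀ ω ∈ G, Qs ω u = Qs ω w' ∧ ∀ b, acc b ω u ↔ acc b ω w' := by
    intro ω hω
    apply hloc
    intro v hv
    simp only [hu]
    split_ifs with hvK
    · rfl
    · exact hS v ((hacc ω hω).2.2 (Finset.mem_sdiff.mpr ⟨hv, hvK⟩))
  refine ⟨j, hj, K, G, u, fun v hv => by simp [hu, hv], hK, ?_, ?_, hM⟩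
  · intro ω hω
    rw [(hag ω hω).1, (hag ω hω).2]
    exact hacc ω hω
  · intro v
    rw [Finset.filter_congr (q := fun ω => v ∈ Qs ω w' \ K)]
    · exact hdeg v
    · intro ω hω
      rw [(hag ω hω).1]

lemma card_heavy {n : ℕ} {Ω : Type} [Fintype Ω] (Qf : Ω → Finset (Fin n)) (Q : ℕ)
    (hQ : ∀ ω, (Qf ω).card ≤ Q) (D : ℝ) :
    ((Finset.univ.filter fun v : Fin n =>
      D < ((Finset.univ.filter fun ω => v ∈ Qf ω).card : ℝ)).card : ℝ) * D
      ≤ Q * Fintype.card Ω := by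
  set H := Finset.univ.filter fun v : Fin n =>
      D < ((Finset.univ.filter fun ω => v ∈ Qf ω).card : ℝ) with hH
  have h1 : (H.card : ℝ) * D ≤ ∑ v ∈ H, ((Finset.univ.filter fun ω => v ∈ Qf ω).card : ℝ) := by
    rw [← nsmul_eq_mul, ← Finset.sum_const]
    refine Finset.sum_le_sum fun v hv => ?_
    simp only [hH, Finset.mem_filter] at hv
    exact hv.2.le
  have h2 : ∑ v ∈ H, ((Finset.univ.filter fun ω => v ∈ Qf ω).card : ℝ) ≤
      ∑ v : Fin n, ((Finset.univ.filter fun ω => v ∈ Qf ω).card : ℝ) :=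
    Finset.sum_le_sum_of_subset_of_nonneg (Finset.subset_univ _) (fun _ _ _ => by positivity)
  have h3 : ∑ v : Fin n, (Finset.univ.filter fun ω => v ∈ Qf ω).card = ∑ ω, (Qf ω).card := by
    simp only [Finset.card_filter]
    rw [Finset.sum_comm]
    refine Finset.sum_congr rfl fun ω _ => ?_
    simp
  have h4 : ∑ ω, (Qf ω).card ≤ Fintype.card Ω * Q := by
    have := Finset.sum_le_sum (s := Finset.univ) (fun ω _ => hQ ω)
    simpa using this
  have h5 : ∑ v : Fin n, ((Finset.univ.filter fun ω => v ∈ Qf ω).card : ℝ) ≤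
      Fintype.card Ω * Q := by
    exact_mod_cast h3.trans_le h4
  linarith

lemma Pr_not_good {n : ℕ} (hn : 0 < n) {p : ℝ} (hp : 0 < p) (hp1 : p ≤ 1) {Ω : Type} [Fintype Ω]
    [Nonempty Ω] (Qs : Ω → (Fin n → Bool) → Finset (Fin n))
    (acc : Bool → Ω → (Fin n → Bool) → Prop) (m : ℕ → ℕ) (Q : ℕ)
    (hQ : ∀ ω w, (Qs ω w).card ≤ Q) (t : ℕ → ℝ) (ht : ∀ j, 0 < t j) (htm : Monotone t)
    (g η : ℝ) (hg : 0 < g)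
    (hm : ∀ j a : ℕ, j ≤ Q → (a : ℝ) * t (j + 1) ≤ Q * n → a ≤ m j)
    (hη : ∀ j ≤ Q, 4 * (j * t j) * (Q + 1) ≤ η * (n * g * p ^ j))
    (w : Fin n → Bool) (b : Bool)
    (hgood : g * Fintype.card Ω ≤ ((Finset.univ.filter fun ω => acc b ω w).card : ℝ)) :
    Pr p (fun S => ¬ Good Qs acc (fun j => t j * Fintype.card Ω / n)
      (fun j => Fintype.card Ω * p ^ j * g / (2 * (Q + 1))) m Q w b S) ≤ η := by
  set N : ℝ := (Fintype.card Ω : ℝ) with hN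
  have hN0 : 0 < N := by
    rw [hN, Nat.cast_pos]
    exact Fintype.card_pos
  have hn' : (0 : ℝ) < n := by exact_mod_cast hn
  set K : ℕ → Finset (Fin n) := fun j => Finset.univ.filter fun v : Fin n =>
      t j * N / n < ((Finset.univ.filter fun ω => v ∈ Qs ω w).card : ℝ) with hK
  have hKm : ∀ j, K (j + 1) ⊆ K j := by
    intro j v hv
    simp only [hK, Finset.mem_filter, Finset.mem_univ, true_and] at hv ⊢
    refine lt_of_le_of_lt ?_ hv
    have := htm (Nat.le_succ j)
    gcongr
  have hlev := fun ω => exists_level K hKm (Qs ω w) Q (hQ ω w)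
  choose lev hlevQ hlevc hlevd using hlev
  set F : Finset Ω := Finset.univ.filter fun ω => acc b ω w with hF
  -- pigeonhole
  obtain ⟨j, hj, hjF⟩ : ∃ j ∈ Finset.range (Q + 1),
      g * N / (Q + 1) ≤ ((F.filter fun ω => lev ω = j).card : ℝ) := by
    by_contra hcon
    push Not at hcon
    have hsum : F.card = ∑ j ∈ Finset.range (Q + 1), (F.filter fun ω => lev ω = j).card :=
      Finset.card_eq_sum_card_fiberwise (fun ω _ => by
        simpa using Nat.lt_succ_of_le (hlevQ ω))
    have h2 : (F.card : ℝ) = ∑ j ∈ Finset.range (Q + 1),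
        ((F.filter fun ω => lev ω = j).card : ℝ) := by exact_mod_cast hsum
    have h3 : ∑ j ∈ Finset.range (Q + 1), ((F.filter fun ω => lev ω = j).card : ℝ) <
        ∑ j ∈ Finset.range (Q + 1), g * N / (Q + 1) :=
      Finset.sum_lt_sum_of_nonempty ⟨0, by simp⟩ hcon
    rw [Finset.sum_const, Finset.card_range, nsmul_eq_mul] at h3
    push_cast at h3
    have h4 : ((Q : ℝ) + 1) * (g * N / (Q + 1)) = g * N := by field_simp
    linarith
  set F' := F.filter fun ω => lev ω = j with hF'
  have hjQ : j ≤ Q := by simpa [Nat.lt_succ_iff] using hj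
  set A : Ω → Finset (Fin n) := fun ω => Qs ω w \ K (j + 1) with hA
  have hAc : ∀ ω ∈ F', (A ω).card = j := by
    intro ω hω
    simp only [hF', Finset.mem_filter] at hω
    have := hlevc ω
    rwa [hω.2] at this
  have hΔ0 : 0 ≤ t j * N / n := by have := ht j; positivity
  have hdeg : ∀ v, ((F'.filter fun ω => v ∈ A ω).card : ℝ) ≤ t j * N / n := by
    intro v
    by_cases hv : v ∈ K j
    · have : F'.filter (fun ω => v ∈ A ω) = ∅ := by
        apply Finset.filter_eq_empty_iff.mpr
        intro ω hω hvA
        simp only [hF', Finset.mem_filter] at hω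
        have := hlevd ω v
        rw [hω.2] at this
        exact this hvA hv
      rw [this]; simpa using hΔ0
    · simp only [hK, Finset.mem_filter, Finset.mem_univ, true_and, not_lt] at hv
      refine le_trans ?_ hv
      have : F'.filter (fun ω => v ∈ A ω) ⊆ Finset.univ.filter fun ω => v ∈ Qs ω w := by
        intro ω hω
        simp only [Finset.mem_filter, hA, Finset.mem_sdiff] at hω
        simp [hω.2.1]
      exact_mod_cast Finset.card_le_card this
  have hlt := lower_tail hp hp1 F' A j hAc _ hΔ0 hdeg
  have hmono : Pr p (fun S => ¬ Good Qs acc (fun j => t j * N / n)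
      (fun j => N * p ^ j * g / (2 * (Q + 1))) m Q w b S) ≤
      Pr p (fun S => ((F'.filter fun ω => A ω ⊆ S).card : ℝ) < F'.card * p ^ j / 2) := by
    apply Pr_mono hp.le hp1
    intro S hS
    by_contra hcon
    rw [not_lt] at hcon
    apply hS
    refine ⟨j, hjQ, K (j + 1), F'.filter fun ω => A ω ⊆ S, ?_, ?_, ?_, ?_⟩
    · apply hm j _ hjQ
      have := card_heavy (fun ω => Qs ω w) Q (fun ω => hQ ω w) (t (j + 1) * N / n)
      have h6 : ((K (j + 1)).card : ℝ) * (t (j + 1) * N / n) ≤ Q * N := this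
      have h7 : ((K (j + 1)).card : ℝ) * (t (j + 1) * N / n) =
        (((K (j + 1)).card : ℝ) * t (j + 1)) * N / n := by ring
      rw [h7, div_le_iff₀ hn'] at h6
      have h8 : (((K (j + 1)).card : ℝ) * t (j + 1)) * N ≤ (Q * n) * N := by linarith
      exact le_of_mul_le_mul_right h8 hN0
    · intro ω hω
      simp only [Finset.mem_filter] at hω
      refine ⟨?_, hAc ω hω.1, hω.2⟩
      have := hω.1
      simp only [hF', hF, Finset.mem_filter] at this
      exact this.1.2
    · intro v
      refine le_trans ?_ (hdeg v)
      have : (F'.filter fun ω => A ω ⊆ S).filter (fun ω => v ∈ Qs ω w \ K (j + 1)) ⊆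
          F'.filter (fun ω => v ∈ A ω) :=
        Finset.filter_subset_filter _ (Finset.filter_subset _ _)
      exact_mod_cast Finset.card_le_card this
    · refine le_trans ?_ hcon
      have hpj : 0 < p ^ j := by positivity
      calc N * p ^ j * g / (2 * (Q + 1)) = (g * N / (Q + 1)) * p ^ j / 2 := by field_simp
        _ ≤ _ := by gcongr
  refine hmono.trans ?_
  set P0 := Pr p (fun S => ((F'.filter fun ω => A ω ⊆ S).card : ℝ) < F'.card * p ^ j / 2)
  have hpj : 0 < p ^ j := by positivity
  have hP0 : 0 ≤ P0 := Finset.sum_nonneg fun S _ => by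
    have := wt_nonneg hp.le hp1 S
    split_ifs <;> simp [this]
  have h9 : (g * N / (Q + 1)) * p ^ j * P0 ≤ 4 * (j * (t j * N / n)) :=
    le_trans (by gcongr) hlt
  have h10 := hη j hjQ
  have h11 : 4 * (j * (t j * N / n)) ≤ (g * N / (Q + 1)) * p ^ j * η := by
    have e1 : 4 * (j * (t j * N / n)) = (4 * (j * t j) * (Q + 1)) * (N / (n * (Q + 1))) := by
      field_simp
    have e2 : (g * N / (Q + 1)) * p ^ j * η = η * (n * g * p ^ j) * (N / (n * (Q + 1))) := by
      field_simp
    rw [e1, e2]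
    gcongr
  exact le_of_mul_le_mul_left (h9.trans h11) (by positivity)

/-- The number of sets of cardinality at most `m`. -/
lemma card_small_sets (n m : ℕ) :
    (Finset.univ.filter fun A : Finset (Fin n) => A.card ≤ m).card ≤ (n + 1) ^ m := by
  have hsub : (Finset.univ.filter fun A : Finset (Fin n) => A.card ≤ m) ⊆
      (Finset.univ : Finset (Fin m → Option (Fin n))).image
        (fun f => Finset.univ.filter fun v => ∃ a, f a = some v) := by
    intro A hA
    simp only [Finset.mem_filter, Finset.mem_univ, true_and] at hA
    simp only [Finset.mem_image, Finset.mem_univ, true_and]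
    refine ⟨fun a => if h : a.1 < A.card then some (A.equivFin.symm ⟨a.1, h⟩).1 else none, ?_⟩
    ext v
    simp only [Finset.mem_filter, Finset.mem_univ, true_and]
    constructor
    · rintro ⟨a, ha⟩
      split_ifs at ha with h
      simp only [Option.some.injEq] at ha
      rw [← ha]; exact (A.equivFin.symm ⟨a.1, h⟩).2
    · intro hv
      have hlt := (A.equivFin ⟨v, hv⟩).2
      refine ⟨⟨(A.equivFin ⟨v, hv⟩).1, by omega⟩, ?_⟩
      simp
  have h1 := (Finset.card_le_card hsub).trans Finset.card_image_le
  simpa using h1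

lemma Pr_danger {n : ℕ} {p : ℝ} (hp : 0 < p) (hp1 : p ≤ 1) {Ω : Type} [Fintype Ω]
    (Qs : Ω → (Fin n → Bool) → Finset (Fin n))
    (acc : Bool → Ω → (Fin n → Bool) → Prop) (Δ M : ℕ → ℝ) (m r : ℕ → ℕ) (Q : ℕ)
    (hΔ : ∀ j, 0 ≤ Δ j) (hM : ∀ j, 0 < M j) (e η : ℝ)
    (hr : ∀ j ≤ Q, (r j * j : ℝ) * Δ j ≤ M j / 2)
    (he : ∀ j ≤ Q, 4 * (e * p ^ j) ≤ M j)
    (hη : ∀ j ≤ Q, ((n : ℝ) + 1) ^ (2 * m j) * (1 / 2) ^ r j ≤ η)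
    (w : Fin n → Bool) (b : Bool)
    (hbad : ∀ u : Fin n → Bool, ∀ j ≤ Q, (Finset.univ.filter fun v => u v ≠ w v).card ≤ m j →
      ((Finset.univ.filter fun ω => acc (!b) ω u).card : ℝ) ≤ e) :
    Pr p (Danger Qs acc Δ M m Q w b) ≤ (Q + 1) * η := by
  set small : ℕ → Finset (Finset (Fin n)) := fun j =>
    Finset.univ.filter fun A : Finset (Fin n) => A.card ≤ m j with hsmall
  set fl : Finset (Fin n) → Fin n → Bool := fun B v => if v ∈ B then !(w v) else w v with hfl
  set E : ℕ → Finset (Fin n) → Finset (Fin n) → Finset (Fin n) → Prop := fun j K B S =>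
    ∃ G, Cert Qs acc Δ M m j K G (!b) (fl B) S with hE
  have h1 : Pr p (Danger Qs acc Δ M m Q w b) ≤
      Pr p (fun S => ∃ j ∈ Finset.range (Q + 1), ∃ K ∈ small j, ∃ B ∈ small j, E j K B S) := by
    apply Pr_mono hp.le hp1
    rintro S ⟨j, hj, K, G, u, hu, hC⟩
    refine ⟨j, by simpa [Nat.lt_succ_iff] using hj, K, by simpa [hsmall] using hC.1,
      Finset.univ.filter fun v => u v ≠ w v, ?_, G, ?_⟩
    · simp only [hsmall, Finset.mem_filter, Finset.mem_univ, true_and]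
      refine le_trans (Finset.card_le_card ?_) hC.1
      intro v hv
      by_contra hvK
      simp only [Finset.mem_filter, Finset.mem_univ, true_and] at hv
      exact hv (hu v hvK)
    · have : fl (Finset.univ.filter fun v => u v ≠ w v) = u := by
        funext v
        simp only [hfl, Finset.mem_filter, Finset.mem_univ, true_and]
        cases hu1 : u v <;> cases hw1 : w v <;> simp
      rw [this]; exact hC
  have hone : ∀ j ≤ Q, ∀ K ∈ small j, ∀ B ∈ small j, Pr p (E j K B) ≤ (1 / 2) ^ r j := by
    intro j hj K hK B hB
    set F : Finset Ω := Finset.univ.filter fun ω =>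
      acc (!b) ω (fl B) ∧ (Qs ω (fl B) \ K).card = j with hF
    have hFc : (F.card : ℝ) ≤ e := by
      refine le_trans ?_ (hbad (fl B) j hj ?_)
      · have : F ⊆ Finset.univ.filter fun ω => acc (!b) ω (fl B) := by
          intro ω hω
          simp only [hF, Finset.mem_filter, Finset.mem_univ, true_and] at hω
          simp [hω.1]
        exact_mod_cast Finset.card_le_card this
      · simp only [hsmall, Finset.mem_filter, Finset.mem_univ, true_and] at hB
        refine le_trans (Finset.card_le_card ?_) hB
        intro v hv
        by_contra hvB
        simp [hfl, hvB] at hv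
    have hup := upper_tail hp.le hp1 F (fun ω => Qs ω (fl B) \ K) j (by
      intro ω hω
      simp only [hF, Finset.mem_filter, Finset.mem_univ, true_and] at hω
      exact hω.2) (Δ j) (M j) (hΔ j) (hM j) (r j) (hr j hj) (by
        refine le_trans ?_ (he j hj)
        gcongr)
    refine le_trans ?_ hup
    apply Pr_mono hp.le hp1
    rintro S ⟨G, _, hG, hdeg, hMG⟩
    refine ⟨G, ?_, fun ω hω => (hG ω hω).2.2, hdeg, hMG⟩
    intro ω hω
    simp only [hF, Finset.mem_filter, Finset.mem_univ, true_and]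
    exact ⟨(hG ω hω).1, (hG ω hω).2.1⟩
  refine h1.trans ((Pr_exists hp.le hp1 _ _).trans ?_)
  have h2 : ∀ j ∈ Finset.range (Q + 1),
      Pr p (fun S => ∃ K ∈ small j, ∃ B ∈ small j, E j K B S) ≤ η := by
    intro j hj
    have hjQ : j ≤ Q := by simpa [Nat.lt_succ_iff] using hj
    refine le_trans ?_ (hη j hjQ)
    refine (Pr_exists hp.le hp1 _ _).trans ?_
    have hsc : ((small j).card : ℝ) ≤ ((n : ℝ) + 1) ^ m j := by
      exact_mod_cast card_small_sets n (m j)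
    have h3 : ∀ K ∈ small j, Pr p (fun S => ∃ B ∈ small j, E j K B S) ≤
        ((n : ℝ) + 1) ^ m j * (1 / 2) ^ r j := by
      intro K hK
      refine (Pr_exists hp.le hp1 _ _).trans ?_
      refine (Finset.sum_le_sum fun B hB => hone j hjQ K hK B hB).trans ?_
      rw [Finset.sum_const, nsmul_eq_mul]
      gcongr
    refine (Finset.sum_le_sum h3).trans ?_
    rw [Finset.sum_const, nsmul_eq_mul]
    calc _ ≤ ((n : ℝ) + 1) ^ m j * (((n : ℝ) + 1) ^ m j * (1 / 2) ^ r j) := by gcongr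
      _ = _ := by rw [two_mul, pow_add]; ring
  refine (Finset.sum_le_sum h2).trans ?_
  rw [Finset.sum_const, nsmul_eq_mul, Finset.card_range]
  push_cast
  rfl

/-- Final counting argument. -/
lemma counting {n k : ℕ} {p : ℝ} (hp : 0 < p) (hp1 : p ≤ 1)
    (C : (Fin k → Bool) → (Fin n → Bool))
    (B : (Fin k → Bool) → Fin k → Finset (Fin n) → Prop) (β : ℝ) (b : ℕ)
    (hB : ∀ x i, Pr p (B x i) ≤ β) (hb : 2 * (k * β) ≤ b)
    (hdec : ∀ S x x', (∀ v ∈ S, C x v = C x' v) → ∀ i, ¬ B x i S → ¬ B x' i S → x i = x' i) :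
    (2 : ℝ) ^ k ≤ 2 * ((1 + p) ^ n * ((k : ℝ) + 1) ^ (2 * b)) := by
  set bc : (Fin k → Bool) → Finset (Fin n) → ℕ := fun x S =>
    (Finset.univ.filter fun i => B x i S).card with hbc
  -- each sample: few `x` with few failures
  have hcount : ∀ S : Finset (Fin n),
      ((Finset.univ.filter fun x => bc x S ≤ b).card : ℝ) ≤
        2 ^ S.card * ((k : ℝ) + 1) ^ (2 * b) := by
    intro S
    set X := Finset.univ.filter fun x => bc x S ≤ b with hX
    have hfib : ∀ s ∈ (Finset.univ : Finset (S → Bool)),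
        (X.filter fun x => (fun v : S => C x v.1) = s).card ≤ (k + 1) ^ (2 * b) := by
      intro s _
      rcases (X.filter fun x => (fun v : S => C x v.1) = s).eq_empty_or_nonempty with h0 | ⟨x0, h0⟩
      · rw [h0]; simp
      · refine le_trans ?_ (card_small_sets k (2 * b))
        apply Finset.card_le_card_of_injOn (fun x => Finset.univ.filter fun i => x i ≠ x0 i)
        · intro x hx
          simp only [Finset.coe_filter, Set.mem_ofPred_eq, Finset.mem_univ, true_and]
          simp only [Finset.coe_filter, Set.mem_ofPred_eq, hX, Finset.mem_filter, Finset.mem_univ,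
            true_and] at hx h0
          have hsub : (Finset.univ.filter fun i => x i ≠ x0 i) ⊆
              (Finset.univ.filter fun i => B x i S) ∪ (Finset.univ.filter fun i => B x0 i S) := by
            intro i hi
            simp only [Finset.mem_filter, Finset.mem_univ, true_and, Finset.mem_union] at hi ⊢
            by_contra hcon
            push Not at hcon
            apply hi
            apply hdec S x x0 _ i hcon.1 hcon.2
            intro v hv
            have := congrFun (hx.2.trans h0.2.symm) ⟨v, hv⟩
            exact this
          have h1 := (Finset.card_le_card hsub).trans (Finset.card_union_le _ _)
          have h2 := hx.1
          have h3 := h0.1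
          simp only [hbc] at h2 h3
          omega
        · intro x _ y _ hxy
          funext i
          have : (x i ≠ x0 i) ↔ (y i ≠ x0 i) := by
            have := Finset.ext_iff.mp hxy i
            simpa using this
          cases hx : x i <;> cases hy : y i <;> cases hz : x0 i <;> simp_all
    have h4 := Finset.card_le_mul_card_image_of_maps_to (s := X)
      (t := (Finset.univ : Finset (S → Bool))) (f := fun x => (fun v : S => C x v.1))
      (fun _ _ => Finset.mem_univ _) ((k + 1) ^ (2 * b)) hfib
    have h5 : X.card ≤ (k + 1) ^ (2 * b) * 2 ^ S.card := by simpa using h4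
    calc (X.card : ℝ) ≤ (((k + 1) ^ (2 * b) * 2 ^ S.card : ℕ) : ℝ) := by exact_mod_cast h5
      _ = _ := by push_cast; ring
  -- each `x`: probability at least one half of few failures
  have hhalf : ∀ x, (1 : ℝ) / 2 ≤ Pr p (fun S => bc x S ≤ b) := by
    intro x
    have hm := Pr_markov hp.le hp1 (fun S => ¬ bc x S ≤ b) (fun S => (bc x S : ℝ))
      (fun S => by positivity) ((b : ℝ) + 1) (by
        intro S hS
        have : b + 1 ≤ bc x S := by omega
        exact_mod_cast this)
    have h1 : ∑ S, wt p S * (bc x S : ℝ) ≤ k * β := by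
      have : ∀ S, wt p S * (bc x S : ℝ) = ∑ i, if B x i S then wt p S else 0 := by
        intro S
        simp [hbc, Finset.sum_ite, mul_comm]
      simp only [this]
      rw [Finset.sum_comm]
      refine (Finset.sum_le_sum fun i _ => hB x i).trans ?_
      simp
    have h2 : Pr p (fun S => bc x S ≤ b) + Pr p (fun S => ¬ bc x S ≤ b) = 1 := by
      unfold Pr
      rw [← Finset.sum_add_distrib, ← sum_wt (n := n) p]
      refine Finset.sum_congr rfl fun S _ => ?_
      by_cases h : bc x S ≤ b <;> simp [h]
    have hb0 : (0 : ℝ) ≤ b := by positivity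
    by_contra hcon
    push Not at hcon
    have : (1 : ℝ) / 2 < Pr p (fun S => ¬ bc x S ≤ b) := by linarith
    nlinarith
  have hsum : (2 : ℝ) ^ k * (1 / 2) ≤ ∑ x, Pr p (fun S => bc x S ≤ b) := by
    have := Finset.sum_le_sum (s := Finset.univ) (fun x _ => hhalf x)
    simpa using this
  have hsw : ∑ x, Pr p (fun S => bc x S ≤ b) =
      ∑ S, wt p S * ((Finset.univ.filter fun x => bc x S ≤ b).card : ℝ) := by
    unfold Pr
    rw [Finset.sum_comm]
    refine Finset.sum_congr rfl fun S _ => ?_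
    rw [Finset.card_filter]
    push_cast
    rw [Finset.mul_sum]
    refine Finset.sum_congr rfl fun x _ => ?_
    by_cases h : bc x S ≤ b <;> simp [h]
  have hfin : ∑ S, wt p S * ((Finset.univ.filter fun x => bc x S ≤ b).card : ℝ) ≤
      (1 + p) ^ n * ((k : ℝ) + 1) ^ (2 * b) := by
    rw [← sum_wt_two p, Finset.sum_mul]
    refine Finset.sum_le_sum fun S _ => ?_
    rw [mul_assoc]
    exact mul_le_mul_of_nonneg_left (hcount S) (wt_nonneg hp.le hp1 S)
  linarith [hsum, hsw, hfin]

lemma tree_loc {n : ℕ} {O : Type} (t : DTree Bool n O) : ∀ u w : Fin n → Bool,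
    (∀ v ∈ t.queries w, u v = w v) → t.queries u = t.queries w ∧ t.eval u = t.eval w := by
  induction t with
  | leaf b => intro u w _; simp [DTree.queries, DTree.eval]
  | node i ts ih =>
    intro u w h
    simp only [DTree.queries, Finset.mem_insert, forall_eq_or_imp] at h
    have h1 := ih (w i) u w h.2
    simp only [DTree.queries, DTree.eval, h.1, h1]
    simp

lemma tree_card {n : ℕ} {O : Type} (t : DTree Bool n O) : ∀ w : Fin n → Bool,
    (t.queries w).card ≤ t.depth := by
  induction t with
  | leaf b => intro w; simp [DTree.queries]
  | node i ts ih =>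
    intro w
    rw [DTree.queries, DTree.depth]
    have h1 := Finset.card_insert_le i ((ts (w i)).queries w)
    have h2 := ih (w i) w
    have h3 : (ts (w i)).depth ≤ Finset.univ.sup fun a => (ts a).depth :=
      Finset.le_sup (f := fun a => (ts a).depth) (Finset.mem_univ _)
    omega

/-- Queries of `L` independent runs. -/
noncomputable def pQ {n : ℕ} {D : Multiset (DTree Bool n (Option Bool))} {L : ℕ}
    (ω : Fin L → D) (w : Fin n → Bool) : Finset (Fin n) :=
  Finset.univ.biUnion fun l => DTree.queries (ω l).1 w

/-- All `L` independent runs output `b`. -/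
def pAcc {n : ℕ} {D : Multiset (DTree Bool n (Option Bool))} {L : ℕ}
    (b : Bool) (ω : Fin L → D) (w : Fin n → Bool) : Prop :=
  ∀ l, DTree.eval (ω l).1 w = some b

lemma pQ_card {n q : ℕ} {D : Multiset (DTree Bool n (Option Bool))} {L : ℕ}
    (hD : ∀ t ∈ D, DTree.depth t ≤ q) (ω : Fin L → D) (w : Fin n → Bool) :
    (pQ ω w).card ≤ q * L := by
  unfold pQ
  refine Finset.card_biUnion_le.trans ?_
  refine (Finset.sum_le_sum (g := fun _ => q) fun l _ => ?_).trans ?_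
  · exact (tree_card _ w).trans (hD _ (Multiset.coe_mem))
  · simp [mul_comm]

lemma p_loc {n : ℕ} {D : Multiset (DTree Bool n (Option Bool))} {L : ℕ}
    (ω : Fin L → D) (u w : Fin n → Bool) (h : ∀ v ∈ pQ ω w, u v = w v) :
    pQ ω u = pQ ω w ∧ ∀ b, pAcc b ω u ↔ pAcc b ω w := by
  have h1 : ∀ l, DTree.queries (ω l).1 u = DTree.queries (ω l).1 w ∧
      DTree.eval (ω l).1 u = DTree.eval (ω l).1 w := by
    intro l
    apply tree_loc
    intro v hv
    apply h
    simp only [pQ, Finset.mem_biUnion, Finset.mem_univ, true_and]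
    exact ⟨l, hv⟩
  constructor
  · unfold pQ
    exact Finset.biUnion_congr rfl fun l _ => (h1 l).1
  · intro b
    unfold pAcc
    simp only [(h1 _).2]

lemma pAcc_card {n : ℕ} (D : Multiset (DTree Bool n (Option Bool))) (L : ℕ)
    (b : Bool) (w : Fin n → Bool) :
    (Finset.univ.filter fun ω : Fin L → D => pAcc b ω w).card =
      (Multiset.countP (fun t => DTree.eval t w = some b) D) ^ L := by
  have h1 : (Finset.univ.filter fun a : D => DTree.eval a.1 w = some b).card =
      Multiset.countP (fun t => DTree.eval t w = some b) D := by
    conv_rhs => rw [← Multiset.map_univ_coe D]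
    rw [Multiset.countP_map]
    rfl
  have h2 : (Finset.univ.filter fun ω : Fin L → D => pAcc b ω w) =
      Fintype.piFinset fun _ : Fin L => Finset.univ.filter fun a : D => DTree.eval a.1 w = some b := by
    ext ω
    simp only [Finset.mem_filter, Fintype.mem_piFinset, Finset.mem_univ, true_and]
    rfl
  rw [h2, Fintype.card_piFinset, Finset.prod_const, h1]
  simp

lemma card_omega {n : ℕ} (D : Multiset (DTree Bool n (Option Bool))) (L : ℕ) :
    (Fintype.card (Fin L → D)) = (Multiset.card D) ^ L := by
  simp

lemma good_count {n : ℕ} (D : Multiset (DTree Bool n (Option Bool))) (hD : D ≠ 0) (L : ℕ)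
    (b : Bool) (w : Fin n → Bool) (h : 2 / 3 ≤ prP D w (· = some b)) :
    (2 / 3 : ℝ) ^ L * Fintype.card (Fin L → D) ≤
      ((Finset.univ.filter fun ω : Fin L → D => pAcc b ω w).card : ℝ) := by
  rw [pAcc_card, card_omega]
  unfold prP at h
  have hc : (0 : ℝ) < (Multiset.card D : ℕ) := by
    exact_mod_cast Multiset.card_pos.mpr hD
  rw [le_div_iff₀ hc] at h
  push_cast
  rw [← mul_pow]
  apply pow_le_pow_left₀ (by positivity)
  refine h.trans (le_of_eq ?_)
  congr

lemma bad_count {n : ℕ} (D : Multiset (DTree Bool n (Option Bool))) (hD : D ≠ 0) (L : ℕ)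
    (b : Bool) (w : Fin n → Bool) (h : 2 / 3 ≤ prP D w (fun o => o = some b ∨ o = none)) :
    ((Finset.univ.filter fun ω : Fin L → D => pAcc (!b) ω w).card : ℝ) ≤
      (1 / 3 : ℝ) ^ L * Fintype.card (Fin L → D) := by
  rw [pAcc_card, card_omega]
  unfold prP at h
  have hc : (0 : ℝ) < (Multiset.card D : ℕ) := by
    exact_mod_cast Multiset.card_pos.mpr hD
  rw [le_div_iff₀ hc] at h
  push_cast
  rw [← mul_pow]
  apply pow_le_pow_left₀ (by positivity)
  have h1 := Multiset.card_eq_countP_add_countP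
    (fun t : DTree Bool n (Option Bool) => DTree.eval t w = some b ∨ DTree.eval t w = none) D
  have h2 : Multiset.countP (fun t => DTree.eval t w = some (!b)) D ≤
      Multiset.countP (fun t : DTree Bool n (Option Bool) =>
        ¬ (DTree.eval t w = some b ∨ DTree.eval t w = none)) D := by
    rw [Multiset.countP_eq_card_filter, Multiset.countP_eq_card_filter]
    apply Multiset.card_le_card
    apply Multiset.monotone_filter_right
    intro t ht
    rw [ht]; cases b <;> simp
  have h3 : (Multiset.card D : ℝ) = (Multiset.countP (fun t : DTree Bool n (Option Bool) =>
      DTree.eval t w = some b ∨ DTree.eval t w = none) D : ℝ) +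
      (Multiset.countP (fun t : DTree Bool n (Option Bool) =>
        ¬ (DTree.eval t w = some b ∨ DTree.eval t w = none)) D : ℝ) := by exact_mod_cast h1
  have h4 : (Multiset.countP (fun t => DTree.eval t w = some (!b)) D : ℝ) ≤
      (Multiset.countP (fun t : DTree Bool n (Option Bool) =>
        ¬ (DTree.eval t w = some b ∨ DTree.eval t w = none)) D : ℝ) := by exact_mod_cast h2
  have h5 : 2 / 3 * (Multiset.card D : ℝ) ≤
      (Multiset.countP (fun t : DTree Bool n (Option Bool) =>
        DTree.eval t w = some b ∨ DTree.eval t w = none) D : ℝ) := by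
    refine h.trans (le_of_eq ?_)
    congr
  linarith

theorem core_s17 {n k q L lam : ℕ} (hn : 0 < n) (hkn : k ≤ n) (hq : 1 ≤ q) (hL1 : 1 ≤ L)
    (C : (Fin k → Bool) → (Fin n → Bool)) (D : Fin k → Multiset (DTree Bool n (Option Bool)))
    (δ p : ℝ) (hδ : 0 < δ) (hδ1 : δ < 1) (hp : 0 < p) (hp1 : p ≤ 1)
    (hD0 : ∀ i, D i ≠ 0) (hdep : ∀ i, ∀ t ∈ D i, DTree.depth t ≤ q)
    (hcomp : ∀ (i : Fin k) (x : Fin k → Bool), 2 / 3 ≤ prP (D i) (C x) (· = some (x i)))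
    (hrel : ∀ (i : Fin k) (x : Fin k → Bool) (w : Fin n → Bool), relDist w (C x) ≤ δ →
      2 / 3 ≤ prP (D i) w (fun o => o = some (x i) ∨ o = none))
    (hL : 8 * (q * L + 1) ≤ 2 ^ L) (hlam : n + 1 ≤ 2 ^ lam) (T : ℝ)
    (hT : T = ((q * L : ℕ) : ℝ) / δ * ((12 * lam * ((q * L : ℕ) + 1) ^ 2 * (q * L : ℕ) *
      (3 / 2) ^ L) / p ^ (q * L)) ^ (q * L + 1))
    (hTn : T ≤ n) :
    (2 : ℝ) ^ k ≤ 2 * ((1 + p) ^ n * ((k : ℝ) + 1) ^ (2 * ⌈4 * T⌉₊)) := by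
  have hn' : (0 : ℝ) < n := by exact_mod_cast hn
  have hQ1 : 1 ≤ q * L := Nat.one_le_iff_ne_zero.mpr (by positivity)
  have hlam1 : 1 ≤ lam := by
    by_contra h
    have : lam = 0 := by omega
    subst this
    simp at hlam; omega
  generalize hQdef : q * L = Q at *
  have hQ1' : (1 : ℝ) ≤ Q := by exact_mod_cast hQ1
  have hlam1' : (1 : ℝ) ≤ lam := by exact_mod_cast hlam1
  set g : ℝ := (2 / 3) ^ L with hg
  have hg0 : 0 < g := by positivity
  set X : ℝ := 12 * lam * (Q + 1) ^ 2 * Q * (3 / 2) ^ L with hX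
  set B : ℝ := X / p ^ Q with hB
  have hB0 : 0 < B := by positivity
  have hgL : (3 / 2 : ℝ) ^ L * g = 1 := by
    rw [hg, ← mul_pow]; norm_num
  have key : ∀ j ≤ Q, 12 * lam * (Q + 1) ^ 2 * Q ≤ B * g * p ^ j := by
    intro j hj
    have h1 : B * g * p ^ j = 12 * lam * (Q + 1) ^ 2 * Q * (p ^ j / p ^ Q) := by
      calc B * g * p ^ j = 12 * lam * (Q + 1) ^ 2 * Q * ((3 / 2) ^ L * g) * (p ^ j / p ^ Q) := by
            rw [hB, hX]; ring
        _ = _ := by rw [hgL]; ring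
    rw [h1]
    have h2 : 1 ≤ p ^ j / p ^ Q := by
      rw [le_div_iff₀ (by positivity), one_mul]
      exact pow_le_pow_of_le_one hp.le hp1 hj
    exact le_mul_of_one_le_right (by positivity) h2
  have hg1 : g ≤ 1 := pow_le_one₀ (by norm_num) (by norm_num)
  have hBQ : (Q : ℝ) + 1 ≤ B := by
    have h1 := key 0 (Nat.zero_le _)
    rw [pow_zero, mul_one] at h1
    have h2 : B * g ≤ B := mul_le_of_le_one_right hB0.le hg1
    have h3 : (Q : ℝ) + 1 ≤ 12 * lam * (Q + 1) ^ 2 * Q := by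
      have : (1 : ℝ) ≤ 12 * lam * (Q + 1) * Q := by
        have : (1:ℝ) ≤ lam * Q := one_le_mul_of_one_le_of_one_le hlam1' hQ1'
        nlinarith
      nlinarith
    linarith
  have hB1 : 1 ≤ B := by linarith
  set t : ℕ → ℝ := fun j => Q / δ * B ^ j with ht
  have ht0 : ∀ j, 0 < t j := fun j => by positivity
  have htm : Monotone t := by
    intro a b hab
    simp only [ht]
    have := pow_le_pow_right₀ hB1 hab
    gcongr
  have htS : ∀ j, t (j + 1) = t j * B := fun j => by simp only [ht]; ring
  have htT : ∀ j ≤ Q, t (j + 1) ≤ T := by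
    intro j hj
    rw [hT]
    exact htm (by omega : j + 1 ≤ Q + 1)
  have hT0 : 0 < T := (ht0 1).trans_le (htT 0 (by omega))
  have hTQ : (Q : ℝ) + 1 ≤ T := by
    refine le_trans ?_ (htT 0 (by omega))
    simp only [ht, zero_add, pow_one]
    have : 1 ≤ Q / δ := by rw [le_div_iff₀ hδ]; linarith
    nlinarith
  set m : ℕ → ℕ := fun j => ⌊Q * n / t (j + 1)⌋₊ with hm
  have hmle : ∀ j, (m j : ℝ) ≤ Q * n / t (j + 1) := fun j =>
    Nat.floor_le (by have := ht0 (j + 1); positivity)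
  set r : ℕ → ℕ := fun j => ⌊p ^ j * g * n / (4 * (Q + 1) * Q * t j)⌋₊ with hr
  have hrle : ∀ j, (r j : ℝ) ≤ p ^ j * g * n / (4 * (Q + 1) * Q * t j) := fun j =>
    Nat.floor_le (by have := ht0 j; positivity)
  have hmδ : ∀ j, (m j : ℝ) ≤ δ * n := by
    intro j
    refine (hmle j).trans ?_
    rw [div_le_iff₀ (ht0 _)]
    have h1 : δ * n * t (j + 1) = Q * n * B ^ (j + 1) := by
      simp only [ht]; field_simp
    rw [h1]
    exact le_mul_of_one_le_right (by positivity) (one_le_pow₀ hB1)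
  have hrm : ∀ j ≤ Q, lam * (2 * m j + 2) ≤ r j := by
    intro j hj
    apply Nat.le_floor
    push_cast
    have hnt : 1 ≤ n / t (j + 1) := by
      rw [le_div_iff₀ (ht0 _), one_mul]; exact (htT j hj).trans hTn
    have h1 : (lam : ℝ) * (2 * m j + 2) ≤ lam * (2 * (Q * (n / t (j + 1))) + 2 * (n / t (j + 1))) := by
      have := hmle j
      rw [mul_div_assoc] at this
      gcongr
      linarith
    refine h1.trans ?_
    have h2 : p ^ j * g * n / (4 * (Q + 1) * Q * t j) =
        (B * g * p ^ j) * (n / t (j + 1)) / (4 * (Q + 1) * Q) := by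
      rw [htS]
      have := ht0 j
      field_simp
    rw [h2, le_div_iff₀ (by positivity)]
    have h3 := mul_le_mul_of_nonneg_right (key j hj) (zero_le_one.trans hnt)
    refine le_trans ?_ h3
    have h4 : (0 : ℝ) ≤ lam * (Q + 1) ^ 2 * Q * (n / t (j + 1)) := by
      have := ht0 (j + 1); positivity
    nlinarith
  set β : ℝ := T / n + (Q + 1) * (1 / ((n : ℝ) + 1) ^ 2) with hβ
  set Δ : ∀ i : Fin k, ℕ → ℝ := fun i j => t j * Fintype.card (Fin L → D i) / n with hΔ
  set M : ∀ i : Fin k, ℕ → ℝ := fun i j =>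
    Fintype.card (Fin L → D i) * p ^ j * g / (2 * (Q + 1)) with hM
  have hN0 : ∀ i, (0 : ℝ) < Fintype.card (Fin L → D i) := by
    intro i
    rw [card_omega]
    have := Multiset.card_pos.mpr (hD0 i)
    push_cast
    positivity
  refine counting hp hp1 C (fun x i S =>
    ¬ Good (Ω := Fin L → D i) pQ pAcc (Δ i) (M i) m Q (C x) (x i) S ∨
      Danger (Ω := Fin L → D i) pQ pAcc (Δ i) (M i) m Q (C x) (x i) S) β _ ?_ ?_ ?_
  · intro x i
    refine (Pr_or hp.le hp1 _ _).trans ?_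
    have : Nonempty (Fin L → D i) := by
      rw [← Fintype.card_pos_iff]
      exact_mod_cast hN0 i
    apply add_le_add
    · apply Pr_not_good hn hp hp1 pQ pAcc m Q _ t ht0 htm g (T / n) hg0 _ _ (C x) (x i)
      · exact good_count (D i) (hD0 i) L (x i) (C x) (hcomp i x)
      · intro ω w
        rw [← hQdef]
        exact pQ_card (hdep i) ω w
      · intro j a _ ha
        apply Nat.le_floor
        rw [le_div_iff₀ (ht0 _)]; exact ha
      · intro j hj
        have h1 : T / n * (n * g * p ^ j) = T * (g * p ^ j) := by field_simp
        rw [h1]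
        have h2 : t j * (B * g * p ^ j) ≤ T * (g * p ^ j) := by
          have := htT j hj
          rw [htS] at this
          calc t j * (B * g * p ^ j) = t j * B * (g * p ^ j) := by ring
            _ ≤ _ := by gcongr
        refine le_trans ?_ h2
        have h3 := mul_le_mul_of_nonneg_left (key j hj) (ht0 j).le
        refine le_trans ?_ h3
        have hj' : (j : ℝ) ≤ Q := by exact_mod_cast hj
        have := ht0 j
        calc 4 * (j * t j) * (Q + 1) ≤ 4 * (Q * t j) * (Q + 1) := by gcongr
          _ = t j * (4 * 1 * (Q + 1) ^ 1 * Q) := by ring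
          _ ≤ t j * (12 * lam * (Q + 1) ^ 2 * Q) := by
            gcongr <;> linarith
    · apply Pr_danger hp hp1 pQ pAcc (Δ i) (M i) m r Q _ _
        ((1 / 3) ^ L * Fintype.card (Fin L → D i)) _ _ _ _ (C x) (x i)
      · intro u j hj hu
        apply bad_count (D i) (hD0 i)
        apply hrel i x u
        unfold relDist
        rw [div_le_iff₀ hn']
        refine le_trans ?_ (hmδ j)
        exact_mod_cast hu
      · intro j
        have := ht0 j; have := hN0 i
        simp only [hΔ]; positivity
      · intro j
        have := hN0 i
        simp only [hM]; positivity
      · intro j hj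
        simp only [hΔ, hM]
        have hj' : (j : ℝ) ≤ Q := by exact_mod_cast hj
        have h0 := hN0 i
        have h1 := ht0 j
        calc (r j * j : ℝ) * (t j * Fintype.card (Fin L → D i) / n)
            ≤ (p ^ j * g * n / (4 * (Q + 1) * Q * t j) * Q) *
                (t j * Fintype.card (Fin L → D i) / n) := by
              have := hrle j
              gcongr
          _ = _ := by field_simp; ring
      · intro j hj
        simp only [hM]
        have h0 := hN0 i
        rw [le_div_iff₀ (by positivity)]
        have h1 : (8 : ℝ) * (Q + 1) ≤ 2 ^ L := by exact_mod_cast hL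
        have h2 : g = (1 / 3) ^ L * 2 ^ L := by rw [hg, ← mul_pow]; norm_num
        rw [h2]
        have h3 : (0 : ℝ) ≤ (1 / 3) ^ L * Fintype.card (Fin L → D i) * p ^ j := by positivity
        have := mul_le_mul_of_nonneg_left h1 h3
        calc _ = (1 / 3) ^ L * Fintype.card (Fin L → D i) * p ^ j * (8 * (Q + 1)) := by ring
          _ ≤ _ := this
          _ = _ := by ring
      · intro j hj
        have h1 : ((n : ℝ) + 1) ≤ 2 ^ lam := by exact_mod_cast hlam
        have h2 : ((n : ℝ) + 1) ^ (2 * m j + 2) ≤ 2 ^ r j := by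
          calc ((n : ℝ) + 1) ^ (2 * m j + 2) ≤ (2 ^ lam) ^ (2 * m j + 2) := by gcongr
            _ = 2 ^ (lam * (2 * m j + 2)) := by rw [← pow_mul]
            _ ≤ _ := pow_le_pow_right₀ (by norm_num) (hrm j hj)
        rw [one_div, inv_pow, le_div_iff₀ (by positivity), mul_right_comm, ← pow_add,
          ← div_eq_mul_inv, div_le_one (by positivity)]
        exact h2
  · refine le_trans ?_ (Nat.le_ceil _)
    have h1 : (Q + 1) * (1 / ((n : ℝ) + 1) ^ 2) ≤ T / n := by
      rw [mul_one_div]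
      apply div_le_div₀ hT0.le hTQ hn'
      nlinarith
    have hk : (k : ℝ) ≤ n := by exact_mod_cast hkn
    have h2 : k * β ≤ n * (2 * (T / n)) := by
      have : β ≤ 2 * (T / n) := by rw [hβ]; linarith
      have hT2 : 0 ≤ 2 * (T / n) := by positivity
      calc k * β ≤ k * (2 * (T / n)) := by gcongr
        _ ≤ _ := by gcongr
    have h3 : n * (2 * (T / n)) = 2 * T := by field_simp
    linarith
  · intro S x x' hS i h1 h2
    push Not at h1 h2
    exact decode pQ pAcc (Δ i) (M i) m Q p_loc (C x) (C x') (x i) (x' i) S hS h2.1 h1.2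

lemma singleton_bound {n k : ℕ} (hk : 1 ≤ k) (C : (Fin k → Bool) → (Fin n → Bool)) (δ : ℝ)
    (hδ : 0 < δ) (hdist : ∀ x y : Fin k → Bool, x ≠ y → 2 * δ < relDist (C x) (C y)) :
    (k : ℝ) - 1 ≤ n * (1 - 2 * δ) := by
  have hn0 : 0 < n := by
    by_contra h
    have : n = 0 := by omega
    subst this
    have := hdist (fun _ => true) (fun _ => false) (by
      intro h
      have := congrFun h ⟨0, hk⟩
      simp at this)
    simp [relDist] at this
    linarith
  have hn' : (0 : ℝ) < n := by exact_mod_cast hn0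
  set d := ⌊2 * δ * n⌋₊ with hd
  have hdiff : ∀ x y : Fin k → Bool, x ≠ y →
      d < (Finset.univ.filter fun v => C x v ≠ C y v).card := by
    intro x y hxy
    have h := hdist x y hxy
    unfold relDist at h
    rw [lt_div_iff₀ hn'] at h
    have h1 : (d : ℝ) ≤ 2 * δ * n := Nat.floor_le (by positivity)
    have h2 := h1.trans_lt h
    exact_mod_cast h2
  have hdn : d ≤ n := by
    have := hdiff (fun _ => true) (fun _ => false) (by
      intro h
      have := congrFun h ⟨0, hk⟩
      simp at this)
    have h2 := Finset.card_filter_le (Finset.univ : Finset (Fin n))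
      (fun v => C (fun _ => true) v ≠ C (fun _ => false) v)
    simp only [Finset.card_univ, Fintype.card_fin] at h2
    omega
  obtain ⟨S, hS, hSc⟩ := Finset.exists_subset_card_eq
    (s := (Finset.univ : Finset (Fin n))) (n := n - d) (by simp)
  have hinj : Function.Injective (fun x : Fin k → Bool => fun v : S => C x v.1) := by
    intro x y hxy
    by_contra hne
    have h := hdiff x y hne
    have hsub : (Finset.univ.filter fun v => C x v ≠ C y v) ⊆ Sᶜ := by
      intro v hv
      simp only [Finset.mem_filter, Finset.mem_univ, true_and] at hv
      simp only [Finset.mem_compl]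
      intro hvS
      exact hv (congrFun hxy ⟨v, hvS⟩)
    have h1 := Finset.card_le_card hsub
    rw [Finset.card_compl, hSc, Fintype.card_fin] at h1
    omega
  have hc := Fintype.card_le_of_injective _ hinj
  simp only [Fintype.card_fun, Fintype.card_bool, Fintype.card_fin, Fintype.card_coe, hSc] at hc
  have hk2 : k ≤ n - d := (Nat.pow_le_pow_iff_right (by norm_num)).mp hc
  have hk3 : k + d ≤ n := by omega
  have hk4 : (k : ℝ) + d ≤ n := by exact_mod_cast hk3
  have h5 := Nat.lt_floor_add_one (2 * δ * n)
  rw [← hd] at h5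
  linarith

lemma params {q L : ℕ} (hq : 1 ≤ q) (hL : L = ⌈8 * Real.logb 2 ((q : ℝ) + 2)⌉₊) :
    1 ≤ Real.logb 2 ((q : ℝ) + 2) ∧ (L : ℝ) ≤ 9 * Real.logb 2 ((q : ℝ) + 2) ∧
    (2 : ℝ) ^ L ≤ 2 * ((q : ℝ) + 2) ^ 8 ∧ 1 ≤ L ∧ 8 * (q * L + 1) ≤ 2 ^ L := by
  set l := Real.logb 2 ((q : ℝ) + 2) with hl
  have hq' : (1 : ℝ) ≤ q := by exact_mod_cast hq
  have hs : (0 : ℝ) < (q : ℝ) + 2 := by positivity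
  have hl1 : 1 ≤ l := by
    rw [hl, Real.le_logb_iff_rpow_le (by norm_num) hs, Real.rpow_one]; linarith
  have hLlo : 8 * l ≤ L := by rw [hL]; exact Nat.le_ceil _
  have hLhi : (L : ℝ) < 8 * l + 1 := by rw [hL]; exact Nat.ceil_lt_add_one (by linarith)
  have h2l : (2 : ℝ) ^ l = (q : ℝ) + 2 := Real.rpow_logb (by norm_num) (by norm_num) hs
  have h8 : (2 : ℝ) ^ (8 * l) = ((q : ℝ) + 2) ^ 8 := by
    rw [mul_comm, Real.rpow_mul (by norm_num), h2l]; norm_cast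
  have hlo : ((q : ℝ) + 2) ^ 8 ≤ 2 ^ L := by
    rw [← h8, ← Real.rpow_natCast]
    exact Real.rpow_le_rpow_of_exponent_le (by norm_num) hLlo
  have hls : l ≤ (q : ℝ) + 2 := by
    rw [← h2l]
    have h0 : Real.log 2 * l < Real.exp (Real.log 2 * l) := by
      have := Real.add_one_le_exp (Real.log 2 * l); linarith
    rw [Real.rpow_def_of_pos (by norm_num)]
    have e1 : Real.exp (Real.log 2 * l) = 2 * Real.exp (Real.log 2 * (l - 1)) := by
      rw [mul_sub, mul_one, Real.exp_sub, Real.exp_log (by norm_num)]; ring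
    have h3 := Real.add_one_le_exp (Real.log 2 * (l - 1))
    have h4 : (0.5 : ℝ) ≤ Real.log 2 := by have := Real.log_two_gt_d9; linarith
    rw [e1]
    nlinarith
  refine ⟨hl1, by linarith, ?_, ?_, ?_⟩
  · rw [← h8, ← Real.rpow_natCast]
    calc (2 : ℝ) ^ (L : ℝ) ≤ 2 ^ (8 * l + 1) :=
          Real.rpow_le_rpow_of_exponent_le (by norm_num) hLhi.le
      _ = _ := by rw [Real.rpow_add (by norm_num), Real.rpow_one]; ring
  · have : (1 : ℝ) ≤ L := by linarith
    exact_mod_cast this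
  · have hL9 : (L : ℝ) ≤ 9 * ((q : ℝ) + 2) := by linarith
    have hLr : (1 : ℝ) ≤ L := by linarith
    have : (8 : ℝ) * (q * L + 1) ≤ 2 ^ L := by
      refine le_trans ?_ hlo
      have h1 : (q : ℝ) * L + 1 ≤ ((q : ℝ) + 2) * L := by nlinarith
      have h2 : ((q : ℝ) + 2) * L ≤ 9 * ((q : ℝ) + 2) ^ 2 := by nlinarith
      have h3 : (3 : ℝ) ^ 6 ≤ ((q : ℝ) + 2) ^ 6 := by gcongr; linarith
      have h4 : ((q : ℝ) + 2) ^ 8 = ((q : ℝ) + 2) ^ 6 * ((q : ℝ) + 2) ^ 2 := by ring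
      rw [h4]
      have h5 : (0 : ℝ) < ((q : ℝ) + 2) ^ 2 := by positivity
      nlinarith
    exact_mod_cast this

lemma T_bound (Q : ℕ) (δ y lr X p T : ℝ) (hδ : 0 < δ) (hy : 1 ≤ y) (hX0 : 0 ≤ X)
    (hQy : (Q : ℝ) ≤ y) (hX : X ≤ y ^ 13) (hp : p = Real.exp (-(4 * lr)))
    (h1 : 4 * lr * Q * (Q + 1) ≤ y / 4)
    (h2 : Real.log (1 / δ) + Real.log y + 13 * (Q + 1) * Real.log y ≤ y / 4)
    (hT : T = Q / δ * (X / p ^ Q) ^ (Q + 1)) : T ≤ Real.exp (y / 2) := by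
  have hy0 : 0 < y := by linarith
  have hpQ : p ^ Q = Real.exp (-(4 * lr * Q)) := by
    rw [hp, ← Real.exp_nat_mul]; congr 1; ring
  have e1 : X / p ^ Q = X * Real.exp (4 * lr * Q) := by
    rw [hpQ, Real.exp_neg, div_inv_eq_mul]
  have e2 : X / p ^ Q ≤ Real.exp (13 * Real.log y + 4 * lr * Q) := by
    rw [e1, Real.exp_add]
    have : Real.exp (13 * Real.log y) = y ^ 13 := by
      rw [show (13 : ℝ) * Real.log y = ((13 : ℕ) : ℝ) * Real.log y by norm_num,
        Real.exp_nat_mul, Real.exp_log hy0]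
    rw [this]
    gcongr
  have e3 : (Q : ℝ) / δ ≤ Real.exp (Real.log (1 / δ) + Real.log y) := by
    rw [Real.exp_add, Real.exp_log (by positivity), Real.exp_log hy0]
    rw [one_div, inv_mul_eq_div]
    gcongr
  have e4 : 0 ≤ X / p ^ Q := by rw [e1]; positivity
  rw [hT]
  calc Q / δ * (X / p ^ Q) ^ (Q + 1) ≤ Real.exp (Real.log (1 / δ) + Real.log y) *
        (Real.exp (13 * Real.log y + 4 * lr * Q)) ^ (Q + 1) := by gcongr
    _ = Real.exp (Real.log (1 / δ) + Real.log y + (Q + 1) * (13 * Real.log y + 4 * lr * Q)) := by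
      rw [← Real.exp_nat_mul, ← Real.exp_add]; push_cast; rfl
    _ ≤ _ := by
      apply Real.exp_le_exp.mpr
      nlinarith

open Filter in
lemma eventually_log_le (ε : ℝ) (hε : 0 < ε) :
    ∀ᶠ y : ℝ in atTop, Real.log y ≤ ε * √y := by
  have h := (isLittleO_log_rpow_atTop (r := 1 / 2) (by norm_num)).bound hε
  filter_upwards [h, eventually_ge_atTop 1] with y hy h1
  rw [← Real.sqrt_eq_rpow, Real.norm_eq_abs, Real.norm_eq_abs,
    abs_of_nonneg (Real.sqrt_nonneg y)] at hy
  exact (le_abs_self _).trans hy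

open Filter in
lemma eventually_y (δ A : ℝ) (hA : 0 ≤ A) :
    ∀ᶠ y : ℝ in atTop, 168 ≤ y ∧ A * √y + 2 ≤ y ∧
      Real.log (1 / δ) + Real.log y + 13 * (A * √y + 1) * Real.log y ≤ y / 4 := by
  have hε : 0 < 1 / (8 * 13 * (A + 2)) := by positivity
  filter_upwards [eventually_log_le _ hε, eventually_log_le (1 / 16) (by norm_num),
    eventually_ge_atTop 168, eventually_ge_atTop ((A + 2) ^ 2),
    eventually_ge_atTop (16 * Real.log (1 / δ))] with y h1 h2 h3 h4 h5
  have hs : √y * √y = y := Real.mul_self_sqrt (by linarith)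
  have hs1 : 1 ≤ √y := by rw [Real.one_le_sqrt]; linarith
  have hsA : A + 2 ≤ √y := Real.le_sqrt_of_sq_le h4
  refine ⟨h3, by nlinarith, ?_⟩
  have hl : 0 ≤ Real.log y := Real.log_nonneg (by linarith)
  have h6 : 13 * (A * √y + 1) * Real.log y ≤ y / 8 := by
    calc 13 * (A * √y + 1) * Real.log y ≤ 13 * ((A + 2) * √y) * (1 / (8 * 13 * (A + 2)) * √y) := by
          gcongr
          nlinarith
      _ = (√y * √y) / 8 := by field_simp
      _ = y / 8 := by rw [hs]
  have h7 : Real.log y ≤ y / 16 := by nlinarith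
  linarith

open Filter in
lemma eventually_k (η : ℝ) (hη : 0 < η) :
    ∀ᶠ x : ℝ in atTop,
      Real.log 2 + (8 * √x + 2) * Real.log (x + 1) < x * η := by
  have hε : 0 < η / 40 := by positivity
  filter_upwards [eventually_log_le _ hε, eventually_ge_atTop 2,
    eventually_gt_atTop (2 / η)] with x h1 h2 h3
  have hs : √x * √x = x := Real.mul_self_sqrt (by linarith)
  have hs1 : 1 ≤ √x := by rw [Real.one_le_sqrt]; linarith
  have hl : 0 ≤ Real.log x := Real.log_nonneg (by linarith)
  have h4 : Real.log (x + 1) ≤ 2 * Real.log x := by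
    have : 2 * Real.log x = Real.log (x ^ 2) := by rw [Real.log_pow]; norm_num
    rw [this]
    apply Real.log_le_log (by linarith)
    nlinarith
  have h5 : (8 * √x + 2) * Real.log (x + 1) ≤ x * η / 2 := by
    calc (8 * √x + 2) * Real.log (x + 1) ≤ (10 * √x) * (2 * (η / 40 * √x)) := by
          gcongr
          · exact Real.log_nonneg (by linarith)
          · linarith
          · linarith
      _ = (√x * √x) * η / 2 := by ring
      _ = _ := by rw [hs]
  have h6 : Real.log 2 < 1 := by have := Real.log_two_lt_d9; linarith
  rw [div_lt_iff₀ hη] at h3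
  linarith

lemma one_add_le (v : ℝ) (h0 : 0 ≤ v) (h1 : v ≤ 1) : Real.log (1 + v ^ 2) ≤ v * Real.log 2 := by
  have hb : (2 : ℝ) ^ (1 - v) ≤ 1 + (1 - v) * 1 := by
    have := rpow_one_add_le_one_add_mul_self (s := 1) (by norm_num) (p := 1 - v)
      (by linarith) (by linarith)
    norm_num at this ⊢
    linarith
  have hpos : (0 : ℝ) < 2 ^ (1 - v) := by positivity
  have hlog : (1 - v) * Real.log 2 ≤ Real.log (2 - v) := by
    rw [← Real.log_rpow (by norm_num)]
    apply Real.log_le_log hpos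
    linarith
  have h3 : Real.log (1 + v ^ 2) + Real.log (2 - v) ≤ Real.log 2 := by
    rw [← Real.log_mul (by positivity) (by linarith)]
    apply Real.log_le_log
    · have : 0 < 2 - v := by linarith
      positivity
    · nlinarith [mul_nonneg h0 (sq_nonneg (1 - v))]
  linarith

set_option maxHeartbeats 2000000 in
lemma main_bound (δ : ℝ) (hδ : 0 < δ) (hδ1 : δ < 1) :
    ∃ k₀ : ℕ, ∀ k : ℕ, k₀ ≤ k →
    ∀ (n q : ℕ) (C : ((Fin k) → Bool) → ((Fin n) → Bool))
      (D : Fin k → Multiset (DTree Bool n (Option Bool))),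
      Function.Injective C →
      (∀ x y : (Fin k) → Bool, x ≠ y → 2 * δ < relDist (C x) (C y)) →
      (∀ i, D i ≠ 0) →
      (∀ i, ∀ t ∈ D i, DTree.depth t ≤ q) →
      (∀ (i : Fin k) (x : (Fin k) → Bool), 2/3 ≤ prP (D i) (C x) (· = some (x i))) →
      (∀ (i : Fin k) (x : (Fin k) → Bool) (w : (Fin n) → Bool),
        relDist w (C x) ≤ δ →
          2/3 ≤ prP (D i) w (fun o => o = some (x i) ∨ o = none)) →
      (k : ℝ) ^ (1 + 1 / ((2592 : ℝ) * (q : ℝ) ^ 2 * (Real.logb 2 ((q : ℝ) + 2)) ^ 2)) ≤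
        (n : ℝ) := by
  have hlδ : 0 < Real.log (1 + δ) := Real.log_pos (by linarith)
  set A : ℝ := 9 * √(1 / (2592 * Real.log (1 + δ))) with hA
  have hA0 : 0 ≤ A := by positivity
  set u0 : ℝ := 1 / (1 + δ) with hu0
  have hu01 : u0 < 1 := by rw [hu0, div_lt_one (by linarith)]; linarith
  have hl2 : 0 < Real.log 2 := Real.log_pos (by norm_num)
  have hη : 0 < (1 - u0) * Real.log 2 := mul_pos (by linarith) hl2
  have ev1 := (Real.tendsto_log_atTop.comp tendsto_natCast_atTop_atTop).eventually
    (eventually_y δ A hA0)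
  have ev2 := (tendsto_natCast_atTop_atTop (R := ℝ)).eventually (eventually_k _ hη)
  have ev3 := (tendsto_natCast_atTop_atTop (R := ℝ)).eventually
    (Filter.eventually_gt_atTop (1 / δ))
  have ev4 := Filter.eventually_ge_atTop (2 : ℕ)
  obtain ⟨k₀, hk₀⟩ := Filter.eventually_atTop.mp (ev1.and (ev2.and (ev3.and ev4)))
  refine ⟨k₀, fun k hk n q C D hinj hdist hD0 hdep hcomp hrel => ?_⟩
  obtain ⟨⟨hy168, hAy, hyle⟩, hkη, hkδ, hk2⟩ := hk₀ k hk
  simp only [Function.comp] at hy168 hAy hyle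
  set y := Real.log k with hy
  have hk0 : (0 : ℝ) < k := by
    have : 0 < k := by omega
    exact_mod_cast this
  have hexpy : Real.exp y = k := Real.exp_log hk0
  have hkn : k ≤ n := by
    have := Fintype.card_le_of_injective _ hinj
    simp only [Fintype.card_fun, Fintype.card_bool, Fintype.card_fin] at this
    exact (Nat.pow_le_pow_iff_right (by norm_num)).mp this
  rcases Nat.eq_zero_or_pos q with rfl | hq
  · simp only [Nat.cast_zero]
    norm_num
    exact hkn
  set l := Real.logb 2 ((q : ℝ) + 2) with hl
  obtain ⟨L, hLdef⟩ : ∃ L, L = ⌈8 * Real.logb 2 ((q : ℝ) + 2)⌉₊ := ⟨_, rfl⟩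
  obtain ⟨hl1, hL9, hL2, hL1, hL8⟩ := params hq hLdef
  rw [← hl] at hl1 hL9
  have hq' : (1 : ℝ) ≤ q := by exact_mod_cast hq
  set s : ℝ := 2592 * (q : ℝ) ^ 2 * l ^ 2 with hs
  have hs0 : 0 < s := by positivity
  have hs1 : 1 ≤ s := by
    have h1 : 1 ≤ (q : ℝ) ^ 2 := one_le_pow₀ hq'
    have h2 : 1 ≤ l ^ 2 := one_le_pow₀ hl1
    have := one_le_mul_of_one_le_of_one_le h1 h2
    rw [hs]; linarith
  set lr : ℝ := y / s with hlr
  have hy0 : 0 < y := by linarith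
  have hlr0 : 0 < lr := by positivity
  have hlry : lr ≤ y := div_le_self hy0.le hs1
  have hgoal : (k : ℝ) ^ (1 + 1 / s) = k * Real.exp lr := by
    rw [Real.rpow_add hk0, Real.rpow_one, Real.rpow_def_of_pos hk0, ← hy, mul_one_div]
  rw [hgoal]
  by_contra hcon
  push Not at hcon
  -- trivial regime
  rcases le_or_gt (Real.exp lr) (1 + δ) with hR | hR
  · have hsb := singleton_bound (by omega) C δ hδ hdist
    have h1 : (n : ℝ) < k * (1 + δ) := hcon.trans_le (by gcongr)
    rw [div_lt_iff₀ hδ] at hkδ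
    have hk1 : (2 : ℝ) ≤ k := by exact_mod_cast hk2
    have h2 : 0 < 1 - 2 * δ := by
      by_contra h
      push Not at h
      have : (n : ℝ) * (1 - 2 * δ) ≤ 0 := mul_nonpos_of_nonneg_of_nonpos (by positivity) h
      linarith
    have h3 : (n : ℝ) * (1 - 2 * δ) ≤ k * (1 + δ) * (1 - 2 * δ) := by gcongr
    nlinarith [mul_pos hk0 (mul_pos hδ hδ)]
  -- main regime
  have hδlr : Real.log (1 + δ) < lr := by
    rw [Real.log_lt_iff_lt_exp (by linarith)]; exact hR
  have hlpos : 0 < l := by linarith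
  have hQA : ((q * L : ℕ) : ℝ) ≤ A * √y := by
    have h1 : (q * l) ^ 2 ≤ 1 / (2592 * Real.log (1 + δ)) * y := by
      rw [hlr, lt_div_iff₀ hs0] at hδlr
      rw [one_div, inv_mul_eq_div, le_div_iff₀ (by positivity)]
      rw [hs] at hδlr
      nlinarith
    have h2 : q * l ≤ √(1 / (2592 * Real.log (1 + δ)) * y) := Real.le_sqrt_of_sq_le h1
    rw [Real.sqrt_mul (by positivity)] at h2
    push_cast
    calc (q : ℝ) * L ≤ q * (9 * l) := by gcongr
      _ = 9 * (q * l) := by ring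
      _ ≤ 9 * (√(1 / (2592 * Real.log (1 + δ))) * √y) := by gcongr
      _ = A * √y := by rw [hA]; ring
  set p : ℝ := Real.exp (-(4 * lr)) with hp
  have hp0 : 0 < p := Real.exp_pos _
  have hp1 : p ≤ 1 := Real.exp_le_one_iff.mpr (by linarith)
  obtain ⟨lam, hlam⟩ : ∃ lam, lam = ⌈6 * y⌉₊ := ⟨_, rfl⟩
  have hlamlo : 6 * y ≤ lam := by rw [hlam]; exact Nat.le_ceil _
  have hlamhi : (lam : ℝ) ≤ 7 * y := by
    have : (lam : ℝ) < 6 * y + 1 := by rw [hlam]; exact Nat.ceil_lt_add_one (by linarith)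
    linarith
  have hk1 : (2 : ℝ) ≤ k := by exact_mod_cast hk2
  have hnlam : n + 1 ≤ 2 ^ lam := by
    have h1 : (n : ℝ) + 1 ≤ k ^ 3 := by
      have : (n : ℝ) < k * k := by
        refine hcon.trans_le ?_
        have : Real.exp lr ≤ k := by rw [← hexpy]; exact Real.exp_le_exp.mpr hlry
        gcongr
      nlinarith
    have h2 : (k : ℝ) ^ 3 ≤ 2 ^ lam := by
      rw [← hexpy, ← Real.exp_nat_mul, ← Real.rpow_natCast, Real.rpow_def_of_pos (by norm_num)]
      apply Real.exp_le_exp.mpr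
      have := Real.log_two_gt_d9
      push_cast
      nlinarith
    exact_mod_cast h1.trans h2
  set Q := q * L with hQ
  have hqQ : (q : ℝ) ≤ Q := by
    have : q ≤ q * L := Nat.le_mul_of_pos_right q (by omega)
    exact_mod_cast this
  obtain ⟨X, hX⟩ : ∃ X : ℝ, X = 12 * lam * ((Q : ℝ) + 1) ^ 2 * Q * (3 / 2) ^ L := ⟨_, rfl⟩
  obtain ⟨T, hT⟩ : ∃ T : ℝ, T = (Q : ℝ) / δ * (X / p ^ Q) ^ (Q + 1) := ⟨_, rfl⟩
  have hX0 : 0 ≤ X := by rw [hX]; positivity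
  have hQ2y : (Q : ℝ) + 2 ≤ y := by linarith
  have hXy : X ≤ y ^ 13 := by
    have h1 : (3 / 2 : ℝ) ^ L ≤ 2 * y ^ 8 := by
      calc (3 / 2 : ℝ) ^ L ≤ 2 ^ L := by gcongr; norm_num
        _ ≤ 2 * ((q : ℝ) + 2) ^ 8 := hL2
        _ ≤ 2 * y ^ 8 := by gcongr; linarith
    rw [hX]
    calc 12 * lam * ((Q : ℝ) + 1) ^ 2 * Q * (3 / 2) ^ L
        ≤ 12 * (7 * y) * y ^ 2 * y * (2 * y ^ 8) := by
          gcongr <;> linarith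
      _ = 168 * y ^ 12 := by ring
      _ ≤ y * y ^ 12 := by gcongr
      _ = y ^ 13 := by ring
  have hlogy : 0 ≤ Real.log y := Real.log_nonneg (by linarith)
  have hTk : T ≤ Real.exp (y / 2) := by
    refine T_bound Q δ y lr X p T hδ (by linarith) hX0 (by linarith) hXy hp ?_ ?_ hT
    · have hQ9 : (Q : ℝ) ≤ 9 * (q * l) := by
        rw [hQ]; push_cast
        calc (q : ℝ) * L ≤ q * (9 * l) := by gcongr
          _ = _ := by ring
      have hQ1 : (1 : ℝ) ≤ Q := by linarith
      calc 4 * lr * Q * (Q + 1) ≤ 4 * lr * Q * (Q + Q) := by gcongr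
        _ = 8 * lr * (Q * Q) := by ring
        _ ≤ 8 * lr * ((9 * (q * l)) * (9 * (q * l))) := by gcongr
        _ = y / 4 := by
          rw [hlr, hs]; field_simp; norm_num
    · refine le_trans ?_ hyle
      gcongr
  have hsqrt : Real.exp (y / 2) = √k := by
    rw [Real.sqrt_eq_rpow, Real.rpow_def_of_pos hk0, ← hy]; congr 1; ring
  have hsqk : √(k : ℝ) ≤ k := by
    rw [Real.sqrt_le_left (by linarith)]; nlinarith
  have hknr : (k : ℝ) ≤ n := by exact_mod_cast hkn
  have hTn : T ≤ n := by linarith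
  have hcore := core_s17 (by omega) hkn hq hL1 C D δ p hδ hδ1 hp0 hp1 hD0 hdep hcomp hrel hL8 hnlam T
    (by rw [hT, hX]) hTn
  have hT0 : 0 ≤ T := by rw [hT]; positivity
  -- take logarithms
  have hlog := Real.log_le_log (by positivity) hcore
  rw [Real.log_pow, Real.log_mul (by norm_num) (by positivity),
    Real.log_mul (by positivity) (by positivity), Real.log_pow, Real.log_pow] at hlog
  set v : ℝ := Real.exp (-(2 * lr)) with hv
  have hpv : p = v ^ 2 := by rw [hp, hv, ← Real.exp_nat_mul]; congr 1; push_cast; ring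
  have hv1 : v ≤ 1 := Real.exp_le_one_iff.mpr (by linarith)
  have h1p : Real.log (1 + p) ≤ v * Real.log 2 := by
    rw [hpv]; exact one_add_le v (Real.exp_pos _).le hv1
  have hnv : n * v ≤ k * u0 := by
    have h1 : n * v ≤ k * Real.exp lr * v := by
      have : 0 < v := Real.exp_pos _
      gcongr
    have h2 : k * Real.exp lr * v = k * Real.exp (-lr) := by
      rw [mul_assoc, hv, ← Real.exp_add]; congr 2; ring
    have h3 : Real.exp (-lr) ≤ u0 := by
      rw [Real.exp_neg, hu0, one_div]
      exact inv_anti₀ (by linarith) hR.le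
    rw [h2] at h1
    exact h1.trans (by gcongr)
  have hceil : ((2 * ⌈4 * T⌉₊ : ℕ) : ℝ) ≤ 8 * √k + 2 := by
    have := Nat.ceil_lt_add_one (show 0 ≤ 4 * T by linarith)
    push_cast
    linarith
  have hlk : 0 ≤ Real.log ((k : ℝ) + 1) := Real.log_nonneg (by linarith)
  have h5 : ((2 * ⌈4 * T⌉₊ : ℕ) : ℝ) * Real.log ((k : ℝ) + 1) ≤
      (8 * √k + 2) * Real.log ((k : ℝ) + 1) := by gcongr
  have h6 : (n : ℝ) * Real.log (1 + p) ≤ k * u0 * Real.log 2 := by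
    calc (n : ℝ) * Real.log (1 + p) ≤ n * (v * Real.log 2) := by gcongr
      _ = n * v * Real.log 2 := by ring
      _ ≤ _ := by gcongr
  nlinarith

end RLDC

/-- **Rate lower bound for relaxed LDCs.** There is a universal constant `c > 0` such
that for every constant `δ ∈ (0,1)` and all sufficiently large `k`: every binary code
`C : {0,1}^k → {0,1}^n` that admits a `q`-query relaxed local decoder with decoding
radius `δ` (outputs in `{0,1,⊥}`, modeled as `Option Bool` with `⊥ = none`) must have
blocklength `n ≥ k^(1 + 1/(c·q²·log₂²(q+2)))`. -/
theorem rldc_rate_lower_bound :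
    ∃ c : ℝ, 0 < c ∧
    ∀ δ : ℝ, 0 < δ → δ < 1 →
    ∃ k₀ : ℕ, ∀ k : ℕ, k₀ ≤ k →
    ∀ (n q : ℕ) (C : ((Fin k) → Bool) → ((Fin n) → Bool))
      (D : Fin k → Multiset (DTree Bool n (Option Bool))),
      Function.Injective C →
      (∀ x y : (Fin k) → Bool, x ≠ y → 2 * δ < relDist (C x) (C y)) →
      (∀ i, D i ≠ 0) →
      (∀ i, ∀ t ∈ D i, DTree.depth t ≤ q) →
      (∀ (i : Fin k) (x : (Fin k) → Bool), 2/3 ≤ prP (D i) (C x) (· = some (x i))) →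
      (∀ (i : Fin k) (x : (Fin k) → Bool) (w : (Fin n) → Bool),
        relDist w (C x) ≤ δ →
          2/3 ≤ prP (D i) w (fun o => o = some (x i) ∨ o = none)) →
      (k : ℝ) ^ (1 + 1 / (c * (q : ℝ) ^ 2 * (Real.logb 2 ((q : ℝ) + 2)) ^ 2)) ≤ (n : ℝ) := by

  exact ⟨2592, by norm_num, fun δ hδ hδ1 => RLDC.main_bound δ hδ hδ1⟩
end
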